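/- Let X be a standard Borel space, E a countable Borel equivalence relation on X, and ρ : E → (0,∞) a Borel coboundary. Then exactly one of the following holds: (1) there is a finite-to-one Borel compression of the quotient of ρ by a finite Borel subequivalence relation of E; (2) there is a ρ-invariant Borel probability measure on X. -/

import Mathlib

open MeasureTheory Set ENNReal

namespace CocycleNadkarni

variable {X : Type*} {Γ : Type*}

/-- The `ρ`-size of `Y` relative to the point `z`: `∑_{y ∈ Y} ρ(y, z)`. -/
noncomputable def eSize (ρ : X → X → ℝ) (Y : Set X) (z : X) : ℝ≥0∞ :=
  ∑' y : Y, ENNReal.ofReal (ρ y z)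

/-- The `ρ`-size of `Y` relative to the set `Z`, computed at the point `z`. -/
noncomputable def relSize (ρ : X → X → ℝ) (Y Z : Set X) (z : X) : ℝ≥0∞ :=
  eSize ρ Y z / eSize ρ Z z

/-- Real-valued `ρ`-size (used for finite sets). -/
noncomputable def rSize (ρ : X → X → ℝ) (Y : Set X) (z : X) : ℝ :=
  ∑' y : Y, ρ y z

/-- `∫_C f dμ^ρ_S`, computed at the point `z`. -/
noncomputable def avgOn (ρ : X → X → ℝ) (f : X → ℝ) (S C : Set X) (z : X) : ℝ :=
  (∑' y : ↥(S ∩ C), f y * ρ y z) / rSize ρ S z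

/-- countable Borel equivalence relation -/
def IsCBER [MeasurableSpace X] (E : X → X → Prop) : Prop :=
  Equivalence E ∧ MeasurableSet {p : X × X | E p.1 p.2} ∧ ∀ x : X, {y | E x y}.Countable

/-- Borel cocycle `ρ : E → (0, ∞)` (as a total function whose values off `E` are irrelevant). -/
def IsCocycle [MeasurableSpace X] (E : X → X → Prop) (ρ : X → X → ℝ) : Prop :=
  Measurable (fun p : X × X => ρ p.1 p.2) ∧
    (∀ ⦃x y : X⦄, E x y → 0 < ρ x y) ∧
    ∀ ⦃x y z : X⦄, E x y → E y z → ρ x z = ρ x y * ρ y z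

/-- Borel cocycle into a group `Γ`. -/
def IsGrpCocycle [MeasurableSpace X] [Group Γ] [MeasurableSpace Γ]
    (E : X → X → Prop) (ρ : X → X → Γ) : Prop :=
  Measurable (fun p : X × X => ρ p.1 p.2) ∧
    ∀ ⦃x y z : X⦄, E x y → E y z → ρ x z = ρ x y * ρ y z

/-- finite Borel subequivalence relation of `E` -/
def IsFinSubequiv [MeasurableSpace X] (E F : X → X → Prop) : Prop :=
  Equivalence F ∧ MeasurableSet {p : X × X | F p.1 p.2} ∧
    (∀ ⦃x y : X⦄, F x y → E x y) ∧ ∀ x : X, {y | F x y}.Finite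

/-- finite Borel subequivalence relation of `E` restricted to `W` (extended by the diagonal). -/
def IsFinSubequivOn [MeasurableSpace X] (E : X → X → Prop) (W : Set X)
    (F : X → X → Prop) : Prop :=
  Equivalence F ∧ MeasurableSet {p : X × X | F p.1 p.2} ∧
    (∀ ⦃x y : X⦄, F x y → x = y ∨ (E x y ∧ x ∈ W ∧ y ∈ W)) ∧ ∀ x : X, {y | F x y}.Finite

/-- `ρ`-invariance of a Borel measure. -/
def IsInvariant [MeasurableSpace X] (E : X → X → Prop) (ρ : X → X → ℝ)
    (μ : Measure X) : Prop :=
  ∀ T : X ≃ᵐ X, (∀ x, E (T x) x) → ∀ B : Set X, MeasurableSet B →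
    μ (T '' B) = ∫⁻ x in B, ENNReal.ofReal (ρ (T x) x) ∂μ

/-- invariance w.r.t. the restriction of `ρ` to a set `R` of pairs, via Borel injections
whose graphs are contained in `R⁻¹`. -/
def IsInvariantRel [MeasurableSpace X] (R : Set (X × X)) (ρ : X → X → ℝ)
    (μ : Measure X) : Prop :=
  ∀ (B : Set X) (T : X → X), MeasurableSet B → Measurable T → Set.InjOn T B →
    (∀ x ∈ B, ((T x, x) : X × X) ∈ R) →
    μ (T '' B) = ∫⁻ x in B, ENNReal.ofReal (ρ (T x) x) ∂μ

/-- a Borel ℕ-coloring of the lacunarity digraph `G^ρ_Z`. -/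
def HasColoring [MeasurableSpace X] (E : X → X → Prop) (ρ : X → X → Γ)
    (Z : Set Γ) : Prop :=
  ∃ c : X → ℕ, Measurable c ∧
    ∀ ⦃x y : X⦄, x ≠ y → E x y → ρ x y ∈ Z → c x ≠ c y

/-- smoothness of the cocycle `ρ` restricted to `E` restricted to `W`. -/
def SmoothOn [MeasurableSpace X] (E : X → X → Prop) (ρ : X → X → ℝ)
    (W : Set X) : Prop :=
  ∃ U : Set ℝ, IsOpen U ∧ (1:ℝ) ∈ U ∧ U ⊆ Set.Ioi 0 ∧
    ∃ c : X → ℕ, Measurable c ∧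
      ∀ ⦃x y : X⦄, x ∈ W → y ∈ W → x ≠ y → E x y → ρ x y ∈ U → c x ≠ c y

/-- smoothness of the cocycle `ρ` on `E`. -/
def Smooth [MeasurableSpace X] (E : X → X → Prop) (ρ : X → X → ℝ) : Prop :=
  SmoothOn E ρ Set.univ

/-- `E`-invariance of a set. -/
def EInvariant (E : X → X → Prop) (B : Set X) : Prop :=
  ∀ ⦃x y : X⦄, E x y → x ∈ B → y ∈ B

/-- a compression of `ρ` over the finite subequivalence relation `F` of `E`. -/
def CompressionOver [MeasurableSpace X] (E F : X → X → Prop) (ρ : X → X → ℝ)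
    (φ : X → X) : Prop :=
  (∀ x, E x (φ x)) ∧
  (∀ x : X, relSize ρ (φ ⁻¹' {y | F y x}) {y | F y x} x ≤ 1) ∧
  (∀ x : X, ∃ y, E x y ∧ relSize ρ (φ ⁻¹' {z | F z y}) {z | F z y} y < 1)

/-- a compression of the quotient of `ρ | E | W` by the finite subequivalence relation given
by the setoid `s`, expressed via representatives. -/
def QuotCompressionOn [MeasurableSpace X] (E : X → X → Prop) (ρ : X → X → ℝ)
    (W : Set X) (s : Setoid X) (φ : Quotient s → Quotient s) : Prop :=
  (∀ ⦃x : X⦄, x ∈ W → ∀ y : X, φ (Quotient.mk s x) = Quotient.mk s y → (E x y ∧ y ∈ W)) ∧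
  (∀ ⦃x : X⦄, x ∈ W →
    relSize ρ {y | y ∈ W ∧ φ (Quotient.mk s y) = Quotient.mk s x} {y | s.r y x} x ≤ 1) ∧
  (∀ ⦃x : X⦄, x ∈ W → ∃ y, y ∈ W ∧ E x y ∧
    relSize ρ {z | z ∈ W ∧ φ (Quotient.mk s z) = Quotient.mk s y} {z | s.r z y} y < 1)


/-- `B` has `ρ`-density at least `ε` relative to `W`. -/
def HasDensityAtLeastOn [MeasurableSpace X] (E : X → X → Prop) (ρ : X → X → ℝ)
    (B W : Set X) (ε : ℝ) : Prop :=
  ∃ F : X → X → Prop, IsFinSubequivOn E W F ∧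
    ∀ x ∈ W, ENNReal.ofReal ε ≤ relSize ρ (B ∩ {y | F y x}) {y | F y x} x

/-- `B` has positive `ρ`-density relative to `W`. -/
def HasPosDensityOn [MeasurableSpace X] (E : X → X → Prop) (ρ : X → X → ℝ)
    (B W : Set X) : Prop :=
  ∃ ε : ℝ, 0 < ε ∧ HasDensityAtLeastOn E ρ B W ε

/-- `B` has σ-positive `ρ`-density relative to `W`. -/
def HasSigmaPosDensityOn [MeasurableSpace X] (E : X → X → Prop) (ρ : X → X → ℝ)
    (B W : Set X) : Prop :=
  ∃ A : ℕ → Set X, (∀ n, MeasurableSet (A n)) ∧ (∀ n, A n ⊆ W) ∧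
    (∀ n, ∀ x ∈ A n, ∀ y ∈ W, E x y → y ∈ A n) ∧ W = ⋃ n, A n ∧
    ∀ n, HasPosDensityOn E ρ (B ∩ A n) (A n)

end CocycleNadkarni

namespace CocycleNadkarni

section LN

abbrev CS := ℕ → Bool

instance instPolishCS : PolishSpace CS :=
  letI := TopologicalSpace.metrizableSpaceMetric CS
  inferInstance

def IsGr {A B : Type*} (G : Set (A × B)) : Prop := ∀ p ∈ G, ∀ q ∈ G, p.1 = q.1 → p.2 = q.2

def SmallM (S : Set (CS × CS)) : Prop :=
  ∃ G : ℕ → Set (CS × CS), (∀ n, MeasurableSet (G n)) ∧ (∀ n, IsGr (G n)) ∧ S = ⋃ n, G n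

lemma SmallM.meas {S : Set (CS × CS)} (h : SmallM S) : MeasurableSet S := by
  obtain ⟨G, hG, -, rfl⟩ := h
  exact MeasurableSet.iUnion hG

lemma SmallM.iUnion {ι : Type*} [Countable ι] {S : ι → Set (CS × CS)} (h : ∀ i, SmallM (S i)) :
    SmallM (⋃ i, S i) := by
  rcases isEmpty_or_nonempty ι with hi | hi
  · exact ⟨fun _ => ∅, fun _ => MeasurableSet.empty, fun _ p hp => hp.elim, by simp⟩
  choose G hG hG' hS using h
  obtain ⟨e, he⟩ := exists_surjective_nat (ι × ℕ)
  refine ⟨fun n => G (e n).1 (e n).2, fun n => hG _ _, fun n => hG' _ _, ?_⟩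
  ext p
  simp only [hS, mem_iUnion]
  constructor
  · rintro ⟨i, j, h⟩
    obtain ⟨n, hn⟩ := he (i, j)
    exact ⟨n, by rw [hn]; exact h⟩
  · rintro ⟨n, h⟩
    exact ⟨_, _, h⟩

lemma SmallM.of_graph {G : Set (CS × CS)} (h : MeasurableSet G) (h' : IsGr G) : SmallM G :=
  ⟨fun _ => G, fun _ => h, fun _ => h', (iUnion_const G).symm⟩

lemma SmallM.union {S T : Set (CS × CS)} (h : SmallM S) (h' : SmallM T) : SmallM (S ∪ T) := by
  rw [union_eq_iUnion]
  exact SmallM.iUnion (fun b => by cases b <;> assumption)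

lemma SmallM.empty : SmallM ∅ :=
  ⟨fun _ => ∅, fun _ => MeasurableSet.empty, fun _ p hp => hp.elim, by simp⟩

/-- An analytic graph is contained in a Borel graph. -/
lemma analytic_graph {D : Set (CS × CS)} (hD : AnalyticSet D) (hg : IsGr D) :
    ∃ G, MeasurableSet G ∧ IsGr G ∧ D ⊆ G := by
  have hA : ∀ (m : ℕ) (b : Bool), AnalyticSet (Prod.fst '' (D ∩ {p : CS × CS | p.2 m = b})) := by
    intro m b
    apply AnalyticSet.image_of_continuous _ continuous_fst
    have : MeasurableSet {p : CS × CS | p.2 m = b} := by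
      have h : Measurable (fun p : CS × CS => p.2 m) := (measurable_pi_apply m).comp measurable_snd
      exact h (measurableSet_singleton b)
    rw [inter_eq_iInter]
    apply AnalyticSet.iInter
    rintro (_ | _)
    · exact this.analyticSet
    · exact hD
  have hs : ∀ m, ∃ Q : Set CS, Prod.fst '' (D ∩ {p : CS × CS | p.2 m = true}) ⊆ Q ∧
      Disjoint (Prod.fst '' (D ∩ {p : CS × CS | p.2 m = false})) Q ∧ MeasurableSet Q := by
    intro m
    apply (hA m true).measurablySeparable (hA m false)
    rw [Set.disjoint_left]
    rintro x ⟨p, ⟨hp, hpm⟩, rfl⟩ ⟨q, ⟨hq, hqm⟩, hqp⟩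
    have := hg p hp q hq hqp.symm
    simp only [mem_ofPred_eq] at hpm hqm
    rw [this, hqm] at hpm
    exact Bool.noConfusion hpm
  choose Q hQ1 hQ2 hQ3 using hs
  refine ⟨{p | ∀ m, p.2 m = true ↔ p.1 ∈ Q m}, ?_, ?_, ?_⟩
  · rw [ofPred_forall]
    refine MeasurableSet.iInter fun m => ?_
    have h : Measurable (fun p : CS × CS => p.2 m) := (measurable_pi_apply m).comp measurable_snd
    have h1 : MeasurableSet {p : CS × CS | p.2 m = true} := h (measurableSet_singleton true)
    have h2 : MeasurableSet {p : CS × CS | p.1 ∈ Q m} := measurable_fst (hQ3 m)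
    exact MeasurableSet.iff h1 h2
  · intro p hp q hq h
    funext m
    have h1 := hp m
    have h2 := hq m
    rw [h] at h1
    rw [Bool.eq_iff_iff, h1, h2]
  · intro p hp m
    constructor
    · intro h
      exact hQ1 m ⟨p, ⟨hp, h⟩, rfl⟩
    · intro h
      by_contra hb
      have : p.2 m = false := by simpa using hb
      exact Set.disjoint_left.1 (hQ2 m) ⟨p, ⟨hp, this⟩, rfl⟩ h

def cyl (u : List ℕ) : Set (ℕ → ℕ) := {z | ∀ i (h : i < u.length), z i = u[i]}

lemma mem_cyl_child {u : List ℕ} {z : ℕ → ℕ} (h : z ∈ cyl u) : z ∈ cyl (u ++ [z u.length]) := by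
  intro i hi
  simp only [List.length_append, List.length_singleton] at hi
  rcases Nat.lt_or_ge i u.length with h' | h'
  · rw [List.getElem_append_left h']; exact h i h'
  · have : i = u.length := by omega
    subst this
    simp

lemma cyl_anti {u v : List ℕ} (h : u <+: v) : cyl v ⊆ cyl u := by
  obtain ⟨w, rfl⟩ := h
  intro z hz i hi
  have := hz i (by simp; omega)
  rw [this, List.getElem_append_left hi]

lemma cyl_prefixed (z : ℕ → ℕ) (n : ℕ) : z ∈ cyl ((List.range n).map z) := by
  intro i hi
  simp

lemma prefix_of_mem_cyl {u : List ℕ} {z : ℕ → ℕ} (h : z ∈ cyl u) {n : ℕ} (hn : u.length ≤ n) :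
    u <+: (List.range n).map z := by
  rw [List.prefix_iff_eq_take]
  apply List.ext_getElem
  · simp [hn]
  · intro i h1 h2
    simp [h i h1]

lemma isClosed_cyl (u : List ℕ) : IsClosed (cyl u) := by
  have : cyl u = ⋂ i, ⋂ (h : i < u.length), {z | z i = u[i]} := by
    ext z; simp [cyl]
  rw [this]
  refine isClosed_iInter fun i => isClosed_iInter fun h => ?_
  exact isClosed_eq (continuous_apply i) continuous_const

/-- cylinder neighbourhoods -/
lemma exists_cyl_const {f : (ℕ → ℕ) → CS × CS} (hf : Continuous f) (z : ℕ → ℕ) (m : ℕ) :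
    ∃ n, ∀ k ≥ n, ∀ z' ∈ cyl ((List.range k).map z), (f z').2 m = (f z).2 m := by
  have hc : Continuous (fun z => (f z).2 m) := (continuous_apply m).comp (continuous_snd.comp hf)
  have ho : IsOpen {z' | (f z').2 m = (f z).2 m} := by
    exact hc.isOpen_preimage {(f z).2 m} (isOpen_discrete _)
  by_contra hcon
  push Not at hcon
  choose k hk z' hz' hne using hcon
  have ht : Filter.Tendsto z' Filter.atTop (nhds z) := by
    rw [tendsto_pi_nhds]
    intro i
    apply tendsto_const_nhds.congr'
    filter_upwards [Filter.eventually_gt_atTop i] with n hn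
    have := hz' n i (by simp; exact lt_of_lt_of_le hn (hk n))
    rw [this]; simp
  have := ht.eventually (ho.mem_nhds rfl)
  obtain ⟨n, hn⟩ := this.exists
  exact hne n hn

def Good (f : (ℕ → ℕ) → CS × CS) (a : Set (List ℕ)) : Prop :=
  ∀ S, SmallM S → ∃ x, ∀ u ∈ a, ∃ z ∈ cyl u, f z ∉ S ∧ (f z).1 = x

def Sep (f : (ℕ → ℕ) → CS × CS) (u v : List ℕ) : Prop :=
  ∃ m, ∃ b : Bool, (∀ z ∈ cyl u, (f z).2 m = b) ∧ ∀ z ∈ cyl v, (f z).2 m = !b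

lemma Good.mono {f : (ℕ → ℕ) → CS × CS} {a b : Set (List ℕ)} (h : Good f b) (hab : a ⊆ b) :
    Good f a := fun S hS => by
  obtain ⟨x, hx⟩ := h S hS
  exact ⟨x, fun u hu => hx u (hab hu)⟩

lemma Good.child {f : (ℕ → ℕ) → CS × CS} {u : List ℕ} {a : Set (List ℕ)}
    (h : Good f (insert u a)) : ∃ n, Good f (insert (u ++ [n]) a) := by
  by_contra hcon
  push Not at hcon
  have h2 : ∀ n, ∃ S, SmallM S ∧ ¬ ∃ x, ∀ v ∈ insert (u ++ [n]) a,
      ∃ z ∈ cyl v, f z ∉ S ∧ (f z).1 = x := by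
    intro n
    have := hcon n
    unfold Good at this
    push Not at this ⊢
    exact this
  choose S hS hS' using h2
  obtain ⟨x, hx⟩ := h (⋃ n, S n) (SmallM.iUnion hS)
  obtain ⟨z, hz, hzS, hzx⟩ := hx u (mem_insert _ _)
  apply hS' (z u.length)
  refine ⟨x, ?_⟩
  rintro v (rfl | hv)
  · exact ⟨z, mem_cyl_child hz, fun h => hzS (mem_iUnion.2 ⟨_, h⟩), hzx⟩
  · obtain ⟨z', h1, h2, h3⟩ := hx v (mem_insert_of_mem _ hv)
    exact ⟨z', h1, fun h => h2 (mem_iUnion.2 ⟨_, h⟩), h3⟩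

lemma Good.split {f : (ℕ → ℕ) → CS × CS} (hf : Continuous f) {u : List ℕ} {a : Set (List ℕ)}
    (h : Good f (insert u a)) : ∃ u0 u1, u <+: u0 ∧ u <+: u1 ∧ Sep f u0 u1 ∧
      Good f (insert u0 (insert u1 a)) := by
  by_contra hcon
  push Not at hcon
  have h2 : ∀ p : List ℕ × List ℕ, ∃ S, SmallM S ∧ (u <+: p.1 → u <+: p.2 → Sep f p.1 p.2 →
      ¬ ∃ x, ∀ v ∈ insert p.1 (insert p.2 a), ∃ z ∈ cyl v, f z ∉ S ∧ (f z).1 = x) := by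
    rintro ⟨p, q⟩
    by_cases h1 : u <+: p ∧ u <+: q ∧ Sep f p q
    · have := hcon p q h1.1 h1.2.1 h1.2.2
      unfold Good at this
      push Not at this
      obtain ⟨S, hS, hS'⟩ := this
      refine ⟨S, hS, fun _ _ _ => ?_⟩
      push Not
      exact hS'
    · exact ⟨∅, SmallM.empty, fun a b c => (h1 ⟨a, b, c⟩).elim⟩
  choose S' hS' hS'' using h2
  set S := ⋃ p, S' p with hSdef
  have hS : SmallM S := SmallM.iUnion hS'
  set D : Set (CS × CS) := {p | (∃ z ∈ cyl u, f z ∉ S ∧ f z = p) ∧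
    ∀ v ∈ a, ∃ z ∈ cyl v, f z ∉ S ∧ (f z).1 = p.1} with hD
  have hDg : IsGr D := by
    rintro p ⟨⟨z, hz, hzS, rfl⟩, hp⟩ q ⟨⟨z', hz', hzS', rfl⟩, hq⟩ hpq
    by_contra hne
    obtain ⟨m, hm⟩ := Function.ne_iff.1 hne
    obtain ⟨n, hn⟩ := exists_cyl_const hf z m
    obtain ⟨n', hn'⟩ := exists_cyl_const hf z' m
    have hsub : ∀ {s}, s ∉ S → ∀ i, s ∉ S' i := fun h i h' => h (mem_iUnion.2 ⟨i, h'⟩)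
    set N := max u.length (max n n')
    refine hS'' ((List.range N).map z, (List.range N).map z')
      (prefix_of_mem_cyl hz (le_max_left _ _)) (prefix_of_mem_cyl hz' (le_max_left _ _))
      ⟨m, (f z).2 m, fun w hw => hn N (by omega) w hw, fun w hw => ?_⟩ ⟨(f z).1, ?_⟩
    · rw [hn' N (by omega) w hw]
      revert hm
      cases (f z).2 m <;> cases (f z').2 m <;> simp
    · rintro v (rfl | rfl | hv)
      · exact ⟨z, cyl_prefixed _ _, hsub hzS _, rfl⟩
      · exact ⟨z', cyl_prefixed _ _, hsub hzS' _, hpq.symm⟩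
      · obtain ⟨w, h1, h2, h3⟩ := hp v hv
        exact ⟨w, h1, hsub h2 _, h3⟩
  have han : ∀ v, AnalyticSet {p | ∃ z ∈ cyl v, f z ∉ S ∧ f z = p} := by
    intro v
    have : {p | ∃ z ∈ cyl v, f z ∉ S ∧ f z = p} = f '' (cyl v ∩ f ⁻¹' Sᶜ) := by
      ext p; simp [and_assoc]
    rw [this]
    apply AnalyticSet.image_of_continuous _ hf
    apply MeasurableSet.analyticSet
    exact (isClosed_cyl v).measurableSet.inter (hf.measurable hS.meas.compl)
  have hDa : AnalyticSet D := by
    have hDeq : D = ⋂ o : Option a, (match o with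
      | none => {p | ∃ z ∈ cyl u, f z ∉ S ∧ f z = p}
      | some v => Prod.fst ⁻¹' (Prod.fst '' {p | ∃ z ∈ cyl v.1, f z ∉ S ∧ f z = p})) := by
      ext p
      rw [mem_iInter, Option.forall]
      refine and_congr Iff.rfl ?_
      simp only [Subtype.forall, mem_preimage, mem_image, mem_ofPred_eq]
      refine forall_congr' fun v => forall_congr' fun hv => ?_
      constructor
      · rintro ⟨z, hz, h1, h2⟩
        exact ⟨_, ⟨z, hz, h1, rfl⟩, h2⟩
      · rintro ⟨_, ⟨z, hz, h1, rfl⟩, h2⟩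
        exact ⟨z, hz, h1, h2⟩
    rw [hDeq]
    apply AnalyticSet.iInter
    rintro (_ | v)
    · exact han u
    · exact ((han v.1).image_of_continuous continuous_fst).preimage continuous_fst
  obtain ⟨G, hG, hG', hDG⟩ := analytic_graph hDa hDg
  obtain ⟨x, hx⟩ := h (S ∪ G) (hS.union (SmallM.of_graph hG hG'))
  obtain ⟨z, hz, hzS, hzx⟩ := hx u (mem_insert _ _)
  apply hzS
  right
  apply hDG
  refine ⟨⟨z, hz, fun h => hzS (Or.inl h), rfl⟩, ?_⟩
  intro v hv
  obtain ⟨z', h1, h2, h3⟩ := hx v (mem_insert_of_mem _ hv)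
  exact ⟨z', h1, fun h => h2 (Or.inl h), h3.trans hzx.symm⟩

lemma Good.split' {f : (ℕ → ℕ) → CS × CS} (hf : Continuous f) {u : List ℕ} {a : Set (List ℕ)}
    (h : Good f (insert u a)) : ∃ u0 u1, (u <+: u0 ∧ u.length < u0.length) ∧
      (u <+: u1 ∧ u.length < u1.length) ∧ Sep f u0 u1 ∧
      Good f (insert u0 (insert u1 a)) := by
  obtain ⟨n, hn⟩ := h.child
  obtain ⟨u0, u1, h0, h1, hs, hg⟩ := hn.split hf
  have e0 := h0.length_le
  have e1 := h1.length_le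
  simp at e0 e1
  exact ⟨u0, u1, ⟨(List.prefix_append _ _).trans h0, by omega⟩,
    ⟨(List.prefix_append _ _).trans h1, by omega⟩, hs, hg⟩

lemma Good.step {f : (ℕ → ℕ) → CS × CS} (hf : Continuous f) {κ : Type*} [DecidableEq κ]
    (v : κ → List ℕ) (s : Finset κ) : ∀ a : Set (List ℕ), Good f (a ∪ v '' s) →
    ∃ w : κ → Bool → List ℕ, (∀ i ∈ s, ∀ b, v i <+: w i b ∧ (v i).length < (w i b).length) ∧
      (∀ i ∈ s, Sep f (w i false) (w i true)) ∧
      Good f (a ∪ {u | ∃ i ∈ s, ∃ b, w i b = u}) := by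
  induction s using Finset.induction_on with
  | empty =>
    intro a h
    exact ⟨fun _ _ => [], by simp, by simp, h.mono (by simp)⟩
  | insert i s hi ih =>
    intro a h
    have : a ∪ v '' ↑(insert i s) = insert (v i) (a ∪ v '' s) := by
      ext z; simp [image_insert_eq]
    rw [this] at h
    obtain ⟨u0, u1, h0, h1, hs, hg⟩ := h.split' hf
    have : insert u0 (insert u1 (a ∪ v '' s)) = (insert u0 (insert u1 a)) ∪ v '' s := by
      ext z; simp [or_assoc]
    rw [this] at hg
    obtain ⟨w, hw1, hw2, hw3⟩ := ih _ hg
    refine ⟨fun j b => if j = i then (if b then u1 else u0) else w j b, ?_, ?_, ?_⟩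
    · intro j hj b
      by_cases hji : j = i
      · subst hji
        cases b
        · simpa using h0
        · simpa using h1
      · simp only [hji, if_false]
        exact hw1 j ((Finset.mem_insert.1 hj).resolve_left hji) b
    · intro j hj
      by_cases hji : j = i
      · simpa [hji] using hs
      · simp only [hji, if_false]
        exact hw2 j ((Finset.mem_insert.1 hj).resolve_left hji)
    · apply hw3.mono
      rintro z (hz | ⟨j, hj, b, hz⟩)
      · simp [hz]
      · by_cases hji : j = i
        · cases b <;> simp [hji] at hz <;> simp [hz]
        · simp only [hji, if_false] at hz
          right
          exact ⟨j, (Finset.mem_insert.1 hj).resolve_left hji, b, hz⟩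

def codes : ℕ → Finset (List Bool)
  | 0 => {[]}
  | n + 1 => (codes n).image (List.cons true) ∪ (codes n).image (List.cons false)

def rcode (α : ℕ → Bool) : ℕ → List Bool
  | 0 => []
  | n + 1 => α n :: rcode α n

lemma rcode_mem (α : ℕ → Bool) (n : ℕ) : rcode α n ∈ codes n := by
  induction n with
  | zero => simp [rcode, codes]
  | succ n ih =>
    simp only [rcode, codes, Finset.mem_union, Finset.mem_image]
    cases h : α n
    · right; exact ⟨_, ih, rfl⟩
    · left; exact ⟨_, ih, rfl⟩

lemma rcode_congr {α β : ℕ → Bool} {n : ℕ} (h : ∀ i < n, α i = β i) : rcode α n = rcode β n := by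
  induction n with
  | zero => rfl
  | succ n ih => simp [rcode, ih (fun i hi => h i (by omega)), h n (by omega)]

lemma Good.contra {f : (ℕ → ℕ) → CS × CS} (hf : Continuous f) (h : Good f {[]})
    (hc : ∀ x, {y | (x, y) ∈ range f}.Countable) : False := by
  classical
  -- build the scheme
  let P : (n : ℕ) → (List Bool → List ℕ) → Prop := fun n v => Good f (v '' (codes n))
  have hstep : ∀ n (v : {v // P n v}), ∃ v' : {v // P (n+1) v},
      (∀ i ∈ codes n, ∀ b, v.1 i <+: v'.1 (b :: i) ∧ (v.1 i).length < (v'.1 (b :: i)).length) ∧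
      (∀ i ∈ codes n, Sep f (v'.1 (false :: i)) (v'.1 (true :: i))) := by
    rintro n ⟨v, hv⟩
    obtain ⟨w, h1, h2, h3⟩ := Good.step hf v (codes n) ∅ (by simpa using hv)
    refine ⟨⟨fun l => match l with | [] => [] | b :: i => w i b, ?_⟩, h1, h2⟩
    apply h3.mono
    rintro z ⟨l, hl, rfl⟩
    right
    simp only [codes, Finset.coe_union, Finset.coe_image, mem_union, mem_image] at hl
    rcases hl with ⟨i, hi, rfl⟩ | ⟨i, hi, rfl⟩
    · exact ⟨i, hi, true, rfl⟩
    · exact ⟨i, hi, false, rfl⟩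
  choose nx hnx1 hnx2 using hstep
  let V : (n : ℕ) → {v // P n v} := fun n => Nat.rec ⟨fun _ => [], h.mono (by simp)⟩ (fun n v => nx n v) n
  have hV : ∀ n, V (n+1) = nx n (V n) := fun n => rfl
  let U : (ℕ → Bool) → ℕ → List ℕ := fun α n => (V n).1 (rcode α n)
  have hU1 : ∀ α n, U α n <+: U α (n+1) := fun α n => by
    have := (hnx1 n (V n) _ (rcode_mem α n) (α n)).1
    exact this
  have hU2 : ∀ α n, (U α n).length < (U α (n+1)).length := fun α n => by
    have := (hnx1 n (V n) _ (rcode_mem α n) (α n)).2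
    exact this
  have hUm : ∀ α n k, U α n <+: U α (n+k) := fun α n k => by
    induction k with
    | zero => exact List.prefix_refl _
    | succ k ih => exact ih.trans (hU1 α (n+k))
  have hUl : ∀ α n, n ≤ (U α n).length := fun α n => by
    induction n with
    | zero => simp
    | succ n ih => have := hU2 α n; omega
  let z : (ℕ → Bool) → ℕ → ℕ := fun α i => (U α (i+1))[i]'(by have := hUl α (i+1); omega)
  have hz : ∀ α n, z α ∈ cyl (U α n) := by
    intro α n i hi
    simp only [z]
    have a1 := hUm α n (i+1)
    have a2 := hUm α (i+1) n
    have e1 := List.IsPrefix.getElem a1 hi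
    have e2 := List.IsPrefix.getElem a2 (by have := hUl α (i+1); omega : i < (U α (i+1)).length)
    rw [e1, e2]
    congr 1
    rw [add_comm]
  choose x hx using fun n => (V n).2 ∅ SmallM.empty
  have hlim : ∀ α, Filter.Tendsto x Filter.atTop (nhds (f (z α)).1) := by
    intro α
    have : ∀ n, ∃ w ∈ cyl (U α n), (f w).1 = x n := by
      intro n
      obtain ⟨w, h1, h2, h3⟩ := hx n (U α n) ⟨_, rcode_mem α n, rfl⟩
      exact ⟨w, h1, h3⟩
    choose w hw hwx using this
    have ht : Filter.Tendsto w Filter.atTop (nhds (z α)) := by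
      rw [tendsto_pi_nhds]
      intro i
      apply tendsto_const_nhds.congr'
      filter_upwards [Filter.eventually_gt_atTop i] with n hn
      have hi : i < (U α n).length := lt_of_lt_of_le hn (hUl α n)
      rw [hw n i hi, hz α n i hi]
    have := ((continuous_fst.comp hf).tendsto (z α)).comp ht
    refine this.congr fun n => ?_
    exact hwx n
  have hxe : ∀ α, (f (z α)).1 = (f (z fun _ => false)).1 := fun α =>
    tendsto_nhds_unique (hlim α) (hlim _)
  have hinj : Function.Injective (fun α => (f (z α)).2) := by
    intro α β hαβ
    by_contra hne
    have hex : ∃ n, α n ≠ β n := Function.ne_iff.1 hne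
    let n := Nat.find hex
    have hn : α n ≠ β n := Nat.find_spec hex
    have hlt : ∀ i < n, α i = β i := fun i hi => by
      have := Nat.find_min hex hi
      simpa using this
    have hrc := rcode_congr hlt
    have hs := hnx2 n (V n) _ (rcode_mem α n)
    rw [← hV] at hs
    obtain ⟨m, b, h1, h2⟩ := hs
    have ha := hz α (n+1)
    have hb := hz β (n+1)
    simp only [U, rcode, ← hrc] at ha hb
    have hab : (f (z α)).2 m = (f (z β)).2 m := by
      have := congrFun hαβ m
      exact this
    generalize α n = p at hn ha
    generalize β n = q at hn hb
    cases p <;> cases q <;> simp at hn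
    · rw [h1 _ ha, h2 _ hb] at hab
      cases b <;> simp at hab
    · rw [h2 _ ha, h1 _ hb] at hab
      cases b <;> simp at hab
  have := hc (f (z fun _ => false)).1
  have hsub : range (fun α => (f (z α)).2) ⊆ {y | ((f (z fun _ => false)).1, y) ∈ range f} := by
    rintro _ ⟨α, rfl⟩
    exact ⟨z α, by rw [← hxe α]⟩
  have h3 := this.mono hsub
  have h4 : (univ : Set (ℕ → Bool)).Countable := by
    have := h3.preimage_of_injOn (f := fun α => (f (z α)).2) hinj.injOn
    simpa using this
  haveI := Set.countable_univ_iff.1 h4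
  obtain ⟨e, he⟩ := exists_surjective_nat (ℕ → Bool)
  obtain ⟨n, hn⟩ := he (fun k => !(e k k))
  have := congrFun hn n
  cases h : e n n <;> simp [h] at this

theorem lusin_novikov_cantor {R : Set (CS × CS)} (hR : MeasurableSet R)
    (hc : ∀ x, {y | (x, y) ∈ R}.Countable) :
    ∃ G : ℕ → Set (CS × CS), (∀ n, MeasurableSet (G n)) ∧ (∀ n, IsGr (G n)) ∧ R = ⋃ n, G n := by
  suffices h : ∃ S, SmallM S ∧ R ⊆ S by
    obtain ⟨S, ⟨G, h1, h2, rfl⟩, hS⟩ := h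
    refine ⟨fun n => R ∩ G n, fun n => hR.inter (h1 n),
      fun n p hp q hq => h2 n p hp.2 q hq.2, ?_⟩
    rw [← inter_iUnion, inter_eq_left.2 hS]
  rcases R.eq_empty_or_nonempty with rfl | hne
  · exact ⟨∅, SmallM.empty, subset_rfl⟩
  have hRa := hR.analyticSet
  rw [AnalyticSet] at hRa
  obtain rfl | ⟨f, hf, rfl⟩ := hRa
  · exact absurd hne (by simp)
  by_contra hcon
  push Not at hcon
  refine Good.contra hf ?_ hc
  intro S hS
  have := hcon S hS
  rw [not_subset] at this
  obtain ⟨_, ⟨z, rfl⟩, hz⟩ := this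
  refine ⟨(f z).1, ?_⟩
  rintro u rfl
  exact ⟨z, by intro i hi; simp at hi, hz, rfl⟩

end LN

end CocycleNadkarni

namespace CocycleNadkarni

section FM

variable {X : Type*} [MeasurableSpace X] [StandardBorelSpace X]

lemma exists_involution {Q : Set (X × X)} (hQ : MeasurableSet Q)
    (hs : ∀ x y, (x, y) ∈ Q → (y, x) ∈ Q) (hg : IsGr Q) :
    ∃ T : X ≃ᵐ X, (∀ x y, (x, y) ∈ Q → T x = y) ∧ (∀ x, T x = x ∨ (x, T x) ∈ Q) ∧
      ∀ x, T (T x) = x := by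
  classical
  let t : X → X := fun x => if h : ∃ y, (x, y) ∈ Q then h.choose else x
  have h1 : ∀ x y, (x, y) ∈ Q → t x = y := by
    intro x y hxy
    have h : ∃ y, (x, y) ∈ Q := ⟨y, hxy⟩
    simp only [t, dif_pos h]
    exact hg _ h.choose_spec _ hxy rfl
  have h2 : ∀ x, (t x = x ∧ ¬ ∃ y, (x, y) ∈ Q) ∨ (x, t x) ∈ Q := by
    intro x
    by_cases h : ∃ y, (x, y) ∈ Q
    · right
      obtain ⟨y, hy⟩ := h
      rw [h1 x y hy]; exact hy
    · left; exact ⟨by simp only [t, dif_neg h], h⟩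
  have h3 : ∀ x, t (t x) = x := by
    intro x
    rcases h2 x with h | h
    · rw [h.1, h.1]
    · exact h1 _ _ (hs _ _ h)
  have hinj : InjOn Prod.fst Q := by
    intro p hp q hq h
    exact Prod.ext h (hg p hp q hq h)
  have hmi : ∀ A : Set X, MeasurableSet A → MeasurableSet (Prod.fst '' (Q ∩ Prod.snd ⁻¹' A)) := by
    intro A hA
    exact (hQ.inter (measurable_snd hA)).image_of_measurable_injOn measurable_fst
      (hinj.mono inter_subset_left)
  have hm : Measurable t := by
    intro A hA
    have : t ⁻¹' A = (Prod.fst '' (Q ∩ Prod.snd ⁻¹' A)) ∪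
        ((Prod.fst '' (Q ∩ Prod.snd ⁻¹' univ))ᶜ ∩ A) := by
      ext x
      constructor
      · intro hx
        rcases h2 x with h | h
        · right
          refine ⟨?_, by rw [mem_preimage, h.1] at hx; exact hx⟩
          rintro ⟨⟨a, b⟩, ⟨hab, -⟩, rfl⟩
          exact h.2 ⟨b, hab⟩
        · left
          exact ⟨(x, t x), ⟨h, hx⟩, rfl⟩
      · rintro (⟨⟨a, b⟩, ⟨hab, hb⟩, rfl⟩ | ⟨hx, hxA⟩)
        · change t a ∈ A
          rw [h1 a b hab]; exact hb
        · rcases h2 x with h | h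
          · change t x ∈ A
            rw [h.1]; exact hxA
          · exact (hx ⟨(x, t x), ⟨h, trivial⟩, rfl⟩).elim
    rw [this]
    exact (hmi A hA).union ((hmi univ MeasurableSet.univ).compl.inter hA)
  refine ⟨⟨⟨t, t, h3, h3⟩, hm, hm⟩, h1, fun x => ?_, h3⟩
  rcases h2 x with h | h
  · exact Or.inl h.1
  · exact Or.inr h

theorem feldman_moore {E : X → X → Prop} (hE : IsCBER E) :
    ∃ γ : ℕ → X ≃ᵐ X, (∀ x y, E x y ↔ ∃ n, γ n x = y) ∧ ∀ n x, γ n (γ n x) = x := by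
  obtain ⟨hEq, hEm, hEc⟩ := hE
  obtain ⟨ι, hι, hιi⟩ := MeasurableSpace.measurable_injection_nat_bool_of_countablySeparated X
  have hemb : MeasurableEmbedding (Prod.map ι ι) := by
    apply Measurable.measurableEmbedding
    · exact (hι.comp measurable_fst).prodMk (hι.comp measurable_snd)
    · exact hιi.prodMap hιi
  set ER : Set (X × X) := {p | E p.1 p.2} with hER
  obtain ⟨G, hG, hG', hRG⟩ := lusin_novikov_cantor (R := Prod.map ι ι '' ER)
    (hemb.measurableSet_image.2 hEm) (by
      intro a
      by_cases ha : ∃ x, ι x = a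
      · obtain ⟨x, rfl⟩ := ha
        apply ((hEc x).image ι).mono
        rintro b ⟨⟨x', y⟩, hxy, h⟩
        simp only [Prod.map_apply, Prod.mk.injEq] at h
        obtain rfl := hιi h.1
        exact ⟨y, hxy, h.2⟩
      · convert Set.countable_empty
        ext b
        simp only [mem_ofPred_eq, mem_empty_iff_false, iff_false]
        rintro ⟨⟨x', y⟩, hxy, h⟩
        simp only [Prod.map_apply, Prod.mk.injEq] at h
        exact ha ⟨x', h.1⟩)
  set H : ℕ → Set (X × X) := fun n => Prod.map ι ι ⁻¹' G n with hH
  have hHm : ∀ n, MeasurableSet (H n) := fun n => hemb.measurable (hG n)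
  have hHg : ∀ n, IsGr (H n) := by
    intro n p hp q hq h
    exact hιi (hG' n _ hp _ hq (by simp [h]))
  have hHE : ∀ x y, E x y → ∃ n, (x, y) ∈ H n := by
    intro x y hxy
    have : Prod.map ι ι (x, y) ∈ ⋃ n, G n := by
      rw [← hRG]; exact ⟨(x, y), hxy, rfl⟩
    obtain ⟨n, hn⟩ := mem_iUnion.1 this
    exact ⟨n, hn⟩
  let P : ℕ × ℕ × ℕ → Set (X × X) := fun k =>
    (ER ∩ H k.1 ∩ Prod.swap ⁻¹' (H k.2.1)) ∩ ({p | ι p.1 k.2.2 = true} ∩ {p | ι p.2 k.2.2 = false})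
  have hPm : ∀ k, MeasurableSet (P k) := by
    intro k
    refine ((hEm.inter (hHm _)).inter (measurable_swap (hHm _))).inter (MeasurableSet.inter ?_ ?_)
    · exact ((measurable_pi_apply k.2.2).comp (hι.comp measurable_fst)) (measurableSet_singleton true)
    · exact ((measurable_pi_apply k.2.2).comp (hι.comp measurable_snd)) (measurableSet_singleton false)
  let Q : ℕ × ℕ × ℕ → Set (X × X) := fun k => P k ∪ Prod.swap ⁻¹' (P k)
  have hQ : ∀ k, ∃ T : X ≃ᵐ X, (∀ x y, (x, y) ∈ Q k → T x = y) ∧ (∀ x, T x = x ∨ (x, T x) ∈ Q k) ∧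
      ∀ x, T (T x) = x := by
    intro k
    apply exists_involution
    · exact (hPm k).union (measurable_swap (hPm k))
    · rintro x y (h | h)
      · right; exact h
      · left; exact h
    · rintro ⟨x, y⟩ hp ⟨x', y'⟩ hq h
      simp only at h
      subst h
      rcases hp with ⟨⟨⟨-, h1⟩, h2⟩, h3, h4⟩ | ⟨⟨⟨-, h1⟩, h2⟩, h3, h4⟩ <;>
      rcases hq with ⟨⟨⟨-, h1'⟩, h2'⟩, h3', h4'⟩ | ⟨⟨⟨-, h1'⟩, h2'⟩, h3', h4'⟩
      · exact hHg _ _ h1 _ h1' rfl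
      · simp at h3 h4'; simp [h3] at h4'
      · simp at h3' h4; simp [h3'] at h4
      · exact hHg _ _ h2 _ h2' rfl
  choose T hT1 hT2 hT3 using hQ
  obtain ⟨e, he⟩ := exists_surjective_nat (Option (ℕ × ℕ × ℕ))
  let γ' : Option (ℕ × ℕ × ℕ) → X ≃ᵐ X := fun o => match o with
    | none => MeasurableEquiv.refl X
    | some k => T k
  refine ⟨fun n => γ' (e n), fun x y => ⟨fun hxy => ?_, ?_⟩, fun n x => ?_⟩
  · suffices h : ∃ o, γ' o x = y by
      obtain ⟨o, ho⟩ := h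
      obtain ⟨n, rfl⟩ := he o
      exact ⟨n, ho⟩
    by_cases hne : x = y
    · exact ⟨none, hne⟩
    obtain ⟨j, hj⟩ := Function.ne_iff.1 (hιi.ne hne)
    obtain ⟨n, hn⟩ := hHE x y hxy
    obtain ⟨m, hm⟩ := hHE y x (hEq.symm hxy)
    cases hxj : ι x j
    · have hyj : ι y j = true := by
        rw [hxj] at hj
        cases h : ι y j
        · exact (hj h.symm).elim
        · rfl
      refine ⟨some (m, n, j), hT1 _ _ _ (Or.inr ⟨⟨⟨hEq.symm hxy, hm⟩, hn⟩, hyj, hxj⟩)⟩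
    · have hyj : ι y j = false := by
        rw [hxj] at hj
        cases h : ι y j
        · rfl
        · exact (hj h.symm).elim
      refine ⟨some (n, m, j), hT1 _ _ _ (Or.inl ⟨⟨⟨hxy, hn⟩, hm⟩, hxj, hyj⟩)⟩
  · rintro ⟨n, rfl⟩
    beta_reduce
    generalize e n = o
    cases o with
    | none => exact hEq.refl x
    | some k =>
      change E x (T k x)
      rcases hT2 k x with h | h | h
      · rw [h]; exact hEq.refl x
      · exact h.1.1.1
      · exact hEq.symm h.1.1.1
  · simp only
    generalize e n = o
    cases o with
    | none => rfl
    | some k => exact hT3 k x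

end FM

end CocycleNadkarni

namespace CocycleNadkarni

section WS
variable {X : Type*}

/-- total weight of a set -/
noncomputable def ws (w : X → ℝ≥0∞) (S : Set X) : ℝ≥0∞ := ∑' y, S.indicator w y

lemma ws_mono {w : X → ℝ≥0∞} {S T : Set X} (h : S ⊆ T) : ws w S ≤ ws w T :=
  ENNReal.tsum_le_tsum fun y => indicator_le_indicator_of_subset h (fun _ => zero_le) y

lemma ws_le_ws {w w' : X → ℝ≥0∞} {S : Set X} (h : ∀ x ∈ S, w x ≤ w' x) : ws w S ≤ ws w' S :=
  ENNReal.tsum_le_tsum fun y => by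
    by_cases hy : y ∈ S
    · simpa [hy] using h y hy
    · simp [hy]

lemma ws_empty (w : X → ℝ≥0∞) : ws w ∅ = 0 := by simp [ws]

lemma ws_union {w : X → ℝ≥0∞} {S T : Set X} (h : Disjoint S T) : ws w (S ∪ T) = ws w S + ws w T := by
  unfold ws
  rw [← ENNReal.tsum_add, indicator_union_of_disjoint h]

lemma ws_union_le {w : X → ℝ≥0∞} (S T : Set X) : ws w (S ∪ T) ≤ ws w S + ws w T := by
  unfold ws
  rw [← ENNReal.tsum_add]
  refine ENNReal.tsum_le_tsum fun y => ?_
  by_cases h1 : y ∈ S <;> by_cases h2 : y ∈ T <;> simp [h1, h2]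

lemma ws_inter_diff (w : X → ℝ≥0∞) (S T : Set X) : ws w (S ∩ T) + ws w (S \ T) = ws w S := by
  rw [← ws_union (disjoint_sdiff_inter.symm), inter_union_diff]

lemma ws_iUnion {ι : Type*} {w : X → ℝ≥0∞} {S : ι → Set X} (h : Pairwise (Function.onFun Disjoint S)) :
    ws w (⋃ i, S i) = ∑' i, ws w (S i) := by
  unfold ws
  rw [ENNReal.tsum_comm]
  refine tsum_congr fun y => ?_
  by_cases hy : ∃ i, y ∈ S i
  · obtain ⟨i, hi⟩ := hy
    rw [tsum_eq_single i, indicator_of_mem hi, indicator_of_mem (mem_iUnion.2 ⟨i, hi⟩)]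
    intro j hj
    rw [indicator_of_notMem]
    intro hj'
    exact Set.disjoint_left.1 (h hj) hj' hi
  · push Not at hy
    rw [indicator_of_notMem (by simpa using hy)]
    simp [hy]

lemma ws_iUnion_le {ι : Type*} {w : X → ℝ≥0∞} {S : ι → Set X} :
    ws w (⋃ i, S i) ≤ ∑' i, ws w (S i) := by
  unfold ws
  rw [ENNReal.tsum_comm]
  refine ENNReal.tsum_le_tsum fun y => ?_
  by_cases hy : ∃ i, y ∈ S i
  · obtain ⟨i, hi⟩ := hy
    rw [indicator_of_mem (mem_iUnion.2 ⟨i, hi⟩)]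
    refine le_trans ?_ (ENNReal.le_tsum i)
    rw [indicator_of_mem hi]
  · push Not at hy
    rw [indicator_of_notMem (by simpa using hy)]
    simp

lemma ws_singleton (w : X → ℝ≥0∞) (x : X) : ws w {x} = w x := by
  unfold ws
  rw [tsum_eq_single x]
  · simp
  · intro y hy; simp [hy]

lemma le_ws {w : X → ℝ≥0∞} {x : X} {S : Set X} (h : x ∈ S) : w x ≤ ws w S := by
  rw [← ws_singleton w x]; exact ws_mono (by simpa using h)

lemma ws_finset (w : X → ℝ≥0∞) (s : Finset X) : ws w s = ∑ x ∈ s, w x := by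
  unfold ws
  rw [tsum_eq_sum (s := s)]
  · refine Finset.sum_congr rfl fun x hx => ?_
    simp [hx]
  · intro x hx; simp [hx]

lemma ws_ne_top {w : X → ℝ≥0∞} (hw : ∀ x, w x ≠ ⊤) {S : Set X} (hS : S.Finite) : ws w S ≠ ⊤ := by
  lift S to Finset X using hS
  rw [ws_finset]
  exact ENNReal.sum_ne_top.2 fun x _ => hw x

lemma ws_pos {w : X → ℝ≥0∞} (hw : ∀ x, w x ≠ 0) {S : Set X} (hS : S.Nonempty) : ws w S ≠ 0 := by
  obtain ⟨x, hx⟩ := hS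
  exact fun h => hw x (le_antisymm (h ▸ le_ws hx) zero_le)

lemma ws_image {Y : Type*} {w : X → ℝ≥0∞} {S : Set Y} {g : Y → X} (hg : InjOn g S) :
    ws w (g '' S) = ws (fun y => w (g y)) S := by
  unfold ws
  rw [← tsum_subtype, ← tsum_subtype]
  exact (Equiv.Set.imageOfInjOn g S hg).tsum_eq (fun y : g '' S => w y) |>.symm

lemma ws_const_mul (c : ℝ≥0∞) (w : X → ℝ≥0∞) (S : Set X) :
    ws (fun x => c * w x) S = c * ws w S := by
  unfold ws
  rw [← ENNReal.tsum_mul_left]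
  refine tsum_congr fun y => ?_
  by_cases h : y ∈ S <;> simp [h]

end WS

/-- the data of the coboundary situation -/
structure Sys (X : Type*) [MeasurableSpace X] where
  E : X → X → Prop
  eqv : Equivalence E
  hEm : MeasurableSet {p : X × X | E p.1 p.2}
  γ : ℕ → X ≃ᵐ X
  hγ : ∀ x y, E x y ↔ ∃ n, γ n x = y
  hγ2 : ∀ n x, γ n (γ n x) = x
  f : X → ℝ≥0∞
  hfm : Measurable f
  hf0 : ∀ x, f x ≠ 0
  hft : ∀ x, f x ≠ ⊤
  l : X → ℤ
  hlm : Measurable l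
  hlf : ∀ x, (2 : ℝ≥0∞) ^ (l x) ≤ f x
  hfl : ∀ x, f x < (2 : ℝ≥0∞) ^ (l x + 1)

namespace Sys
variable {X : Type*} [MeasurableSpace X] (S : Sys X)

lemma refl (x : X) : S.E x x := S.eqv.refl x
lemma E_γ (n : ℕ) (x : X) : S.E x (S.γ n x) := (S.hγ _ _).2 ⟨n, rfl⟩

/-- dyadic weight -/
noncomputable def h (x : X) : ℝ≥0∞ := (2 : ℝ≥0∞) ^ (S.l x)

lemma h_ne_zero (x : X) : S.h x ≠ 0 := (ENNReal.zpow_pos (by norm_num) (by norm_num) _).ne'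
lemma h_ne_top (x : X) : S.h x ≠ ⊤ := (ENNReal.zpow_lt_top (by norm_num) (by norm_num) _).ne
lemma h_le (x : X) : S.h x ≤ S.f x := S.hlf x
lemma f_le (x : X) : S.f x ≤ 2 * S.h x := by
  have := (S.hfl x).le
  rw [ENNReal.zpow_add (by norm_num) (by norm_num), zpow_one, mul_comm] at this
  exact this
lemma h_meas : Measurable S.h := by
  have : Measurable (fun n : ℤ => (2 : ℝ≥0∞) ^ n) := measurable_from_top
  exact this.comp S.hlm

lemma ws_h_le (A : Set X) : ws S.h A ≤ ws S.f A := ws_le_ws fun x _ => S.h_le x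
lemma ws_f_le (A : Set X) : ws S.f A ≤ 2 * ws S.h A := by
  rw [← ws_const_mul]; exact ws_le_ws fun x _ => S.f_le x

lemma ws_f_top_iff (A : Set X) : ws S.f A = ⊤ ↔ ws S.h A = ⊤ := by
  constructor
  · intro h
    by_contra h'
    have := S.ws_f_le A
    rw [h, top_le_iff] at this
    exact ENNReal.mul_ne_top (by norm_num) h' this
  · intro h
    have := S.ws_h_le A
    rwa [h, top_le_iff] at this

variable {S}

lemma meas_ex {P : X → X → Prop} (hP : MeasurableSet {p : X × X | P p.1 p.2}) :
    MeasurableSet {x | ∃ y, S.E x y ∧ P x y} := by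
  have : {x | ∃ y, S.E x y ∧ P x y} = ⋃ n, (fun x => (x, S.γ n x)) ⁻¹' {p : X × X | P p.1 p.2} := by
    ext x
    simp only [mem_ofPred_eq, mem_iUnion, mem_preimage, S.hγ]
    constructor
    · rintro ⟨_, ⟨n, rfl⟩, h⟩; exact ⟨n, h⟩
    · rintro ⟨n, h⟩; exact ⟨_, ⟨n, rfl⟩, h⟩
  rw [this]
  exact MeasurableSet.iUnion fun n => (measurable_id.prodMk (S.γ n).measurable) hP

lemma meas_all {P : X → X → Prop} (hP : MeasurableSet {p : X × X | P p.1 p.2}) :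
    MeasurableSet {x | ∀ y, S.E x y → P x y} := by
  have : {x | ∀ y, S.E x y → P x y} = {x | ∃ y, S.E x y ∧ ¬ P x y}ᶜ := by
    ext x; simp
  rw [this]
  exact (meas_ex hP.compl).compl

lemma meas_tsum {g : X → X → ℝ≥0∞} (hg : Measurable fun p : X × X => g p.1 p.2)
    (hE : ∀ x y, ¬ S.E x y → g x y = 0) [StandardBorelSpace X] :
    Measurable fun x => ∑' y, g x y := by
  classical
  have : (fun x => ∑' y, g x y) =
      fun x => ∑' n, if ∀ k < n, S.γ k x ≠ S.γ n x then g x (S.γ n x) else 0 := by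
    funext x
    have h1 : ∀ y, g x y = ∑' n, if (∀ k < n, S.γ k x ≠ S.γ n x) ∧ S.γ n x = y then g x y else 0 := by
      intro y
      by_cases hy : S.E x y
      · have hex := (S.hγ x y).1 hy
        rw [tsum_eq_single (Nat.find hex)]
        · rw [if_pos]
          refine ⟨fun k hk => ?_, Nat.find_spec hex⟩
          rw [Nat.find_spec hex]
          exact Nat.find_min hex hk
        · intro n hn
          rw [if_neg]
          rintro ⟨h1, h2⟩
          have h3 := Nat.find_min' hex h2
          exact h1 _ (lt_of_le_of_ne h3 hn.symm) ((Nat.find_spec hex).trans h2.symm)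
      · simp [hE x y hy]
    rw [tsum_congr h1, ENNReal.tsum_comm]
    refine tsum_congr fun n => ?_
    rw [tsum_eq_single (S.γ n x)]
    · simp
    · intro y hy
      rw [if_neg]
      rintro ⟨-, h⟩
      exact hy h.symm
  rw [this]
  refine Measurable.ennreal_tsum fun n => Measurable.ite ?_ ?_ measurable_const
  · have : {x | ∀ k < n, S.γ k x ≠ S.γ n x} = ⋂ k, ⋂ (_ : k < n), {x | S.γ k x = S.γ n x}ᶜ := by
      ext x; simp
    rw [this]
    refine MeasurableSet.iInter fun k => MeasurableSet.iInter fun _ => MeasurableSet.compl ?_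
    exact measurableSet_eq_fun (S.γ k).measurable (S.γ n).measurable
  · exact hg.comp (measurable_id.prodMk (S.γ n).measurable)

lemma meas_ws [StandardBorelSpace X] {w : X → ℝ≥0∞} (hw : Measurable w) {P : X → X → Prop}
    (hP : MeasurableSet {p : X × X | P p.1 p.2}) (hE : ∀ x y, P x y → S.E x y) :
    Measurable fun x => ws w {y | P x y} := by
  refine meas_tsum (S := S) (g := fun x y => ({y | P x y} : Set X).indicator w y) ?_ ?_
  · have : (fun p : X × X => ({y | P p.1 y} : Set X).indicator w p.2) =
        {p : X × X | P p.1 p.2}.indicator (fun p => w p.2) := by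
      funext p
      by_cases h : P p.1 p.2 <;> simp [indicator, h]
    rw [this]
    exact (hw.comp measurable_snd).indicator hP
  · intro x y h
    rw [indicator_of_notMem]
    exact fun h' => h (hE _ _ h')

end Sys

end CocycleNadkarni

namespace CocycleNadkarni

lemma exists_finset_of_lt_ws {X : Type*} {w : X → ℝ≥0∞} {A : Set X} {c : ℝ≥0∞} (h : c < ws w A) :
    ∃ t : Finset X, ↑t ⊆ A ∧ c < ws w t := by
  classical
  unfold ws at h
  rw [ENNReal.tsum_eq_iSup_sum, lt_iSup_iff] at h
  obtain ⟨t, ht⟩ := h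
  refine ⟨t.filter (· ∈ A), by intro x; simp, lt_of_lt_of_le ht (le_of_eq ?_)⟩
  rw [ws_finset, Finset.sum_filter]
  exact Finset.sum_congr rfl fun x _ => by simp [indicator]

namespace Sys
variable {X : Type*} [MeasurableSpace X] (S : Sys X)

def Comp (N : Set X) : Prop :=
  ∃ (F : X → X → Prop) (φ : X → X), IsFinSubequiv S.E F ∧ Measurable φ ∧
    (∀ x y, F x y → F (φ x) (φ y)) ∧ (∀ x, S.E x (φ x)) ∧ (∀ x, {y | F (φ y) x}.Finite) ∧
    (∀ x, ws S.f {y | F (φ y) x} ≤ ws S.f {y | F y x}) ∧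
    ∀ x ∈ N, ∃ y, S.E x y ∧ ws S.f {z | F (φ z) y} < ws S.f {z | F z y}

variable {S}

lemma Comp.mono {N N' : Set X} (h : S.Comp N) (h' : N' ⊆ N) : S.Comp N' := by
  obtain ⟨F, φ, h1, h2, h3, h4, h5, h6, h7⟩ := h
  exact ⟨F, φ, h1, h2, h3, h4, h5, h6, fun x hx => h7 x (h' hx)⟩

variable [StandardBorelSpace X]

lemma Comp.iUnion_nat {N : ℕ → Set X} (h : ∀ n, S.Comp (N n)) : S.Comp (⋃ n, N n) := by
  classical
  choose F φ hF hφ h3 h4 h5 h6 h7 using h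
  have hFE : ∀ n x y, F n x y → S.E x y := fun n x y h => (hF n).2.2.1 h
  let N' : ℕ → Set X := fun n => {x | ∃ y, S.E x y ∧
    ws S.f {z | F n (φ n z) y} < ws S.f {z | F n z y}}
  have hN'm : ∀ n, MeasurableSet (N' n) := by
    intro n
    apply meas_ex
    apply measurableSet_lt
    · refine Measurable.comp (g := fun y => ws S.f {z | F n (φ n z) y}) ?_ measurable_snd
      refine meas_ws (S := S) S.hfm ?_ ?_
      · exact ((hφ n).comp measurable_snd |>.prodMk measurable_fst) (hF n).2.1
      · intro x y hxy
        exact S.eqv.symm (S.eqv.trans (h4 n y) (hFE _ _ _ hxy))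
    · refine Measurable.comp (g := fun y => ws S.f {z | F n z y}) ?_ measurable_snd
      refine meas_ws (S := S) S.hfm ?_ ?_
      · exact (measurable_snd.prodMk measurable_fst) (hF n).2.1
      · intro x y hxy
        exact S.eqv.symm (hFE _ _ _ hxy)
  have hN'i : ∀ n x y, S.E x y → x ∈ N' n → y ∈ N' n := by
    rintro n x y hxy ⟨z, hz, hz'⟩
    exact ⟨z, S.eqv.trans (S.eqv.symm hxy) hz, hz'⟩
  have hex : ∀ x, ∃ n, x ∈ N' n ∨ ¬ ∃ m, x ∈ N' m := by
    intro x
    by_cases hx : ∃ m, x ∈ N' m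
    · obtain ⟨m, hm⟩ := hx; exact ⟨m, Or.inl hm⟩
    · exact ⟨0, Or.inr hx⟩
  let d : X → ℕ := fun x => Nat.find (hex x)
  have hd : Measurable d := by
    apply measurable_find
    intro k
    refine (hN'm k).union (MeasurableSet.compl ?_)
    have : {x | ∃ m, x ∈ N' m} = ⋃ m, N' m := by ext x; simp
    change MeasurableSet {x | ∃ m, x ∈ N' m}
    rw [this]
    exact MeasurableSet.iUnion hN'm
  have hdE : ∀ x y, S.E x y → d x = d y := by
    intro x y hxy
    have hiff : ∀ n, x ∈ N' n ↔ y ∈ N' n := fun n =>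
      ⟨hN'i n x y hxy, hN'i n y x (S.eqv.symm hxy)⟩
    simp only [d, hiff]
  refine ⟨fun x y => F (d x) x y, fun x => φ (d x) x, ⟨⟨fun x => (hF _).1.refl x, ?_, ?_⟩, ?_, ?_, ?_⟩,
    ?_, ?_, ?_, ?_, ?_, ?_⟩
  · intro x y hxy
    rw [← hdE x y (hFE _ _ _ hxy)]
    exact (hF _).1.symm hxy
  · intro x y z hxy hyz
    rw [← hdE x y (hFE _ _ _ hxy)] at hyz
    exact (hF _).1.trans hxy hyz
  · have : {p : X × X | F (d p.1) p.1 p.2} =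
        ⋃ n, ((fun p : X × X => d p.1) ⁻¹' {n} ∩ {p : X × X | F n p.1 p.2}) := by
      ext p; simp
    rw [this]
    exact MeasurableSet.iUnion fun n =>
      ((hd.comp measurable_fst) (measurableSet_singleton n)).inter (hF n).2.1
  · intro x y hxy; exact hFE _ _ _ hxy
  · intro x; exact (hF _).2.2.2 x
  · have : Measurable (fun p : ℕ × X => φ p.1 p.2) := measurable_from_prod_countable_right fun n => hφ n
    exact this.comp (hd.prodMk measurable_id)
  · intro x y hxy
    have e1 := hdE x y (hFE _ _ _ hxy)
    have e2 := hdE _ _ (h4 (d x) x)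
    simp only [← e1, ← e2]
    exact h3 _ _ _ hxy
  · intro x; exact h4 _ _
  all_goals
    have key : ∀ x, {y | F (d (φ (d y) y)) (φ (d y) y) x} = {y | F (d x) (φ (d x) y) x} := by
      intro x
      ext y
      simp only [mem_ofPred_eq]
      rw [← hdE _ _ (h4 (d y) y)]
      constructor
      · intro h
        have := hdE _ _ (S.eqv.trans (h4 _ _) (hFE _ _ _ h))
        rwa [this] at h
      · intro h
        have := hdE _ _ (S.eqv.trans (h4 _ _) (hFE _ _ _ h))
        rwa [this]
    have key2 : ∀ x, {y | F (d y) y x} = {y | F (d x) y x} := by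
      intro x
      ext y
      simp only [mem_ofPred_eq]
      constructor
      · intro h; rwa [hdE _ _ (hFE _ _ _ h)] at h
      · intro h; rwa [hdE _ _ (hFE _ _ _ h)]
  · intro x; simp only [key]; exact h5 _ _
  · intro x; simp only [key, key2]; exact h6 _ _
  · intro x hx
    obtain ⟨n, hn⟩ := mem_iUnion.1 hx
    have hxn : x ∈ N' n := h7 n x hn
    have hs := Nat.find_spec (hex x)
    rcases hs with hs | hs
    · obtain ⟨y, hxy, hy⟩ := hs
      refine ⟨y, hxy, ?_⟩
      simp only [key, key2]
      rw [← hdE x y hxy]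
      exact hy
    · exact (hs ⟨n, hxn⟩).elim

lemma Comp.iUnion {ι : Type*} [Countable ι] [Nonempty ι] {N : ι → Set X} (h : ∀ n, S.Comp (N n)) :
    S.Comp (⋃ n, N n) := by
  obtain ⟨e, he⟩ := exists_surjective_nat ι
  refine (Comp.iUnion_nat (fun n => h (e n))).mono ?_
  intro x hx
  obtain ⟨i, hi⟩ := mem_iUnion.1 hx
  obtain ⟨n, rfl⟩ := he i
  exact mem_iUnion.2 ⟨n, hi⟩

lemma Comp.union {A B : Set X} (hA : S.Comp A) (hB : S.Comp B) : S.Comp (A ∪ B) := by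
  rw [union_eq_iUnion]
  exact Comp.iUnion (fun b => by cases b <;> assumption)

lemma Comp.empty : S.Comp ∅ := by
  refine ⟨fun x y => x = y, id, ⟨⟨fun _ => rfl, fun h => h.symm, fun h h' => h.trans h'⟩,
    measurableSet_eq_fun measurable_fst measurable_snd, ?_, ?_⟩, measurable_id, ?_, ?_, ?_, ?_, ?_⟩
  · rintro x y rfl; exact S.refl _
  · intro x; simp
  · intro x y h; exact h
  · intro x; exact S.refl x
  · intro x; simp
  · intro x; exact le_rfl
  · intro x hx; exact hx.elim

/-- A measurable partial retraction with fibres of infinite mass yields a compression. -/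
theorem compR {W : Set X} (hW : MeasurableSet W) {r : X → X} (hr : Measurable r)
    (hrE : ∀ x ∈ W, S.E x (r x)) :
    S.Comp {x | ∃ m, S.E x m ∧ ws S.f {y | y ∈ W ∧ r y = m} = ⊤} := by
  classical
  -- index in the fibre
  have hnex : ∀ y, ∃ n, S.γ n (r y) = y ∨ y ∉ W := by
    intro y
    by_cases hy : y ∈ W
    · obtain ⟨n, hn⟩ := (S.hγ _ _).1 (S.eqv.symm (hrE y hy))
      exact ⟨n, Or.inl hn⟩
    · exact ⟨0, Or.inr hy⟩
  let n : X → ℕ := fun y => Nat.find (hnex y)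
  have hn : ∀ y ∈ W, S.γ (n y) (r y) = y := by
    intro y hy
    exact (Nat.find_spec (hnex y)).resolve_right (by simpa using hy)
  have hnm : Measurable n := by
    apply measurable_find
    intro k
    exact (measurableSet_eq_fun ((S.γ k).measurable.comp hr) measurable_id).union hW.compl
  have hninj : ∀ y ∈ W, ∀ y' ∈ W, r y = r y' → n y = n y' → y = y' := by
    intro y hy y' hy' h1 h2
    rw [← hn y hy, ← hn y' hy', h1, h2]
  -- the fibre pieces
  let D : ℕ → ℕ → X → Set X := fun a b m => {y | (y ∈ W ∧ r y = m) ∧ a ≤ n y ∧ n y < b}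
  have hDfin : ∀ a b m, (D a b m).Finite := by
    intro a b m
    apply Set.Finite.of_finite_image (f := n)
    · exact (Set.finite_Iio b).subset (by rintro _ ⟨y, hy, rfl⟩; exact hy.2.2)
    · intro y hy y' hy' h
      exact hninj y hy.1.1 y' hy'.1.1 (hy.1.2.trans hy'.1.2.symm) h
  have hDt : ∀ a b m, ws S.f (D a b m) ≠ ⊤ := fun a b m => ws_ne_top S.hft (hDfin a b m)
  have hWr : MeasurableSet {p : X × X | p.2 ∈ W ∧ r p.2 = p.1} :=
    (measurable_snd hW).inter (measurableSet_eq_fun (hr.comp measurable_snd) measurable_fst)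
  have hWrE : ∀ x y, y ∈ W ∧ r y = x → S.E x y := by
    rintro x y ⟨h1, rfl⟩; exact S.eqv.symm (hrE y h1)
  have hDm : ∀ a b, Measurable fun m => ws S.f (D a b m) := by
    intro a b
    refine meas_ws (S := S) S.hfm (P := fun m y => (y ∈ W ∧ r y = m) ∧ a ≤ n y ∧ n y < b) ?_ ?_
    · refine hWr.inter ?_
      exact (hnm.comp measurable_snd) (measurableSet_Ico (a := a) (b := b))
    · intro x y h; exact hWrE x y h.1
  let M : Set X := {m | ws S.f {y | y ∈ W ∧ r y = m} = ⊤}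
  have hMm : MeasurableSet M := by
    have : Measurable fun m => ws S.f {y | y ∈ W ∧ r y = m} := meas_ws (S := S) S.hfm hWr hWrE
    exact this (measurableSet_singleton ⊤)
  have hbex : ∀ a, ∀ m, ∃ b, ws S.f (D 0 a m) < ws S.f (D a b m) ∨ m ∉ M := by
    intro a m
    by_cases hm : m ∈ M
    · have hlt : 2 * ws S.f (D 0 a m) < ws S.f {y | y ∈ W ∧ r y = m} := by
        rw [show ws S.f {y | y ∈ W ∧ r y = m} = ⊤ from hm]
        exact ENNReal.mul_lt_top (by norm_num) (hDt _ _ _).lt_top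
      obtain ⟨t, ht, ht'⟩ := exists_finset_of_lt_ws hlt
      refine ⟨t.sup n + 1, Or.inl ?_⟩
      have hsub : (t : Set X) ⊆ D 0 a m ∪ D a (t.sup n + 1) m := by
        intro y hy
        have h1 := ht hy
        have h2 : n y ≤ t.sup n := Finset.le_sup (f := n) hy
        rcases Nat.lt_or_ge (n y) a with h3 | h3
        · left; exact ⟨h1, Nat.zero_le _, h3⟩
        · right; exact ⟨h1, h3, by omega⟩
      have h4 := lt_of_lt_of_le ht' ((ws_mono hsub).trans (ws_union_le _ _))
      rw [two_mul] at h4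
      exact (ENNReal.add_lt_add_iff_left (hDt _ _ _)).1 h4
    · exact ⟨0, Or.inr hm⟩
  let b : ℕ → X → ℕ := fun k => Nat.rec (fun _ => 0) (fun _ bk m => Nat.find (hbex (bk m) m)) k
  have hb0 : ∀ m, b 0 m = 0 := fun _ => rfl
  have hbs : ∀ k m, m ∈ M → ws S.f (D 0 (b k m) m) < ws S.f (D (b k m) (b (k+1) m) m) := by
    intro k m hm
    exact (Nat.find_spec (hbex (b k m) m)).resolve_right (by simpa using hm)
  have hbm : ∀ k, Measurable (b k) := by
    intro k
    induction k with
    | zero => exact measurable_const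
    | succ k ih =>
      apply measurable_find
      intro j
      have : {m | ws S.f (D 0 (b k m) m) < ws S.f (D (b k m) j m) ∨ m ∉ M} =
          (⋃ a, (b k ⁻¹' {a} ∩ {m | ws S.f (D 0 a m) < ws S.f (D a j m)})) ∪ Mᶜ := by
        ext m; simp
      exact this ▸ (MeasurableSet.iUnion fun a => (ih (measurableSet_singleton a)).inter
        (measurableSet_lt (hDm 0 a) (hDm a j))).union hMm.compl
  have hblt : ∀ k m, m ∈ M → b k m < b (k+1) m := by
    intro k m hm
    by_contra hcon
    have h1 := hbs k m hm
    have : D (b k m) (b (k+1) m) m = ∅ := by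
      ext y
      simp only [D, mem_ofPred_eq, mem_empty_iff_false, iff_false]
      omega
    rw [this, ws_empty] at h1
    exact ENNReal.not_lt_zero h1
  have hbk : ∀ k m, m ∈ M → k ≤ b k m := by
    intro k m hm
    induction k with
    | zero => simp
    | succ k ih => have := hblt k m hm; omega
  let W' : Set X := W ∩ r ⁻¹' M
  have hW'm : MeasurableSet W' := hW.inter (hr hMm)
  have hkex : ∀ y, ∃ k, n y < b (k+1) (r y) ∨ y ∉ W' := by
    intro y
    by_cases hy : y ∈ W'
    · exact ⟨n y, Or.inl (hbk (n y + 1) _ hy.2)⟩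
    · exact ⟨0, Or.inr hy⟩
  let k : X → ℕ := fun y => Nat.find (hkex y)
  have hkm : Measurable k := by
    apply measurable_find
    intro j
    exact (measurableSet_lt hnm ((hbm (j+1)).comp hr)).union hW'm.compl
  have hk1 : ∀ y ∈ W', n y < b (k y + 1) (r y) := by
    intro y hy
    exact (Nat.find_spec (hkex y)).resolve_right (by simpa using hy)
  have hk2 : ∀ y ∈ W', b (k y) (r y) ≤ n y := by
    intro y hy
    cases hc : k y with
    | zero => rw [hb0]; exact Nat.zero_le _
    | succ j =>
      have := Nat.find_min (hkex y) (m := j) (by change j < k y; omega)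
      push Not at this
      exact this.1
  have hbmono : ∀ m, m ∈ M → StrictMono fun k => b k m := fun m hm =>
    strictMono_nat_of_lt_succ fun k => hblt k m hm
  have hk3 : ∀ y ∈ W', ∀ j, b j (r y) ≤ n y → n y < b (j+1) (r y) → k y = j := by
    intro y hy j h1 h2
    have h3 := hk1 y hy
    have h4 := hk2 y hy
    have a1 : j < k y + 1 := (hbmono _ hy.2).lt_iff_lt.1 (lt_of_le_of_lt h1 h3)
    have a2 : k y < j + 1 := (hbmono _ hy.2).lt_iff_lt.1 (lt_of_le_of_lt h4 h2)
    omega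
  let Bl : X → ℕ → Set X := fun m j => {y | y ∈ W' ∧ r y = m ∧ k y = j}
  have hBl : ∀ m ∈ M, ∀ j, Bl m j = D (b j m) (b (j+1) m) m := by
    intro m hm j
    ext y
    constructor
    · rintro ⟨h1, rfl, rfl⟩
      exact ⟨⟨h1.1, rfl⟩, hk2 y h1, hk1 y h1⟩
    · rintro ⟨⟨h1, rfl⟩, h2, h3⟩
      exact ⟨⟨h1, hm⟩, rfl, hk3 y ⟨h1, hm⟩ j h2 h3⟩
  have hBlfin : ∀ m ∈ M, ∀ j, (Bl m j).Finite := fun m hm j => (hBl m hm j) ▸ hDfin _ _ _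
  have hBlmono : ∀ m ∈ M, ∀ j, ws S.f (Bl m j) ≤ ws S.f (Bl m (j+1)) := by
    intro m hm j
    rw [hBl m hm, hBl m hm]
    refine le_trans (ws_mono ?_) (hbs (j+1) m hm).le
    rintro y ⟨h1, h2, h3⟩
    exact ⟨h1, Nat.zero_le _, h3⟩
  have hBlne : ∀ m ∈ M, ∀ j, (Bl m j).Nonempty := by
    intro m hm j
    rw [hBl m hm, nonempty_iff_ne_empty]
    intro h
    have := hbs j m hm
    rw [h, ws_empty] at this
    exact ENNReal.not_lt_zero this
  have hpex : ∀ y, ∃ j, S.γ j (r y) ∈ Bl (r y) (k y + 1) ∨ y ∉ W' := by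
    intro y
    by_cases hy : y ∈ W'
    · obtain ⟨z, hz⟩ := hBlne (r y) hy.2 (k y + 1)
      have : S.E (r y) z := by
        rw [← hz.2.1]; exact S.eqv.symm (hrE z hz.1.1)
      obtain ⟨j, rfl⟩ := (S.hγ _ _).1 this
      exact ⟨j, Or.inl hz⟩
    · exact ⟨0, Or.inr hy⟩
  let p : X → ℕ := fun y => Nat.find (hpex y)
  have hp : ∀ y ∈ W', S.γ (p y) (r y) ∈ Bl (r y) (k y + 1) := fun y hy =>
    (Nat.find_spec (hpex y)).resolve_right (by simpa using hy)
  have hpm : Measurable p := by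
    apply measurable_find
    intro j
    refine MeasurableSet.union ?_ hW'm.compl
    have hg : Measurable fun y => S.γ j (r y) := (S.γ j).measurable.comp hr
    exact (hg hW'm).inter ((measurableSet_eq_fun (hr.comp hg) hr).inter
      (measurableSet_eq_fun (hkm.comp hg) (hkm.add_const 1)))
  let φ : X → X := fun y => if y ∈ W' then S.γ (p y) (r y) else y
  have hφ1 : ∀ y ∈ W', φ y ∈ Bl (r y) (k y + 1) := by
    intro y hy
    simp only [φ, if_pos hy]; exact hp y hy
  have hφ2 : ∀ y, y ∉ W' → φ y = y := by
    intro y hy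
    simp only [φ, if_neg hy]
  have hφm : Measurable φ := by
    refine Measurable.ite hW'm ?_ measurable_id
    have : Measurable (fun q : ℕ × X => S.γ q.1 q.2) :=
      measurable_from_prod_countable_right fun n => (S.γ n).measurable
    exact this.comp (hpm.prodMk hr)
  let F : X → X → Prop := fun x y => x = y ∨ (x ∈ W' ∧ y ∈ W' ∧ r x = r y ∧ k x = k y)
  have hFW : ∀ x ∈ W', {y | F y x} = Bl (r x) (k x) := by
    intro x hx
    ext y
    constructor
    · rintro (rfl | h)
      · exact ⟨hx, rfl, rfl⟩
      · exact ⟨h.1, h.2.2.1, h.2.2.2⟩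
    · rintro ⟨h1, h2, h3⟩
      exact Or.inr ⟨h1, hx, h2, h3⟩
  have hFn : ∀ x, x ∉ W' → {y | F y x} = {x} := by
    intro x hx
    ext y
    constructor
    · rintro (rfl | h)
      · rfl
      · exact (hx h.2.1).elim
    · rintro rfl; exact Or.inl rfl
  have hFsymm : ∀ x y, F x y → F y x := by
    rintro x y (rfl | ⟨h1, h2, h3, h4⟩)
    · exact Or.inl rfl
    · exact Or.inr ⟨h2, h1, h3.symm, h4.symm⟩
  have hFφ0 : ∀ x ∈ W', k x = 0 → {y | F (φ y) x} = ∅ := by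
    intro x hx hk0
    ext y
    simp only [mem_ofPred_eq, mem_empty_iff_false, iff_false]
    intro h
    have h' : φ y ∈ Bl (r x) (k x) := by rw [← hFW x hx]; exact h
    by_cases hy : y ∈ W'
    · have := (hφ1 y hy).2.2
      have := h'.2.2
      omega
    · rw [hφ2 y hy] at h'
      exact hy h'.1
  have hFφs : ∀ x ∈ W', ∀ j, k x = j + 1 → {y | F (φ y) x} = Bl (r x) j := by
    intro x hx j hk0
    ext y
    have e : F (φ y) x ↔ φ y ∈ Bl (r x) (k x) := by rw [← hFW x hx]; rfl
    simp only [mem_ofPred_eq, e]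
    by_cases hy : y ∈ W'
    · have h1 := hφ1 y hy
      constructor
      · intro h
        refine ⟨hy, h1.2.1.symm.trans h.2.1, ?_⟩
        have := h1.2.2; have := h.2.2; omega
      · rintro ⟨-, h2, h3⟩
        exact ⟨h1.1, h1.2.1.trans h2, by have := h1.2.2; omega⟩
    · rw [hφ2 y hy]
      constructor
      · intro h; exact (hy h.1).elim
      · intro h; exact (hy h.1).elim
  have hFφn : ∀ x, x ∉ W' → {y | F (φ y) x} = {x} := by
    intro x hx
    ext y
    have e : F (φ y) x ↔ φ y ∈ ({x} : Set X) := by rw [← hFn x hx]; rfl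
    simp only [mem_ofPred_eq, e, mem_singleton_iff]
    by_cases hy : y ∈ W'
    · constructor
      · intro h; exact (hx (h ▸ (hφ1 y hy).1)).elim
      · rintro rfl; exact (hx hy).elim
    · rw [hφ2 y hy]
  have hFE : ∀ x y, F x y → S.E x y := by
    rintro x y (rfl | ⟨h1, h2, h3, h4⟩)
    · exact S.refl x
    · exact S.eqv.trans (hrE x h1.1) (h3 ▸ S.eqv.symm (hrE y h2.1))
  refine ⟨F, φ, ⟨⟨fun x => Or.inl rfl, fun h => hFsymm _ _ h, ?_⟩, ?_, fun x y h => hFE x y h, ?_⟩,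
    hφm, ?_, ?_, ?_, ?_, ?_⟩
  · rintro x y z (rfl | ⟨h1, h2, h3, h4⟩) (rfl | ⟨g1, g2, g3, g4⟩)
    · exact Or.inl rfl
    · exact Or.inr ⟨g1, g2, g3, g4⟩
    · exact Or.inr ⟨h1, h2, h3, h4⟩
    · exact Or.inr ⟨h1, g2, h3.trans g3, h4.trans g4⟩
  · refine (measurableSet_eq_fun measurable_fst measurable_snd).union ?_
    exact (measurable_fst hW'm).inter ((measurable_snd hW'm).inter
      ((measurableSet_eq_fun (hr.comp measurable_fst) (hr.comp measurable_snd)).inter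
      (measurableSet_eq_fun (hkm.comp measurable_fst) (hkm.comp measurable_snd))))
  · intro x
    have : {y | F x y} = {y | F y x} := by
      ext y; exact ⟨fun h => hFsymm _ _ h, fun h => hFsymm _ _ h⟩
    rw [this]
    by_cases hx : x ∈ W'
    · rw [hFW x hx]; exact hBlfin _ hx.2 _
    · rw [hFn x hx]; exact finite_singleton x
  · rintro x y (rfl | ⟨h1, h2, h3, h4⟩)
    · exact Or.inl rfl
    · have a := hφ1 x h1
      have b := hφ1 y h2
      exact Or.inr ⟨a.1, b.1, by rw [a.2.1, b.2.1, h3], by rw [a.2.2, b.2.2, h4]⟩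
  · intro x
    by_cases hx : x ∈ W'
    · simp only [φ, if_pos hx]
      exact S.eqv.trans (hrE x hx.1) (S.E_γ _ _)
    · rw [hφ2 x hx]; exact S.refl x
  · intro x
    by_cases hx : x ∈ W'
    · cases hk0 : k x with
      | zero => rw [hFφ0 x hx hk0]; exact finite_empty
      | succ j => rw [hFφs x hx j hk0]; exact hBlfin _ hx.2 _
    · rw [hFφn x hx]; exact finite_singleton x
  · intro x
    by_cases hx : x ∈ W'
    · cases hk0 : k x with
      | zero => rw [hFφ0 x hx hk0, ws_empty]; exact zero_le
      | succ j => rw [hFφs x hx j hk0, hFW x hx, hk0]; exact hBlmono _ hx.2 _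
    · rw [hFφn x hx, hFn x hx]
  · rintro x ⟨m, hxm, hm⟩
    obtain ⟨y, hy⟩ := hBlne m hm 0
    refine ⟨y, ?_, ?_⟩
    · have := hrE y hy.1.1
      rw [hy.2.1] at this
      exact S.eqv.trans hxm (S.eqv.symm this)
    · rw [hFφ0 y hy.1 hy.2.2, ws_empty]
      exact (ws_pos S.hf0 ⟨y, Or.inl rfl⟩).bot_lt

end Sys

end CocycleNadkarni

namespace CocycleNadkarni

lemma finite_of_ws {X : Type*} {w : X → ℝ≥0∞} {A : Set X} {c : ℝ≥0∞} (hc : c ≠ 0)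
    (h : ws w A ≠ ⊤) (hA : ∀ x ∈ A, c ≤ w x) : A.Finite := by
  have := ENNReal.finite_const_le_of_tsum_ne_top (a := A.indicator w) h hc
  refine this.subset fun x hx => ?_
  simp only [mem_ofPred_eq, indicator_of_mem hx]
  exact hA x hx

set_option linter.unusedSectionVars false

namespace Sys
variable {X : Type*} [MeasurableSpace X] {S : Sys X} [StandardBorelSpace X]

lemma meas_γ_pair : Measurable (fun q : ℕ × X => S.γ q.1 q.2) :=
  measurable_from_prod_countable_right fun n => (S.γ n).measurable

/-- measurable uniformization of a relation inside `E` -/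
lemma exists_select {P : X → X → Prop} (hP : MeasurableSet {p : X × X | P p.1 p.2}) :
    ∃ r : X → X, Measurable r ∧ (∀ x, S.E x (r x)) ∧
      ∀ x, (∃ y, S.E x y ∧ P x y) → P x (r x) := by
  classical
  have hW : MeasurableSet {x | ∃ y, S.E x y ∧ P x y} := meas_ex hP
  have hex : ∀ x, ∃ n, P x (S.γ n x) ∨ ¬ ∃ y, S.E x y ∧ P x y := by
    intro x
    by_cases hx : ∃ y, S.E x y ∧ P x y
    · obtain ⟨y, h1, h2⟩ := hx
      obtain ⟨n, rfl⟩ := (S.hγ _ _).1 h1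
      exact ⟨n, Or.inl h2⟩
    · exact ⟨0, Or.inr hx⟩
  refine ⟨fun x => S.γ (Nat.find (hex x)) x, ?_, fun x => S.E_γ _ _, fun x hx => ?_⟩
  · refine meas_γ_pair.comp (Measurable.prodMk ?_ measurable_id)
    apply measurable_find
    intro k
    exact ((measurable_id.prodMk (S.γ k).measurable) hP).union hW.compl
  · exact (Nat.find_spec (hex x)).resolve_right (by simpa using hx)

/-- a partial transversal on classes of infinite mass -/
lemma comp_transversal (hinf : ∀ x, ws S.f {y | S.E x y} = ⊤) {T : Set X} (hT : MeasurableSet T)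
    (hT1 : ∀ x ∈ T, ∀ y ∈ T, S.E x y → x = y) : S.Comp {x | ∃ t, S.E x t ∧ t ∈ T} := by
  have hP : MeasurableSet {p : X × X | (fun _ y => y ∈ T) p.1 p.2} := measurable_snd hT
  obtain ⟨r, hr, hrE, hrT⟩ := exists_select (S := S) (P := fun _ y => y ∈ T) hP
  refine (compR (W := {x | ∃ t, S.E x t ∧ t ∈ T}) (meas_ex (P := fun _ y => y ∈ T) hP) hr (fun x _ => hrE x)).mono ?_
  rintro x ⟨t, hxt, ht⟩
  refine ⟨t, hxt, ?_⟩
  rw [← top_le_iff, ← hinf t]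
  apply ws_mono
  intro y hy
  have hyt : S.E y t := S.eqv.symm hy
  have h1 : ∃ t, S.E y t ∧ t ∈ T := ⟨t, hyt, ht⟩
  exact ⟨h1, hT1 _ (hrT y h1) _ ht (S.eqv.trans (S.eqv.symm (hrE y)) hyt)⟩

/-- If a Borel set has finite nonzero mass on a class then the class is compressible. -/
lemma comp_smooth (hinf : ∀ x, ws S.f {y | S.E x y} = ⊤) {V : Set X} (hV : MeasurableSet V) :
    S.Comp {x | (∃ y, S.E x y ∧ y ∈ V) ∧ ws S.h {y | S.E x y ∧ y ∈ V} ≠ ⊤} := by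
  obtain ⟨e, he⟩ := MeasureTheory.exists_measurableEmbedding_real X
  let T : Set X := {v | v ∈ V ∧ ∀ y, S.E v y → y ∈ V → (S.l y < S.l v ∨ (S.l y = S.l v ∧ e v ≤ e y))}
  have hT : MeasurableSet T := by
    refine hV.inter (meas_all (S := S) ?_)
    have : {p : X × X | p.2 ∈ V → (S.l p.2 < S.l p.1 ∨ (S.l p.2 = S.l p.1 ∧ e p.1 ≤ e p.2))} =
        {p : X × X | p.2 ∈ V}ᶜ ∪ ({p : X × X | S.l p.2 < S.l p.1} ∪
          ({p : X × X | S.l p.2 = S.l p.1} ∩ {p : X × X | e p.1 ≤ e p.2})) := by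
      ext p
      simp only [mem_ofPred_eq, mem_union, mem_compl_iff, mem_inter_iff]
      tauto
    rw [this]
    have l1 : Measurable fun p : X × X => S.l p.1 := S.hlm.comp measurable_fst
    have l2 : Measurable fun p : X × X => S.l p.2 := S.hlm.comp measurable_snd
    exact (measurable_snd hV).compl.union ((measurableSet_lt l2 l1).union
      ((measurableSet_eq_fun l2 l1).inter (measurableSet_le (he.measurable.comp measurable_fst)
        (he.measurable.comp measurable_snd))))
  refine (comp_transversal hinf hT ?_).mono ?_
  · rintro x ⟨hx, hx'⟩ y ⟨hy, hy'⟩ hxy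
    have h1 := hx' y hxy hy
    have h2 := hy' x (S.eqv.symm hxy) hx
    apply he.injective
    rcases h1 with h1 | ⟨h1, h1'⟩ <;> rcases h2 with h2 | ⟨h2, h2'⟩
    · omega
    · omega
    · omega
    · exact le_antisymm h1' h2'
  · rintro x ⟨⟨y0, hxy0, hy0⟩, hfin⟩
    have hfinite : ({y | S.E x y ∧ y ∈ V} ∩ {y | S.l y0 ≤ S.l y}).Finite := by
      refine finite_of_ws (w := S.h) (c := S.h y0) (S.h_ne_zero y0)
        (ne_top_of_le_ne_top hfin (ws_mono inter_subset_left)) ?_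
      rintro y ⟨-, hy⟩
      exact ENNReal.zpow_le_of_le (by norm_num) hy
    obtain ⟨y1, hy1, hmax⟩ := Set.exists_max_image _ S.l hfinite ⟨y0, ⟨hxy0, hy0⟩, le_refl (S.l y0)⟩
    obtain ⟨y2, hy2, hmin⟩ := Set.exists_min_image
      ({y | S.E x y ∧ y ∈ V} ∩ {y | S.l y0 ≤ S.l y} ∩ {y | S.l y = S.l y1}) e
      (hfinite.subset inter_subset_left) ⟨y1, hy1, rfl⟩
    refine ⟨y2, hy2.1.1.1, hy2.1.1.2, fun y hy hyV => ?_⟩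
    have hxy : S.E x y := S.eqv.trans hy2.1.1.1 hy
    have e2 : S.l y2 = S.l y1 := hy2.2
    by_cases hl : S.l y0 ≤ S.l y
    · have h1 := hmax y ⟨⟨hxy, hyV⟩, hl⟩
      rcases lt_or_eq_of_le h1 with h1 | h1
      · left; omega
      · right
        exact ⟨by omega, hmin y ⟨⟨⟨hxy, hyV⟩, hl⟩, h1⟩⟩
    · left
      have : S.l y0 ≤ S.l y1 := hy1.2
      omega

/-! ### greedy maximal families -/

variable (S) in
def cs (s : Finset ℕ) (x : X) : Set X := {y | ∃ i ∈ s, S.γ i x = y}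

lemma cs_finite (s : Finset ℕ) (x : X) : (S.cs s x).Finite := by
  have : S.cs s x = (fun i => S.γ i x) '' s := by ext y; simp [cs]
  rw [this]; exact s.finite_toSet.image _

lemma cs_E {s : Finset ℕ} {x y : X} (h : y ∈ S.cs s x) : S.E x y := by
  obtain ⟨i, -, rfl⟩ := h; exact S.E_γ i x

lemma cs_meas (s : Finset ℕ) : MeasurableSet {p : X × X | p.2 ∈ S.cs s p.1} := by
  have : {p : X × X | p.2 ∈ S.cs s p.1} = ⋃ i ∈ s, {p : X × X | S.γ i p.1 = p.2} := by
    ext p; simp [cs]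
  rw [this]
  exact Finset.measurableSet_biUnion _ fun i _ =>
    measurableSet_eq_fun ((S.γ i).measurable.comp measurable_fst) measurable_snd

lemma exists_cs {T : Set X} (hT : T.Finite) {x : X} (hx : ∀ y ∈ T, S.E x y) :
    ∃ s, S.cs s x = T := by
  classical
  have : ∀ y : T, ∃ n, S.γ n x = y := fun y => (S.hγ _ _).1 (hx y y.2)
  choose n hn using this
  have : Fintype T := hT.fintype
  refine ⟨Finset.univ.image n, ?_⟩
  ext y
  simp only [cs, mem_ofPred_eq, Finset.mem_image, Finset.mem_univ, true_and]
  constructor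
  · rintro ⟨_, ⟨z, rfl⟩, rfl⟩; rw [hn]; exact z.2
  · intro hy; exact ⟨_, ⟨⟨y, hy⟩, rfl⟩, hn ⟨y, hy⟩⟩

variable (S) in
theorem greedy (Φ : Set X → Prop) (hΦ : ∀ s, MeasurableSet {x | Φ (S.cs s x)}) :
    ∃ (F : X → X → Prop) (U : Set X), IsFinSubequiv S.E F ∧ MeasurableSet U ∧
      (∀ x ∈ U, ∀ y, F x y → y = x) ∧ (∀ x, x ∉ U → Φ {y | F x y}) ∧
      ∀ T : Set X, T.Finite → T.Nonempty → (∀ x ∈ T, ∀ y ∈ T, S.E x y) → T ⊆ U → ¬ Φ T := by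
  classical
  obtain ⟨ι, hι, hιi⟩ := MeasurableSpace.measurable_injection_nat_bool_of_countablySeparated X
  let O : List Bool → Set X := fun u => {y | (List.range u.length).map (ι y) = u}
  have hOm : ∀ u, MeasurableSet (O u) := by
    intro u
    have : O u = ⋂ i : Fin u.length, {y | ι y i = u[i]} := by
      ext y
      simp only [O, mem_ofPred_eq, mem_iInter]
      constructor
      · intro h i
        have h2 : i.1 < ((List.range u.length).map (ι y)).length := by simp
        have := List.getElem_of_eq h h2
        simpa using this
      · intro h
        apply List.ext_getElem (by simp)
        intro i h1 h2
        simpa using h ⟨i, h2⟩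
    rw [this]
    exact MeasurableSet.iInter fun i =>
      ((measurable_pi_apply i.1).comp hι) (measurableSet_singleton _)
  have hOsep : ∀ (x : X) (K : Set X), K.Finite → x ∉ K → ∃ u, x ∈ O u ∧ ∀ y ∈ K, y ∉ O u := by
    intro x K hK hx
    have : ∀ y ∈ K, ∃ n, ι x n ≠ ι y n := fun y hy =>
      Function.ne_iff.1 (hιi.ne (fun h => hx (h ▸ hy)))
    choose! n hn using this
    obtain ⟨N, hN⟩ := (hK.image n).bddAbove
    refine ⟨(List.range (N+1)).map (ι x), ?_, ?_⟩
    · simp [O]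
    · intro y hy h
      have hyN : n y ≤ N := hN ⟨y, hy, rfl⟩
      simp only [O, mem_ofPred_eq, List.length_map, List.length_range] at h
      have h2 : n y < ((List.range (N+1)).map (ι y)).length := by simp; omega
      have := List.getElem_of_eq h h2
      simp at this
      exact hn y hy this.symm
  -- colours
  let Col : Finset ℕ × List Bool → Set X := fun q => {x | x ∈ O q.2 ∧
    ∀ x', S.E x x' → (x' ≠ x ∧ ∃ y, S.E x y ∧ y ∈ S.cs q.1 x ∧ y ∈ S.cs q.1 x') → x' ∉ O q.2}
  have hColm : ∀ q, MeasurableSet (Col q) := by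
    intro q
    refine (hOm q.2).inter (meas_all (S := S) (P := fun x x' =>
      (x' ≠ x ∧ ∃ y, S.E x y ∧ y ∈ S.cs q.1 x ∧ y ∈ S.cs q.1 x') → x' ∉ O q.2) ?_)
    refine MeasurableSet.imp (MeasurableSet.inter ?_ ?_) ?_
    · exact (measurableSet_eq_fun measurable_snd measurable_fst).compl
    · have : {p : X × X | ∃ y, S.E p.1 y ∧ y ∈ S.cs q.1 p.1 ∧ y ∈ S.cs q.1 p.2} =
        ⋃ i, {p : X × X | S.γ i p.1 ∈ S.cs q.1 p.1 ∧ S.γ i p.1 ∈ S.cs q.1 p.2} := by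
        ext p
        simp only [mem_ofPred_eq, mem_iUnion, S.hγ]
        constructor
        · rintro ⟨_, ⟨n, rfl⟩, h⟩; exact ⟨n, h⟩
        · rintro ⟨n, h⟩; exact ⟨_, ⟨n, rfl⟩, h⟩
      change MeasurableSet {p : X × X | ∃ y, S.E p.1 y ∧ y ∈ S.cs q.1 p.1 ∧ y ∈ S.cs q.1 p.2}
      rw [this]
      refine MeasurableSet.iUnion fun i => ?_
      have g1 : Measurable fun p : X × X => S.γ i p.1 := (S.γ i).measurable.comp measurable_fst
      exact ((measurable_fst.prodMk g1) (cs_meas q.1)).inter ((measurable_snd.prodMk g1) (cs_meas q.1))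
    · exact (measurable_snd (hOm q.2)).compl
  have hCol1 : ∀ q, ∀ x ∈ Col q, ∀ x' ∈ Col q, ∀ y, y ∈ S.cs q.1 x → y ∈ S.cs q.1 x' → x = x' := by
    rintro q x ⟨hx, hx'⟩ x' ⟨hy, -⟩ y h1 h2
    by_contra hne
    exact hx' x' (S.eqv.trans (cs_E h1) (S.eqv.symm (cs_E h2)))
      ⟨fun h => hne h.symm, y, cs_E h1, h1, h2⟩ hy
  have hCol2 : ∀ s x, ∃ u, x ∈ Col (s, u) := by
    intro s x
    obtain ⟨u, hu, hu'⟩ := hOsep x {x' | x' ≠ x ∧ ∃ y, S.E x y ∧ y ∈ S.cs s x ∧ y ∈ S.cs s x'} (by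
      apply Set.Finite.subset (s := ⋃ i ∈ s, ⋃ j ∈ s, {S.γ i (S.γ j x)})
      · exact s.finite_toSet.biUnion fun i _ => s.finite_toSet.biUnion fun j _ => finite_singleton _
      · rintro x' ⟨-, y, -, ⟨j, hj, hj'⟩, ⟨i, hi, hi'⟩⟩
        simp only [mem_iUnion, mem_singleton_iff]
        refine ⟨i, hi, j, hj, ?_⟩
        rw [hj', ← hi', S.hγ2]) (by simp)
    exact ⟨u, hu, fun x' _ h => hu' x' h⟩
  obtain ⟨q, hq⟩ := exists_surjective_nat (Finset ℕ × List Bool)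
  let C : ℕ → Set X := fun k => Nat.rec ∅ (fun k Ck => Ck ∪ {y | ∃ x, S.E y x ∧
    ((x ∈ Col (q k) ∧ Φ (S.cs (q k).1 x) ∧ ∀ z, S.E x z → z ∈ S.cs (q k).1 x → z ∉ Ck) ∧
      y ∈ S.cs (q k).1 x)}) k
  let A : ℕ → Set X := fun k => {x | x ∈ Col (q k) ∧ Φ (S.cs (q k).1 x) ∧
    ∀ z, S.E x z → z ∈ S.cs (q k).1 x → z ∉ C k}
  have hCs : ∀ k, C (k+1) = C k ∪ {y | ∃ x, S.E y x ∧ (x ∈ A k ∧ y ∈ S.cs (q k).1 x)} := fun k => rfl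
  have hAm' : ∀ k, MeasurableSet (C k) → MeasurableSet (A k) := by
    intro k hk
    refine (hColm _).inter ((hΦ _).inter (meas_all (S := S) (P := fun x z => z ∈ S.cs (q k).1 x → z ∉ C k) ?_))
    exact MeasurableSet.imp (cs_meas _) (measurable_snd hk).compl
  have hCm : ∀ k, MeasurableSet (C k) := by
    intro k
    induction k with
    | zero => exact MeasurableSet.empty
    | succ k ih =>
      rw [hCs]
      refine ih.union (meas_ex (S := S) (P := fun y x => x ∈ A k ∧ y ∈ S.cs (q k).1 x) ?_)
      exact (measurable_snd (hAm' k ih)).inter (measurable_swap (cs_meas _))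
  have hAm : ∀ k, MeasurableSet (A k) := fun k => hAm' k (hCm k)
  have hCmono : Monotone C := monotone_nat_of_le_succ fun k => by
    rw [hCs]; exact subset_union_left
  have hAC : ∀ k x y, x ∈ A k → y ∈ S.cs (q k).1 x → y ∈ C (k+1) := by
    intro k x y hx hy
    rw [hCs]; right
    exact ⟨x, S.eqv.symm (cs_E hy), hx, hy⟩
  have hAC' : ∀ k x y, x ∈ A k → y ∈ S.cs (q k).1 x → y ∉ C k := by
    intro k x y hx hy
    exact hx.2.2 y (cs_E hy) hy
  have huniq : ∀ k k' z z' x, z ∈ A k → z' ∈ A k' → x ∈ S.cs (q k).1 z → x ∈ S.cs (q k').1 z' →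
      k = k' ∧ z = z' := by
    intro k k' z z' x hz hz' hx hx'
    have hkk : k = k' := by
      rcases lt_trichotomy k k' with h | h | h
      · exact (hAC' k' z' x hz' hx' (hCmono h (hAC k z x hz hx))).elim
      · exact h
      · exact (hAC' k z x hz hx (hCmono h (hAC k' z' x hz' hx'))).elim
    subst hkk
    exact ⟨rfl, hCol1 _ z hz.1 z' hz'.1 x hx hx'⟩
  let F : X → X → Prop := fun x y => x = y ∨
    ∃ z, S.E x z ∧ ∃ k, z ∈ A k ∧ x ∈ S.cs (q k).1 z ∧ y ∈ S.cs (q k).1 z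
  have hU : ∀ x, x ∈ ⋃ k, C k → ∃ k z, z ∈ A k ∧ x ∈ S.cs (q k).1 z := by
    intro x hx
    obtain ⟨k, hk⟩ := mem_iUnion.1 hx
    induction k with
    | zero => exact hk.elim
    | succ k ih =>
      rw [hCs] at hk
      rcases hk with hk | ⟨z, -, h⟩
      · exact ih hk
      · exact ⟨k, z, h⟩
  have hFb : ∀ k z x, z ∈ A k → x ∈ S.cs (q k).1 z → {y | F x y} = S.cs (q k).1 z := by
    intro k z x hz hx
    ext y
    constructor
    · rintro (rfl | ⟨z', -, k', hz', hx', hy'⟩)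
      · exact hx
      · obtain ⟨rfl, rfl⟩ := huniq _ _ _ _ _ hz hz' hx hx'
        exact hy'
    · intro hy
      exact Or.inr ⟨z, S.eqv.symm (cs_E hx), k, hz, hx, hy⟩
  have hFu : ∀ x, x ∉ ⋃ k, C k → {y | F x y} = {x} := by
    intro x hx
    ext y
    constructor
    · rintro (rfl | ⟨z', -, k', hz', hx', hy'⟩)
      · rfl
      · exact (hx (mem_iUnion.2 ⟨k' + 1, hAC _ _ _ hz' hx'⟩)).elim
    · rintro rfl; exact Or.inl rfl
  refine ⟨F, (⋃ k, C k)ᶜ, ⟨⟨fun x => Or.inl rfl, ?_, ?_⟩, ?_, ?_, ?_⟩,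
    (MeasurableSet.iUnion hCm).compl, ?_, ?_, ?_⟩
  · rintro x y (rfl | ⟨z, hz, k, h1, h2, h3⟩)
    · exact Or.inl rfl
    · exact Or.inr ⟨z, S.eqv.symm (cs_E h3), k, h1, h3, h2⟩
  · rintro x y w (rfl | ⟨z, hz, k, h1, h2, h3⟩) h
    · exact h
    · rcases h with rfl | ⟨z', hz', k', h1', h2', h3'⟩
      · exact Or.inr ⟨z, hz, k, h1, h2, h3⟩
      · obtain ⟨rfl, rfl⟩ := huniq _ _ _ _ _ h1 h1' h3 h2'
        exact Or.inr ⟨z, hz, k, h1, h2, h3'⟩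
  · refine (measurableSet_eq_fun measurable_fst measurable_snd).union ?_
    have : {p : X × X | ∃ z, S.E p.1 z ∧ ∃ k, z ∈ A k ∧ p.1 ∈ S.cs (q k).1 z ∧ p.2 ∈ S.cs (q k).1 z} =
        ⋃ n, ⋃ k, {p : X × X | S.γ n p.1 ∈ A k ∧ p.1 ∈ S.cs (q k).1 (S.γ n p.1) ∧
          p.2 ∈ S.cs (q k).1 (S.γ n p.1)} := by
      ext p
      simp only [mem_ofPred_eq, mem_iUnion, S.hγ]
      constructor
      · rintro ⟨_, ⟨n, rfl⟩, h⟩; exact ⟨n, h⟩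
      · rintro ⟨n, h⟩; exact ⟨_, ⟨n, rfl⟩, h⟩
    change MeasurableSet {p : X × X | ∃ z, S.E p.1 z ∧ ∃ k, z ∈ A k ∧ p.1 ∈ S.cs (q k).1 z ∧ p.2 ∈ S.cs (q k).1 z}
    rw [this]
    refine MeasurableSet.iUnion fun n => MeasurableSet.iUnion fun k => ?_
    have g1 : Measurable fun p : X × X => S.γ n p.1 := (S.γ n).measurable.comp measurable_fst
    exact (g1 (hAm k)).inter (((g1.prodMk measurable_fst) (cs_meas _)).inter
      ((g1.prodMk measurable_snd) (cs_meas _)))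
  · rintro x y (rfl | ⟨z, hz, k, h1, h2, h3⟩)
    · exact S.refl x
    · exact S.eqv.trans hz (cs_E h3)
  · intro x
    by_cases hx : x ∈ ⋃ k, C k
    · obtain ⟨k, z, hz, hxz⟩ := hU x hx
      rw [hFb k z x hz hxz]; exact cs_finite _ _
    · rw [hFu x hx]; exact finite_singleton x
  · intro x hx y hy
    have : y ∈ {y | F x y} := hy
    rw [hFu x hx] at this
    exact this
  · intro x hx
    obtain ⟨k, z, hz, hxz⟩ := hU x (by simpa using hx)
    rw [hFb k z x hz hxz]
    exact hz.2.1
  · rintro T hT ⟨x, hx⟩ hTE hTU hΦT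
    obtain ⟨s, hs⟩ := exists_cs hT (x := x) (fun y hy => hTE x hx y hy)
    obtain ⟨u, hu⟩ := hCol2 s x
    obtain ⟨k, hk⟩ := hq (s, u)
    have hxA : x ∈ A k := by
      refine ⟨by rw [hk]; exact hu, by rw [hk]; simp only [hs]; exact hΦT, ?_⟩
      intro z hz hz' hzC
      rw [hk] at hz'
      simp only [hs] at hz'
      exact hTU hz' (mem_iUnion.2 ⟨k, hzC⟩)
    have : x ∈ S.cs (q k).1 x := by rw [hk]; simp only [hs]; exact hx
    exact hTU hx (mem_iUnion.2 ⟨k+1, hAC k x x hxA this⟩)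

end Sys

end CocycleNadkarni

namespace CocycleNadkarni

set_option linter.unusedSectionVars false

lemma finv_induction {X : Type*} {F : X → X → Prop} (hF : Equivalence F)
    {P : Set X → Prop} (h0 : P ∅) : ∀ (G : Set X), G.Finite → (∀ x ∈ G, ∀ y, F x y → y ∈ G) →
    (∀ (G' : Set X) (x : X), G'.Finite → (∀ x ∈ G', ∀ y, F x y → y ∈ G') → G' ⊆ G → x ∈ G →
      Disjoint G' {y | F x y} → P G' → P (G' ∪ {y | F x y})) → P G := by
  have key : ∀ n, ∀ (G : Set X), G.ncard = n → G.Finite → (∀ x ∈ G, ∀ y, F x y → y ∈ G) →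
    (∀ (G' : Set X) (x : X), G'.Finite → (∀ x ∈ G', ∀ y, F x y → y ∈ G') → G' ⊆ G → x ∈ G →
      Disjoint G' {y | F x y} → P G' → P (G' ∪ {y | F x y})) → P G := by
    intro n
    induction n using Nat.strong_induction_on with
    | _ n ih =>
      intro G hn hG hinv hstep
      rcases G.eq_empty_or_nonempty with rfl | ⟨x, hx⟩
      · exact h0
      · have hsub : {y | F x y} ⊆ G := fun y hy => hinv x hx y hy
        have hG' : (G \ {y | F x y}) ∪ {y | F x y} = G := sdiff_union_of_subset hsub
        have hlt : G \ {y | F x y} ⊂ G := by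
          refine ⟨sdiff_subset, fun h => (h hx).2 (hF.refl x)⟩
        have hinv' : ∀ x' ∈ G \ {y | F x y}, ∀ y, F x' y → y ∈ G \ {y | F x y} := by
          rintro x' ⟨h1, h2⟩ y hy
          exact ⟨hinv x' h1 y hy, fun h => h2 (hF.trans h (hF.symm hy))⟩
        rw [← hG']
        refine hstep _ x (hG.subset sdiff_subset) hinv' sdiff_subset hx disjoint_sdiff_left ?_
        refine ih _ (hn ▸ ncard_lt_ncard hlt hG) _ rfl (hG.subset sdiff_subset) hinv' ?_
        intro G' x' a b c d
        exact hstep G' x' a b (c.trans sdiff_subset) d.1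
  exact fun G => key _ G rfl

lemma finv_le {X : Type*} {F : X → X → Prop} (hF : Equivalence F) {w w' : X → ℝ≥0∞}
    {G : Set X} (hG : G.Finite) (hinv : ∀ x ∈ G, ∀ y, F x y → y ∈ G)
    (h : ∀ x ∈ G, ws w {y | F x y} ≤ ws w' {y | F x y}) : ws w G ≤ ws w' G := by
  refine finv_induction hF (P := fun G => ws w G ≤ ws w' G) (by simp [ws_empty]) G hG hinv ?_
  intro G' x _ _ _ hx hd ih
  rw [ws_union hd, ws_union hd]
  exact add_le_add ih (h x hx)

lemma ws_ind {X : Type*} (w : X → ℝ≥0∞) (A G : Set X) : ws (A.indicator w) G = ws w (A ∩ G) := by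
  unfold ws
  refine tsum_congr fun y => ?_
  rw [indicator_indicator, inter_comm]

/-- lower density persists -/
lemma finv_low {X : Type*} {F : X → X → Prop} (hF : Equivalence F) {w : X → ℝ≥0∞} {A : Set X}
    {s : ℝ≥0∞} {G : Set X} (hG : G.Finite) (hinv : ∀ x ∈ G, ∀ y, F x y → y ∈ G)
    (h : ∀ x ∈ G, s * ws w {y | F x y} ≤ ws w (A ∩ {y | F x y})) :
    s * ws w G ≤ ws w (A ∩ G) := by
  rw [← ws_ind, ← ws_const_mul]
  refine finv_le hF hG hinv fun x hx => ?_
  rw [ws_ind, ws_const_mul]; exact h x hx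

lemma finv_high {X : Type*} {F : X → X → Prop} (hF : Equivalence F) {w : X → ℝ≥0∞} {A : Set X}
    {s : ℝ≥0∞} {G : Set X} (hG : G.Finite) (hinv : ∀ x ∈ G, ∀ y, F x y → y ∈ G)
    (h : ∀ x ∈ G, ws w (A ∩ {y | F x y}) ≤ s * ws w {y | F x y}) :
    ws w (A ∩ G) ≤ s * ws w G := by
  rw [← ws_ind, ← ws_const_mul]
  refine finv_le hF hG hinv fun x hx => ?_
  rw [ws_ind, ws_const_mul]; exact h x hx

/-- finite invariant sets of large mass -/
lemma exists_finv {X : Type*} {F : X → X → Prop} (hF : Equivalence F)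
    (hfin : ∀ x, {y | F x y}.Finite) {w : X → ℝ≥0∞} {V : Set X}
    (hV : ∀ x ∈ V, ∀ y, F x y → y ∈ V) {c : ℝ≥0∞} (hc : c < ws w V) :
    ∃ G, G.Finite ∧ (∀ x ∈ G, ∀ y, F x y → y ∈ G) ∧ G ⊆ V ∧ c < ws w G := by
  obtain ⟨t, ht, ht'⟩ := exists_finset_of_lt_ws hc
  refine ⟨⋃ x ∈ t, {y | F x y}, t.finite_toSet.biUnion fun x _ => hfin x, ?_, ?_, ?_⟩
  · intro x hx y hy
    simp only [mem_iUnion] at hx ⊢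
    obtain ⟨z, hz, hzx⟩ := hx
    exact ⟨z, hz, hF.trans hzx hy⟩
  · intro x hx
    simp only [mem_iUnion] at hx
    obtain ⟨z, hz, hzx⟩ := hx
    exact hV z (ht hz) x hzx
  · refine lt_of_lt_of_le ht' (ws_mono fun x hx => ?_)
    simp only [mem_iUnion]
    exact ⟨x, hx, hF.refl x⟩

namespace Sys
variable {X : Type*} [MeasurableSpace X] {S : Sys X} [StandardBorelSpace X]

lemma meas_ex2 {Y : Type*} [MeasurableSpace Y] {g : Y → X} (hg : Measurable g) {P : Y → X → Prop}
    (hP : MeasurableSet {p : Y × X | P p.1 p.2}) :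
    MeasurableSet {y | ∃ z, S.E (g y) z ∧ P y z} := by
  have : {y | ∃ z, S.E (g y) z ∧ P y z} =
      ⋃ n, (fun y => (y, S.γ n (g y))) ⁻¹' {p : Y × X | P p.1 p.2} := by
    ext x
    simp only [mem_ofPred_eq, mem_iUnion, mem_preimage, S.hγ]
    constructor
    · rintro ⟨_, ⟨n, rfl⟩, h⟩; exact ⟨n, h⟩
    · rintro ⟨n, h⟩; exact ⟨_, ⟨n, rfl⟩, h⟩
  rw [this]
  exact MeasurableSet.iUnion fun n => (measurable_id.prodMk ((S.γ n).measurable.comp hg)) hP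

lemma meas_all2 {Y : Type*} [MeasurableSpace Y] {g : Y → X} (hg : Measurable g) {P : Y → X → Prop}
    (hP : MeasurableSet {p : Y × X | P p.1 p.2}) :
    MeasurableSet {y | ∀ z, S.E (g y) z → P y z} := by
  have : {y | ∀ z, S.E (g y) z → P y z} = {y | ∃ z, S.E (g y) z ∧ ¬ P y z}ᶜ := by
    ext x; simp
  rw [this]
  exact (meas_ex2 hg (P := fun y z => ¬ P y z) hP.compl).compl

theorem mix_step (hinf : ∀ x, ws S.f {y | S.E x y} = ⊤) {F : X → X → Prop}
    (hF : IsFinSubequiv S.E F) {A : Set X} (hA : MeasurableSet A) {s t : ℝ≥0∞} (hst : s < t) 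
    (hs' : s ≠ ⊤) :
    ∃ F' : X → X → Prop, IsFinSubequiv S.E F' ∧ (∀ x y, F x y → F' x y) ∧ ∃ N, S.Comp N ∧
      ∀ x, x ∉ N → (∀ y, S.E x y → s * ws S.h {z | F' y z} ≤ ws S.h (A ∩ {z | F' y z})) ∨
        (∀ y, S.E x y → ws S.h (A ∩ {z | F' y z}) ≤ t * ws S.h {z | F' y z}) := by
  obtain ⟨hFe, hFm, hFE, hFf⟩ := id hF
  obtain ⟨d, hd⟩ := exists_add_of_le hst.le
  have hd0 : d ≠ 0 := by rintro rfl; simp at hd; exact hst.ne hd.symm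
  let Φ : Set X → Prop := fun T => (∀ x ∈ T, ∀ y, F x y → y ∈ T) ∧
    s * ws S.h T ≤ ws S.h (A ∩ T) ∧ ws S.h (A ∩ T) ≤ t * ws S.h T
  have hΦ : ∀ u, MeasurableSet {x | Φ (S.cs u x)} := by
    intro u
    have m1 : Measurable fun x => ws S.h (S.cs u x) :=
      meas_ws (S := S) (P := fun x y => y ∈ S.cs u x) S.h_meas (cs_meas u) fun x y h => cs_E h
    have m2 : Measurable fun x => ws S.h (A ∩ S.cs u x) :=
      meas_ws (S := S) (P := fun x y => y ∈ A ∧ y ∈ S.cs u x) S.h_meas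
        ((measurable_snd hA).inter (cs_meas u)) fun x y h => cs_E h.2
    refine MeasurableSet.inter ?_ ((measurableSet_le (m1.const_mul s) m2).inter
      (measurableSet_le m2 (m1.const_mul t)))
    have : {a | ∀ x ∈ S.cs u a, ∀ y, F x y → y ∈ S.cs u a} =
        {a | ∀ x, S.E a x → (x ∈ S.cs u a → ∀ y, S.E a y → (F x y → y ∈ S.cs u a))} := by
      ext a
      constructor
      · intro h x _ hx y _ hxy; exact h x hx y hxy
      · intro h x hx y hxy; exact h x (cs_E hx) hx y (S.eqv.trans (cs_E hx) (hFE hxy)) hxy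
    change MeasurableSet {a | ∀ x ∈ S.cs u a, ∀ y, F x y → y ∈ S.cs u a}
    rw [this]
    refine meas_all (S := S) (P := fun a x => x ∈ S.cs u a → ∀ y, S.E a y → (F x y → y ∈ S.cs u a)) ?_
    refine MeasurableSet.imp (cs_meas u) ?_
    refine meas_all2 (S := S) (g := Prod.fst) measurable_fst
      (P := fun (p : X × X) y => F p.2 y → y ∈ S.cs u p.1) ?_
    refine MeasurableSet.imp ?_ ?_
    · exact ((measurable_snd.comp measurable_fst).prodMk measurable_snd) hFm
    · exact ((measurable_fst.comp measurable_fst).prodMk measurable_snd) (cs_meas u)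
  obtain ⟨F', U, hF', hU, hFU, hFΦ, hmax⟩ := S.greedy Φ hΦ
  obtain ⟨hFe', hFm', hFE', hFf'⟩ := id hF'
  have hUinv : ∀ x y, F x y → (x ∈ U ↔ y ∈ U) := by
    have : ∀ x y, F x y → x ∈ U → y ∈ U := by
      intro x y hxy hx
      by_contra hy
      have h1 := (hFΦ y hy).1 y (hFe'.refl y) x (hFe.symm hxy)
      have h2 := hFU x hx y (hFe'.symm h1)
      exact hy (h2 ▸ hx)
    exact fun x y h => ⟨this x y h, this y x (hFe.symm h)⟩
  have hUinv' : ∀ x y, F' x y → (x ∈ U ↔ y ∈ U) := by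
    have : ∀ x y, F' x y → x ∈ U → y ∈ U := by
      intro x y hxy hx
      rw [hFU x hx y hxy]; exact hx
    exact fun x y h => ⟨this x y h, this y x (hFe'.symm h)⟩
  let F2 : X → X → Prop := fun x y => (x ∉ U ∧ F' x y) ∨ (x ∈ U ∧ F x y)
  have hb1 : ∀ x, x ∉ U → {y | F2 x y} = {y | F' x y} := by
    intro x hx; ext y; simp [F2, hx]
  have hb2 : ∀ x, x ∈ U → {y | F2 x y} = {y | F x y} := by
    intro x hx; ext y; simp [F2, hx]
  -- masses of blocks
  have mb : Measurable fun x => ws S.h {y | F x y} :=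
    meas_ws (S := S) S.h_meas hFm fun x y h => hFE h
  have mbA : Measurable fun x => ws S.h (A ∩ {y | F x y}) :=
    meas_ws (S := S) (P := fun x y => y ∈ A ∧ F x y) S.h_meas
      ((measurable_snd hA).inter hFm) fun x y h => hFE h.2
  have hbe : ∀ x y, F x y → {z | F x z} = {z | F y z} := by
    intro x y hxy; ext z
    exact ⟨fun h => hFe.trans (hFe.symm hxy) h, fun h => hFe.trans hxy h⟩
  let UL : Set X := {x | x ∈ U ∧ ws S.h (A ∩ {y | F x y}) < s * ws S.h {y | F x y}}
  let UH : Set X := {x | x ∈ U ∧ t * ws S.h {y | F x y} < ws S.h (A ∩ {y | F x y})}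
  let LW : ℕ → Set X := fun W => {x | x ∈ UL ∧ ws S.h {y | F x y} ≤ W}
  have hULm : MeasurableSet UL := hU.inter (measurableSet_lt mbA (mb.const_mul s))
  have hUHm : MeasurableSet UH := hU.inter (measurableSet_lt (mb.const_mul t) mbA)
  have hLWm : ∀ W, MeasurableSet (LW W) := fun W => hULm.inter (measurableSet_le mb measurable_const)
  have hULi : ∀ x y, F x y → x ∈ UL → y ∈ UL := by
    rintro x y hxy ⟨h1, h2⟩
    exact ⟨(hUinv x y hxy).1 h1, by rw [← hbe x y hxy]; exact h2⟩
  have hUHi : ∀ x y, F x y → x ∈ UH → y ∈ UH := by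
    rintro x y hxy ⟨h1, h2⟩
    exact ⟨(hUinv x y hxy).1 h1, by rw [← hbe x y hxy]; exact h2⟩
  have hLWi : ∀ W x y, F x y → x ∈ LW W → y ∈ LW W := by
    rintro W x y hxy ⟨h1, h2⟩
    exact ⟨hULi x y hxy h1, by rw [← hbe x y hxy]; exact h2⟩
  refine ⟨F2, ⟨⟨?_, ?_, ?_⟩, ?_, ?_, ?_⟩, ?_,
    {x | (∃ y, S.E x y ∧ y ∈ UH) ∧ ws S.h {y | S.E x y ∧ y ∈ UH} ≠ ⊤} ∪
    ⋃ W, {x | (∃ y, S.E x y ∧ y ∈ LW W) ∧ ws S.h {y | S.E x y ∧ y ∈ LW W} ≠ ⊤},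
    (comp_smooth hinf hUHm).union (Comp.iUnion_nat fun W => comp_smooth hinf (hLWm W)), ?_⟩
  · intro x
    by_cases hx : x ∈ U
    · exact Or.inr ⟨hx, hFe.refl x⟩
    · exact Or.inl ⟨hx, hFe'.refl x⟩
  · rintro x y (⟨h1, h2⟩ | ⟨h1, h2⟩)
    · exact Or.inl ⟨fun h => h1 ((hUinv' _ _ h2).2 h), hFe'.symm h2⟩
    · exact Or.inr ⟨(hUinv _ _ h2).1 h1, hFe.symm h2⟩
  · rintro x y z (⟨h1, h2⟩ | ⟨h1, h2⟩) (⟨h3, h4⟩ | ⟨h3, h4⟩)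
    · exact Or.inl ⟨h1, hFe'.trans h2 h4⟩
    · exact (h1 ((hUinv' _ _ h2).2 h3)).elim
    · exact (h3 ((hUinv _ _ h2).1 h1)).elim
    · exact Or.inr ⟨h1, hFe.trans h2 h4⟩
  · exact ((measurable_fst hU).compl.inter hFm').union ((measurable_fst hU).inter hFm)
  · rintro x y (⟨h1, h2⟩ | ⟨h1, h2⟩)
    · exact hFE' h2
    · exact hFE h2
  · intro x
    by_cases hx : x ∈ U
    · rw [hb2 x hx]; exact hFf x
    · rw [hb1 x hx]; exact hFf' x
  · intro x y hxy
    by_cases hx : x ∈ U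
    · exact Or.inr ⟨hx, hxy⟩
    · exact Or.inl ⟨hx, (hFΦ x hx).1 x (hFe'.refl x) y hxy⟩
  intro x hx
  by_cases hLx : ∃ y, S.E x y ∧ y ∈ UL
  swap
  · left
    intro y hy
    by_cases hyU : y ∈ U
    · rw [hb2 y hyU]
      by_contra hcon
      exact hLx ⟨y, hy, hyU, not_le.1 hcon⟩
    · rw [hb1 y hyU]
      exact (hFΦ y hyU).2.1
  by_cases hHx : ∃ y, S.E x y ∧ y ∈ UH
  swap
  · right
    intro y hy
    by_cases hyU : y ∈ U
    · rw [hb2 y hyU]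
      by_contra hcon
      exact hHx ⟨y, hy, hyU, not_le.1 hcon⟩
    · rw [hb1 y hyU]
      exact (hFΦ y hyU).2.2
  exfalso
  obtain ⟨y0, hxy0, hy0⟩ := hLx
  have hfb : ∀ x, ws S.h {y | F x y} ≠ ⊤ := fun x => ws_ne_top S.h_ne_top (hFf x)
  obtain ⟨W, hW⟩ := ENNReal.exists_nat_gt (hfb y0)
  have hy0W : y0 ∈ LW W := ⟨hy0, hW.le⟩
  have hHinf : ws S.h {y | S.E x y ∧ y ∈ UH} = ⊤ := by
    by_contra h; exact hx (Or.inl ⟨hHx, h⟩)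
  have hLinf : ws S.h {y | S.E x y ∧ y ∈ LW W} = ⊤ := by
    by_contra h; exact hx (Or.inr (mem_iUnion.2 ⟨W, ⟨y0, hxy0, hy0W⟩, h⟩))
  have hc1 : s * W / d < ⊤ := ENNReal.div_lt_top (ENNReal.mul_ne_top hs' (by simp)) hd0
  obtain ⟨H, hHf, hHi, hHV, hHc⟩ := exists_finv hFe hFf (w := S.h) (V := {y | S.E x y ∧ y ∈ UH})
    (by rintro a ⟨h1, h2⟩ b hab; exact ⟨S.eqv.trans h1 (hFE hab), hUHi _ _ hab h2⟩)
    (c := s * W / d) (by rw [hHinf]; exact hc1)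
  have hHtop : ws S.h H ≠ ⊤ := ws_ne_top S.h_ne_top hHf
  obtain ⟨G, hGf, hGi, hGV, hGc⟩ := exists_finv hFe hFf (w := S.h) (V := {y | S.E x y ∧ y ∈ LW W})
    (by rintro a ⟨h1, h2⟩ b hab; exact ⟨S.eqv.trans h1 (hFE hab), hLWi _ _ _ hab h2⟩)
    (c := ws S.h H / d) (by rw [hLinf]; exact ENNReal.div_lt_top hHtop hd0)
  have hGtop : ws S.h G ≠ ⊤ := ws_ne_top S.h_ne_top hGf
  have hHne : H.Nonempty := by
    rw [nonempty_iff_ne_empty]; rintro rfl; simp [ws_empty] at hHc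
  have hLH : Disjoint UL UH := by
    rw [Set.disjoint_left]
    rintro a ⟨-, h1⟩ ⟨-, h2⟩
    have : t * ws S.h {y | F a y} < s * ws S.h {y | F a y} := h2.trans h1
    exact absurd this (not_lt.2 (by gcongr))
  have key : t * ws S.h (H ∪ G) ≤ ws S.h (A ∩ (H ∪ G)) := by
    refine finv_induction hFe (P := fun G => t * ws S.h (H ∪ G) ≤ ws S.h (A ∩ (H ∪ G))) ?_ G hGf hGi ?_
    · simp only [union_empty]
      exact finv_low hFe hHf hHi fun y hy => (hHV hy).2.2.le
    · intro G' y hG'f hG'i hG'G hyG hdis ih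
      by_contra hcon
      rw [not_le] at hcon
      refine hmax (H ∪ (G' ∪ {z | F y z})) (hHf.union (hG'f.union (hFf y))) (hHne.inl) ?_ ?_ ⟨?_, ?_, hcon.le⟩
      · have : ∀ a ∈ H ∪ (G' ∪ {z | F y z}), S.E x a := by
          rintro a (ha | ha | ha)
          · exact (hHV ha).1
          · exact (hGV (hG'G ha)).1
          · exact S.eqv.trans (hGV hyG).1 (hFE ha)
        exact fun a ha b hb => S.eqv.trans (S.eqv.symm (this a ha)) (this b hb)
      · rintro a (ha | ha | ha)
        · exact (hHV ha).2.1
        · exact (hGV (hG'G ha)).2.1.1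
        · exact (hUinv _ _ ha).1 (hGV hyG).2.1.1
      · rintro a (ha | ha | ha) b hab
        · exact Or.inl (hHi a ha b hab)
        · exact Or.inr (Or.inl (hG'i a ha b hab))
        · exact Or.inr (Or.inr (hFe.trans ha hab))
      · have e1 : ws S.h (H ∪ (G' ∪ {z | F y z})) ≤ ws S.h (H ∪ G') + W := by
          rw [← union_assoc]
          exact (ws_union_le _ _).trans (by gcongr; exact (hGV hyG).2.2)
        have e2 : s * W ≤ d * ws S.h (H ∪ G') := by
          have := hHc.le
          rw [ENNReal.div_le_iff_le_mul (Or.inl hd0) (Or.inr (ws_pos S.h_ne_zero hHne)), mul_comm (ws S.h H)] at this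
          refine this.trans ?_
          gcongr
          exact ws_mono subset_union_left
        calc s * ws S.h (H ∪ (G' ∪ {z | F y z})) ≤ s * (ws S.h (H ∪ G') + W) := by gcongr
          _ = s * ws S.h (H ∪ G') + s * W := mul_add _ _ _
          _ ≤ s * ws S.h (H ∪ G') + d * ws S.h (H ∪ G') := by gcongr
          _ = t * ws S.h (H ∪ G') := by rw [hd, add_mul]
          _ ≤ ws S.h (A ∩ (H ∪ G')) := ih
          _ ≤ _ := ws_mono (inter_subset_inter_right _ (union_subset_union_right _ subset_union_left))
  have hdHG : Disjoint H G := by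
    rw [Set.disjoint_left]
    intro a ha hb
    exact Set.disjoint_left.1 hLH (hGV hb).2.1 (hHV ha).2
  have k2 : ws S.h (A ∩ G) ≤ s * ws S.h G := finv_high hFe hGf hGi fun y hy => (hGV hy).2.1.2.le
  have k3 : ws S.h (A ∩ (H ∪ G)) ≤ ws S.h H + s * ws S.h G := by
    rw [inter_union_distrib_left]
    refine (ws_union_le _ _).trans (add_le_add (ws_mono inter_subset_right) k2)
  have k4 : s * ws S.h G + d * ws S.h G ≤ s * ws S.h G + ws S.h H := by
    calc s * ws S.h G + d * ws S.h G = t * ws S.h G := by rw [hd, add_mul]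
      _ ≤ t * ws S.h (H ∪ G) := by gcongr; exact ws_mono subset_union_right
      _ ≤ _ := key.trans (k3.trans (le_of_eq (add_comm _ _)))
  have k5 : d * ws S.h G ≤ ws S.h H :=
    (ENNReal.add_le_add_iff_left (ENNReal.mul_ne_top hs' hGtop)).1 k4
  have k6 : ws S.h G ≤ ws S.h H / d := by
    by_cases hdt : d = ⊤
    · exfalso
      rw [hdt, ENNReal.top_mul] at k5
      · exact hHtop (top_le_iff.1 k5)
      · rintro h; rw [h] at hGc; exact ENNReal.not_lt_zero hGc
    · rw [ENNReal.le_div_iff_mul_le (Or.inl hd0) (Or.inl hdt), mul_comm]; exact k5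
  exact absurd hGc (not_lt.2 k6)

end Sys

end CocycleNadkarni

namespace CocycleNadkarni

set_option linter.unusedSectionVars false

namespace Sys
variable {X : Type*} [MeasurableSpace X] {S : Sys X} [StandardBorelSpace X]

lemma finSub_eq : IsFinSubequiv S.E (fun x y : X => x = y) := by
  refine ⟨eq_equivalence, measurableSet_eq_fun measurable_fst measurable_snd, ?_, ?_⟩
  · rintro x y rfl; exact S.refl x
  · intro x
    have : {y | x = y} = {x} := by ext y; simp [eq_comm]
    rw [this]; exact finite_singleton x

theorem mixing_seq (hinf : ∀ x, ws S.f {y | S.E x y} = ⊤) (A : ℕ → Set X)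
    (hA : ∀ i, MeasurableSet (A i)) :
    ∃ F : ℕ → X → X → Prop, (∀ n, IsFinSubequiv S.E (F n)) ∧
      (∀ n m, n ≤ m → ∀ x y, F n x y → F m x y) ∧ ∃ N, S.Comp N ∧
      ∀ x, x ∉ N → ∀ i s t, s < t → ∃ n0,
        (∀ n ≥ n0, ∀ y, S.E x y → s * ws S.h {z | F n y z} ≤ ws S.h (A i ∩ {z | F n y z})) ∨
        (∀ n ≥ n0, ∀ y, S.E x y → ws S.h (A i ∩ {z | F n y z}) ≤ t * ws S.h {z | F n y z}) := by
  classical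
  obtain ⟨e, he⟩ := exists_surjective_nat (ℕ × ℚ × ℚ)
  let c : ℚ → ℝ≥0∞ := fun q => ((Real.toNNReal q : NNReal) : ℝ≥0∞)
  have hct : ∀ q, c q ≠ ⊤ := fun q => ENNReal.coe_ne_top
  have step : ∀ (k : ℕ) (F : {F : X → X → Prop // IsFinSubequiv S.E F}),
      ∃ F' : {F : X → X → Prop // IsFinSubequiv S.E F}, (∀ x y, F.1 x y → F'.1 x y) ∧
        (c (e k).2.1 < c (e k).2.2 → ∃ N, S.Comp N ∧ ∀ x, x ∉ N →
          (∀ y, S.E x y → c (e k).2.1 * ws S.h {z | F'.1 y z} ≤ ws S.h (A (e k).1 ∩ {z | F'.1 y z})) ∨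
          (∀ y, S.E x y → ws S.h (A (e k).1 ∩ {z | F'.1 y z}) ≤ c (e k).2.2 * ws S.h {z | F'.1 y z})) := by
    intro k F
    by_cases h : c (e k).2.1 < c (e k).2.2
    · obtain ⟨F', h1, h2, h3⟩ := mix_step hinf F.2 (hA (e k).1) h (hct _)
      exact ⟨⟨F', h1⟩, h2, fun _ => h3⟩
    · exact ⟨F, fun _ _ h => h, fun h' => (h h').elim⟩
  choose nx hnx1 hnx2 using step
  let F : ℕ → {F : X → X → Prop // IsFinSubequiv S.E F} :=
    fun n => Nat.rec ⟨fun x y => x = y, finSub_eq⟩ (fun k G => nx k G) n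
  have hFs : ∀ n, F (n+1) = nx n (F n) := fun n => rfl
  have hmono : ∀ n m, n ≤ m → ∀ x y, (F n).1 x y → (F m).1 x y := by
    intro n m hnm x y hxy
    induction hnm with
    | refl => exact hxy
    | step _ ih => rw [hFs]; exact hnx1 _ _ _ _ ih
  choose! N hN1 hN2 using fun k => hnx2 k (F k)
  refine ⟨fun n => (F n).1, fun n => (F n).2, hmono,
    ⋃ k, (if c (e k).2.1 < c (e k).2.2 then N k else ∅), ?_, ?_⟩
  · refine Comp.iUnion_nat fun k => ?_
    split_ifs with h
    · exact hN1 k h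
    · exact Comp.empty
  intro x hx i s t hst
  obtain ⟨q1, -, h1, h2⟩ := ENNReal.lt_iff_exists_rat_btwn.1 hst
  obtain ⟨q2, -, h3, h4⟩ := ENNReal.lt_iff_exists_rat_btwn.1 h2
  obtain ⟨k, hk⟩ := he (i, q1, q2)
  have hlt : c (e k).2.1 < c (e k).2.2 := by rw [hk]; exact h3
  have hxN : x ∉ N k := by
    intro h
    apply hx
    rw [mem_iUnion]
    exact ⟨k, by rw [if_pos hlt]; exact h⟩
  have hsub : ∀ n ≥ k + 1, ∀ y, ∀ a ∈ {z | (F n).1 y z}, ∀ b, (F (k+1)).1 a b → b ∈ {z | (F n).1 y z} := by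
    intro n hn y a ha b hab
    exact (F n).2.1.trans ha (hmono _ _ hn _ _ hab)
  refine ⟨k + 1, ?_⟩
  rcases hN2 k hlt x hxN with h | h
  · left
    intro n hn y hy
    refine le_trans (mul_le_mul_left h1.le _) ?_
    refine finv_low (F (k+1)).2.1 ((F n).2.2.2.2 y) (hsub n hn y) fun a ha => ?_
    have := h a (S.eqv.trans hy ((F n).2.2.2.1 ha))
    rw [hk] at this
    exact this
  · right
    intro n hn y hy
    refine le_trans ?_ (mul_le_mul_left h4.le _)
    refine finv_high (F (k+1)).2.1 ((F n).2.2.2.2 y) (hsub n hn y) fun a ha => ?_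
    have := h a (S.eqv.trans hy ((F n).2.2.2.1 ha))
    rw [hk] at this
    exact this

end Sys

end CocycleNadkarni

namespace CocycleNadkarni

set_option linter.unusedSectionVars false

namespace Sys
variable {X : Type*} [MeasurableSpace X] {S : Sys X} [StandardBorelSpace X]

/-- Borel choice of a self-map of each block of a finite equivalence relation -/
theorem finSel {F : X → X → Prop} (hF : IsFinSubequiv S.E F) (Ψ : X → (X → X) → Prop)
    (hloc : ∀ b p q, (∀ y, F b y → p y = q y) → Ψ b p → Ψ b q)
    (hinv : ∀ b c p, F b c → Ψ b p → Ψ c p)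
    (hm : ∀ p, Measurable p → (∀ x, F x (p x)) → MeasurableSet {b | Ψ b p})
    (hex : ∀ b, ∃ p, (∀ x, F x (p x)) ∧ Ψ b p) :
    ∃ p, Measurable p ∧ (∀ x, F x (p x)) ∧ ∀ b, Ψ b p := by
  classical
  obtain ⟨hFe, hFm, hFE, hFf⟩ := id hF
  obtain ⟨e, he⟩ := MeasureTheory.exists_measurableEmbedding_real X
  have hPm : MeasurableSet {p : X × X | F p.1 p.2 ∧ ∀ z, S.E p.1 z → F p.1 z → e p.2 ≤ e z} := by
    refine hFm.inter (meas_all2 (S := S) (g := Prod.fst) measurable_fst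
      (P := fun (p : X × X) z => F p.1 z → e p.2 ≤ e z) ?_)
    refine MeasurableSet.imp ?_ ?_
    · exact ((measurable_fst.comp measurable_fst).prodMk measurable_snd) hFm
    · exact measurableSet_le (he.measurable.comp (measurable_snd.comp measurable_fst))
        (he.measurable.comp measurable_snd)
  obtain ⟨bs, hbs, -, hbsP⟩ := exists_select (S := S)
    (P := fun x y => F x y ∧ ∀ z, S.E x z → F x z → e y ≤ e z) hPm
  have hb : ∀ x, F x (bs x) ∧ ∀ z, S.E x z → F x z → e (bs x) ≤ e z := by
    intro x
    apply hbsP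
    obtain ⟨y, hy, hmin⟩ := Set.exists_min_image _ e (hFf x) ⟨x, hFe.refl x⟩
    exact ⟨y, hFE hy, hy, fun z _ hz => hmin z hz⟩
  have hbeq : ∀ x y, F x y → bs x = bs y := by
    intro x y hxy
    apply he.injective
    apply le_antisymm
    · exact (hb x).2 _ (hFE (hFe.trans hxy (hb y).1)) (hFe.trans hxy (hb y).1)
    · exact (hb y).2 _ (hFE (hFe.trans (hFe.symm hxy) (hb x).1)) (hFe.trans (hFe.symm hxy) (hb x).1)
  have hidx : ∀ y, ∃ i, S.γ i (bs y) = y := fun y => (S.hγ _ _).1 (S.eqv.symm (hFE (hb y).1))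
  let ix : X → ℕ := fun y => Nat.find (hidx y)
  have hix : ∀ y, S.γ (ix y) (bs y) = y := fun y => Nat.find_spec (hidx y)
  have hixm : Measurable ix := by
    apply measurable_find
    intro k
    exact measurableSet_eq_fun ((S.γ k).measurable.comp hbs) measurable_id
  let pc : (ℕ →₀ ℕ) → X → X := fun σ y => if F y (S.γ (σ (ix y)) (bs y)) then S.γ (σ (ix y)) (bs y) else y
  have hpF : ∀ σ y, F y (pc σ y) := by
    intro σ y
    simp only [pc]
    split_ifs with h
    · exact h
    · exact hFe.refl y
  have hpm : ∀ σ, Measurable (pc σ) := by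
    intro σ
    have h1 : Measurable fun y => S.γ (σ (ix y)) (bs y) :=
      (meas_γ_pair (S := S)).comp (((measurable_from_top (f := σ)).comp hixm).prodMk hbs)
    exact Measurable.ite ((measurable_id.prodMk h1) hFm) h1 measurable_id
  have hcode : ∀ b, ∃ σ, Ψ b (pc σ) := by
    intro b
    obtain ⟨p, hp, hΨ⟩ := hex b
    let σ : ℕ → ℕ := fun i => if F b (S.γ i (bs b)) ∧ ix (S.γ i (bs b)) = i then ix (p (S.γ i (bs b))) else 0
    have hσ : (Function.support σ).Finite := by
      refine ((hFf b).image ix).subset fun i hi => ?_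
      have : F b (S.γ i (bs b)) ∧ ix (S.γ i (bs b)) = i := by
        by_contra h
        exact hi (if_neg h)
      exact ⟨_, this.1, this.2⟩
    refine ⟨Finsupp.ofSupportFinite σ hσ, hloc b p _ (fun y hy => ?_) hΨ⟩
    have e1 : bs y = bs b := (hbeq _ _ hy).symm
    have e2 : S.γ (ix y) (bs b) = y := by rw [← e1]; exact hix y
    have e3 : σ (ix y) = ix (p y) := by
      simp only [σ, e2]
      rw [if_pos ⟨hy, trivial⟩]
    have e4 : S.γ (ix (p y)) (bs y) = p y := by
      rw [hbeq _ _ (hp y)]; exact hix (p y)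
    simp only [pc, Finsupp.ofSupportFinite_coe, e3, e4]
    rw [if_pos (hp y)]
  obtain ⟨en, hen⟩ := exists_surjective_nat (ℕ →₀ ℕ)
  have hcn : ∀ b, ∃ n, Ψ b (pc (en n)) := by
    intro b
    obtain ⟨σ, hσ⟩ := hcode b
    obtain ⟨n, rfl⟩ := hen σ
    exact ⟨n, hσ⟩
  let cd : X → ℕ := fun b => Nat.find (hcn b)
  have hcdm : Measurable cd := measurable_find _ fun k => hm _ (hpm _) (hpF _)
  have hcdi : ∀ b c, F b c → cd b = cd c := by
    intro b c hbc
    simp only [cd]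
    apply Nat.find_congr'
    intro n
    exact ⟨hinv _ _ _ hbc, hinv _ _ _ (hFe.symm hbc)⟩
  refine ⟨fun y => pc (en (cd y)) y, ?_, fun y => hpF _ y, fun b => ?_⟩
  · have : Measurable (fun q : ℕ × X => pc (en q.1) q.2) :=
      measurable_from_prod_countable_right fun n => hpm (en n)
    exact this.comp (hcdm.prodMk measurable_id)
  · refine hloc b (pc (en (cd b))) _ (fun y hy => ?_) (Nat.find_spec (hcn b))
    simp only [hcdi b y hy]

lemma comp_rel {P : X → X → Prop} (hP : MeasurableSet {p : X × X | P p.1 p.2})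
    (hPE : ∀ y m, P y m → S.E y m) (hfun : ∀ y m m', P y m → P y m' → m = m') :
    S.Comp {x | ∃ m, S.E x m ∧ ws S.f {y | P y m} = ⊤} := by
  obtain ⟨r, hr, hrE, hrP⟩ := exists_select (S := S) hP
  refine (compR (W := {x | ∃ y, S.E x y ∧ P x y}) (meas_ex hP) hr fun x _ => hrE x).mono ?_
  rintro x ⟨m, hxm, hm⟩
  refine ⟨m, hxm, ?_⟩
  rw [← top_le_iff, ← hm]
  apply ws_mono
  intro y hy
  have : ∃ z, S.E y z ∧ P y z := ⟨m, hPE _ _ hy, hy⟩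
  exact ⟨this, hfun y _ _ (hrP y this) hy⟩

lemma ws_one {Y : Type*} {A : Set Y} (hA : A.Finite) : ws (fun _ => 1) A = (A.ncard : ℝ≥0∞) := by
  lift A to Finset Y using hA
  rw [ws_finset, ncard_coe_finset]; simp

lemma ws_top_of_infinite {Y : Type*} {A : Set Y} {w : Y → ℝ≥0∞} {c : ℝ≥0∞} (hc : c ≠ 0)
    (hA : A.Infinite) (h : ∀ x ∈ A, c ≤ w x) : ws w A = ⊤ := by
  by_contra hne
  exact hA (finite_of_ws hc hne h)

lemma meas_iterate {g : X → X} (hg : Measurable g) (n : ℕ) : Measurable (g^[n]) := hg.iterate n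

/-- two equidecomposable sets of constant weights cannot have uniformly different counts -/
theorem comp_count {F : X → X → Prop} (hF : IsFinSubequiv S.E F) {B B' : Set X}
    (hB : MeasurableSet B) (hB' : MeasurableSet B') (T : X → X) (hTm : Measurable T)
    (hT : ∀ x ∈ B', S.E x (T x)) (hTB : ∀ x ∈ B', T x ∈ B) (hTi : InjOn T B') {b : ℤ}
    (hl : ∀ x ∈ B', S.l x = b) :
    S.Comp {x | ∀ y, S.E x y → ws (fun _ => 1) (B ∩ {z | F y z}) < ws (fun _ => 1) (B' ∩ {z | F y z})} := by
  classical
  obtain ⟨hFe, hFm, hFE, hFf⟩ := id hF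
  have mc : ∀ {D : Set X}, MeasurableSet D → Measurable fun x => ws (fun _ => 1) (D ∩ {z | F x z}) := by
    intro D hD
    exact meas_ws (S := S) (P := fun x y => y ∈ D ∧ F x y) measurable_const
      ((measurable_snd hD).inter hFm) fun x y h => hFE h.2
  have hbe : ∀ x y, F x y → {z | F x z} = {z | F y z} := by
    intro x y hxy; ext z
    exact ⟨fun h => hFe.trans (hFe.symm hxy) h, fun h => hFe.trans hxy h⟩
  obtain ⟨p, hpm, hpF, hp⟩ := finSel hF (fun x p =>
      ws (fun _ => 1) (B ∩ {z | F x z}) ≤ ws (fun _ => 1) (B' ∩ {z | F x z}) →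
      ((∀ y, S.E x y → (F x y ∧ y ∈ B) → p y ∈ B') ∧ ∀ y, S.E x y → (F x y ∧ y ∈ B) →
        ∀ z, S.E x z → (F x z ∧ z ∈ B) → p y = p z → y = z))
    (by
      intro x p q hpq h hx
      obtain ⟨h1, h2⟩ := h hx
      refine ⟨fun y h3 h4 => ?_, fun y h3 h4 z h5 h6 h7 => ?_⟩
      · rw [← hpq y h4.1]; exact h1 y h3 h4
      · exact h2 y h3 h4 z h5 h6 (by rw [hpq y h4.1, hpq z h6.1]; exact h7))
    (by
      intro x c p hxc h hx
      rw [← hbe _ _ hxc] at hx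
      obtain ⟨h1, h2⟩ := h hx
      have hE := hFE hxc
      refine ⟨fun y h3 h4 => h1 y (S.eqv.trans hE h3) ⟨hFe.trans hxc h4.1, h4.2⟩,
        fun y h3 h4 z h5 h6 h7 => h2 y (S.eqv.trans hE h3) ⟨hFe.trans hxc h4.1, h4.2⟩
          z (S.eqv.trans hE h5) ⟨hFe.trans hxc h6.1, h6.2⟩ h7⟩)
    (by
      intro p hp hpF
      refine MeasurableSet.imp (measurableSet_le (mc hB) (mc hB')) (MeasurableSet.inter ?_ ?_)
      · refine meas_all (S := S) (P := fun x y => (F x y ∧ y ∈ B) → p y ∈ B') ?_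
        exact MeasurableSet.imp (hFm.inter (measurable_snd hB)) ((hp.comp measurable_snd) hB')
      · refine meas_all (S := S) (P := fun x y => (F x y ∧ y ∈ B) →
          ∀ z, S.E x z → (F x z ∧ z ∈ B) → p y = p z → y = z) ?_
        refine MeasurableSet.imp (hFm.inter (measurable_snd hB)) ?_
        refine meas_all2 (S := S) (g := Prod.fst) measurable_fst
          (P := fun (q : X × X) z => (F q.1 z ∧ z ∈ B) → p q.2 = p z → q.2 = z) ?_
        have m2 : Measurable fun q : (X × X) × X => q.1.2 := measurable_snd.comp measurable_fst
        refine MeasurableSet.imp (MeasurableSet.inter ?_ ?_) (MeasurableSet.imp ?_ ?_)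
        · exact ((measurable_fst.comp measurable_fst).prodMk measurable_snd) hFm
        · exact measurable_snd hB
        · exact measurableSet_eq_fun (hp.comp m2) (hp.comp measurable_snd)
        · exact measurableSet_eq_fun m2 measurable_snd)
    (by
      intro x
      by_cases hx : ws (fun _ => 1) (B ∩ {z | F x z}) ≤ ws (fun _ => 1) (B' ∩ {z | F x z})
      swap
      · exact ⟨id, hFe.refl, fun h => (hx h).elim⟩
      have hf1 : (B ∩ {z | F x z}).Finite := (hFf x).subset inter_subset_right
      have hf2 : (B' ∩ {z | F x z}).Finite := (hFf x).subset inter_subset_right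
      rw [ws_one hf1, ws_one hf2, Nat.cast_le] at hx
      have hx' : (B ∩ {z | F x z}).encard ≤ (B' ∩ {z | F x z}).encard := by
        rw [← hf1.cast_ncard_eq, ← hf2.cast_ncard_eq]; exact_mod_cast hx
      have : ∃ g : X → X, B ∩ {z | F x z} ⊆ g ⁻¹' (B' ∩ {z | F x z}) ∧ InjOn g (B ∩ {z | F x z}) := by
        rcases (B' ∩ {z | F x z}).eq_empty_or_nonempty with h | h
        · rw [h] at hx'
          simp at hx'
          rw [hx']; exact ⟨id, by simp, by simp⟩
        · have : Nonempty X := ⟨x⟩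
          exact hf1.exists_injOn_of_encard_le hx'
      obtain ⟨g, hg1, hg2⟩ := this
      refine ⟨fun y => if y ∈ B ∩ {z | F x z} then g y else y, fun y => ?_, fun _ => ⟨?_, ?_⟩⟩
      · beta_reduce
        split_ifs with h
        · exact hFe.trans (hFe.symm h.2) (hg1 h).2
        · exact hFe.refl y
      · rintro y - ⟨h1, h2⟩
        beta_reduce
        rw [if_pos (show y ∈ B ∩ {z | F x z} from ⟨h2, h1⟩)]
        exact (hg1 ⟨h2, h1⟩).1
      · rintro y - ⟨h1, h2⟩ z - ⟨h3, h4⟩ h5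
        beta_reduce at h5
        rw [if_pos (show y ∈ B ∩ {z | F x z} from ⟨h2, h1⟩), if_pos (show z ∈ B ∩ {z | F x z} from ⟨h4, h3⟩)] at h5
        exact hg2 ⟨h2, h1⟩ ⟨h4, h3⟩ h5)
  let N0 : Set X := {x | ∀ y, S.E x y → ws (fun _ => 1) (B ∩ {z | F y z}) < ws (fun _ => 1) (B' ∩ {z | F y z})}
  have hN0m : MeasurableSet N0 := meas_all (S := S) (P := fun x y => ws (fun _ => 1) (B ∩ {z | F y z}) < ws (fun _ => 1) (B' ∩ {z | F y z}))
    (measurable_snd (measurableSet_lt (mc hB) (mc hB')))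
  have hN0i : ∀ x y, S.E x y → x ∈ N0 → y ∈ N0 := fun x y hxy hx z hz => hx z (S.eqv.trans hxy hz)
  have hp1 : ∀ x ∈ N0, x ∈ B → p x ∈ B' := fun x hx hxB =>
    (hp x (hx x (S.refl x)).le).1 x (S.refl x) ⟨hFe.refl x, hxB⟩
  have hp2 : ∀ x ∈ N0, ∀ y, x ∈ B → y ∈ B → p x = p y → x = y := fun x hx y hxB hyB hxy =>
    have hF' : F x y := hFe.trans (hpF x) (hxy ▸ hFe.symm (hpF y))
    (hp x (hx x (S.refl x)).le).2 x (S.refl x) ⟨hFe.refl x, hxB⟩ y (hFE hF') ⟨hF', hyB⟩ hxy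
  let g : X → X := fun x => p (T x)
  have hgm : Measurable g := hpm.comp hTm
  have hgE : ∀ x ∈ B', S.E x (g x) := fun x hx => S.eqv.trans (hT x hx) (hFE (hpF _))
  have hgB : ∀ x ∈ N0 ∩ B', g x ∈ N0 ∩ B' := fun x hx =>
    ⟨hN0i _ _ (hgE x hx.2) hx.1, hp1 _ (hN0i _ _ (hT x hx.2) hx.1) (hTB x hx.2)⟩
  have hgi : ∀ x ∈ N0 ∩ B', ∀ y ∈ N0 ∩ B', g x = g y → x = y := fun x hx y hy hxy =>
    hTi hx.2 hy.2 (hp2 _ (hN0i _ _ (hT x hx.2) hx.1) _ (hTB x hx.2) (hTB y hy.2) hxy)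
  let M : Set X := {m | m ∈ N0 ∩ B' ∧ ∀ y, S.E m y → (y ∈ N0 ∩ B' → g y ≠ m)}
  have hMm : MeasurableSet M := by
    refine (hN0m.inter hB').inter (meas_all (S := S) (P := fun m y => y ∈ N0 ∩ B' → g y ≠ m) ?_)
    exact MeasurableSet.imp (measurable_snd (hN0m.inter hB'))
      (measurableSet_eq_fun (hgm.comp measurable_snd) measurable_fst).compl
  have hgn : ∀ n, ∀ x ∈ N0 ∩ B', g^[n] x ∈ N0 ∩ B' ∧ S.E x (g^[n] x) := by
    intro n x hx
    induction n with
    | zero => exact ⟨hx, S.refl x⟩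
    | succ n ih =>
      rw [Function.iterate_succ_apply']
      exact ⟨hgB _ ih.1, S.eqv.trans ih.2 (hgE _ ih.1.2)⟩
  have hroot : ∀ n k m m', m ∈ M → m' ∈ M → g^[n] m = g^[k] m' → n = k ∧ m = m' := by
    intro n
    induction n with
    | zero =>
      intro k m m' hm hm' h
      cases k with
      | zero => exact ⟨rfl, h⟩
      | succ k =>
        rw [Function.iterate_succ_apply'] at h
        exfalso
        have h1 := hgn k m' hm'.1
        exact hm.2 (g^[k] m') (S.eqv.symm (by simpa [← h] using hgE _ h1.1.2)) h1.1 h.symm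
    | succ n ih =>
      intro k m m' hm hm' h
      cases k with
      | zero =>
        rw [Function.iterate_succ_apply'] at h
        exfalso
        have h1 := hgn n m hm.1
        simp only [Function.iterate_zero, id] at h
        exact hm'.2 (g^[n] m) (S.eqv.symm (by simpa [← h] using hgE _ h1.1.2)) h1.1 h
      | succ k =>
        rw [Function.iterate_succ_apply', Function.iterate_succ_apply'] at h
        have := ih k m m' hm hm' (hgi _ (hgn n m hm.1).1 _ (hgn k m' hm'.1).1 h)
        exact ⟨by rw [this.1], this.2⟩
  have hPm : MeasurableSet {q : X × X | q.2 ∈ M ∧ ∃ n, g^[n] q.2 = q.1} := by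
    have : {q : X × X | q.2 ∈ M ∧ ∃ n, g^[n] q.2 = q.1} =
        {q : X × X | q.2 ∈ M} ∩ ⋃ n, {q : X × X | g^[n] q.2 = q.1} := by
      ext q; simp
    rw [this]
    exact (measurable_snd hMm).inter (MeasurableSet.iUnion fun n =>
      measurableSet_eq_fun ((hgm.iterate n).comp measurable_snd) measurable_fst)
  refine (comp_rel (S := S) (P := fun y m => m ∈ M ∧ ∃ n, g^[n] m = y) hPm ?_ ?_).mono ?_
  · rintro y m ⟨hm, n, rfl⟩
    exact S.eqv.symm (hgn n m hm.1).2
  · rintro y m m' ⟨hm, n, hn⟩ ⟨hm', k, hk⟩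
    exact (hroot n k m m' hm hm' (hn.trans hk.symm)).2
  · intro x hx
    have hxN : x ∈ N0 := hx
    have h1 := hx x (S.refl x)
    have : ∃ m ∈ B' ∩ {z | F x z}, m ∉ p '' (B ∩ {z | F x z}) := by
      by_contra hcon
      push Not at hcon
      have hsub : B' ∩ {z | F x z} ⊆ p '' (B ∩ {z | F x z}) := hcon
      have hf1 : (B ∩ {z | F x z}).Finite := (hFf x).subset inter_subset_right
      have hf2 : (B' ∩ {z | F x z}).Finite := (hFf x).subset inter_subset_right
      rw [ws_one hf1, ws_one hf2, Nat.cast_lt] at h1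
      have h2 := ncard_le_ncard hsub (hf1.image p)
      have h3 := ncard_image_le (f := p) hf1
      omega
    obtain ⟨m, ⟨hmB, hmF⟩, hmp⟩ := this
    have hmF' : F x m := hmF
    have hmM : m ∈ M := by
      refine ⟨⟨hN0i _ _ (hFE hmF') hxN, hmB⟩, fun y hy hyN hgy => hmp ⟨T y, ⟨hTB y hyN.2, ?_⟩, hgy⟩⟩
      have : F (T y) m := hgy ▸ hpF (T y)
      exact hFe.trans hmF' (hFe.symm this)
    refine ⟨m, hFE hmF', ?_⟩
    rw [ws_f_top_iff]
    refine ws_top_of_infinite (c := (2 : ℝ≥0∞) ^ b) (fun h => S.h_ne_zero m (by rw [Sys.h, hl m hmB]; exact h)) ?_ ?_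
    · refine Set.infinite_of_injective_forall_mem (f := fun n => g^[n] m) ?_ ?_
      · intro n k hnk
        exact (hroot n k m m hmM hmM hnk).1
      · intro n; exact ⟨hmM, n, rfl⟩
    · rintro y ⟨-, n, rfl⟩
      rw [Sys.h, hl _ (hgn n m hmM.1).1.2]

end Sys

end CocycleNadkarni

namespace CocycleNadkarni

set_option linter.unusedSectionVars false

lemma dep_choice {α : Type*} {Inv : ℕ → α → Prop} {Step : ℕ → α → α → Prop} {a : α} (h0 : Inv 0 a)
    (hs : ∀ k p, Inv k p → ∃ p', Inv (k+1) p' ∧ Step k p p') :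
    ∃ p : ℕ → α, p 0 = a ∧ (∀ k, Inv k (p k)) ∧ ∀ k, Step k (p k) (p (k+1)) := by
  choose nx h1 h2 using hs
  let s : ∀ k, {p // Inv k p} := fun k =>
    Nat.rec ⟨a, h0⟩ (fun k p => ⟨nx k p.1 p.2, h1 k p.1 p.2⟩) k
  exact ⟨fun k => (s k).1, rfl, fun k => (s k).2, fun k => h2 k _ _⟩

namespace Sys
variable {X : Type*} [MeasurableSpace X] {S : Sys X} [StandardBorelSpace X]

theorem finSel' {F : X → X → Prop} (hF : IsFinSubequiv S.E F) (Θ : X → (X → X) → Prop)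
    (hloc : ∀ b p q, (∀ y, F b y → p y = q y) → Θ b p → Θ b q)
    (hm : ∀ p, Measurable p → (∀ x, F x (p x)) → MeasurableSet {b | Θ b p})
    (hex : ∀ b, ∃ p, (∀ x, F x (p x)) ∧ ∀ x, F b x → Θ x p) :
    ∃ p, Measurable p ∧ (∀ x, F x (p x)) ∧ ∀ b, Θ b p := by
  obtain ⟨hFe, hFm, hFE, hFf⟩ := id hF
  obtain ⟨p, h1, h2, h3⟩ := finSel hF (fun b p => ∀ x, S.E b x → F b x → Θ x p)
    (by
      intro b p q hpq h x h1 h2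
      exact hloc x p q (fun y hy => hpq y (hFe.trans h2 hy)) (h x h1 h2))
    (by
      intro b c p hbc h x h1 h2
      exact h x (S.eqv.trans (hFE hbc) h1) (hFe.trans hbc h2))
    (by
      intro p hp hpF
      exact meas_all (S := S) (P := fun b x => F b x → Θ x p)
        (MeasurableSet.imp hFm (measurable_snd (hm p hp hpF))))
    (by
      intro b
      obtain ⟨p, h1, h2⟩ := hex b
      exact ⟨p, h1, fun x _ h => h2 x h⟩)
  exact ⟨p, h1, h2, fun b => h3 b b (S.refl b) (hFe.refl b)⟩

/-- mass of `P 0 ∪ … ∪ P k` escapes -/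
def Esc (S : Sys X) (F : ℕ → X → X → Prop) (P : ℕ → Set X) : Set X :=
  {x | (∃ y, S.E x y ∧ y ∈ P 0) ∧ ∀ k, ∃ n, ∀ y, S.E x y →
    5 * ws S.h ({z | ∃ j ≤ k, z ∈ P j} ∩ {z | F n y z}) ≤ ws S.h ((⋃ j, P j) ∩ {z | F n y z})}

lemma meas_le {P : ℕ → Set X} (hP : ∀ k, MeasurableSet (P k)) (k : ℕ) :
    MeasurableSet {z | ∃ j ≤ k, z ∈ P j} := by
  have : {z | ∃ j ≤ k, z ∈ P j} = ⋃ j, ⋃ (_ : j ≤ k), P j := by ext z; simp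
  rw [this]
  exact MeasurableSet.iUnion fun j => MeasurableSet.iUnion fun _ => hP j

lemma esc_G {F : ℕ → X → X → Prop} (hF : ∀ n, IsFinSubequiv S.E (F n))
    (hmono : ∀ n m, n ≤ m → ∀ x y, F n x y → F m x y) {P : ℕ → Set X}
    (hP : ∀ k, MeasurableSet (P k)) :
    ∃ (G : ℕ → X → X → Prop) (D : Set X), (∀ k, IsFinSubequiv S.E (G k)) ∧
      (∀ n m, n ≤ m → ∀ x y, G n x y → G m x y) ∧ MeasurableSet D ∧
      (∀ x y, S.E x y → x ∈ D → y ∈ D) ∧ S.Esc F P ⊆ D ∧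
      ∀ x ∈ D, ∀ k, 5 * ws S.h ({z | ∃ j ≤ k, z ∈ P j} ∩ {z | G k x z}) ≤
        ws S.h ((⋃ j, P j) ∩ {z | G k x z}) := by
  classical
  let Q : ℕ → ℕ → X → Prop := fun k n x => ∀ y, S.E x y →
    5 * ws S.h ({z | ∃ j ≤ k, z ∈ P j} ∩ {z | F n y z}) ≤ ws S.h ((⋃ j, P j) ∩ {z | F n y z})
  have hQm : ∀ k n, MeasurableSet {x | Q k n x} := by
    intro k n
    have mc : ∀ {D : Set X}, MeasurableSet D → Measurable fun x => ws S.h (D ∩ {z | F n x z}) := by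
      intro D hD
      exact meas_ws (S := S) (P := fun x y => y ∈ D ∧ F n x y) S.h_meas
        ((measurable_snd hD).inter (hF n).2.1) fun x y h => (hF n).2.2.1 h.2
    refine meas_all (S := S) (P := fun x y => 5 * ws S.h ({z | ∃ j ≤ k, z ∈ P j} ∩ {z | F n y z}) ≤ ws S.h ((⋃ j, P j) ∩ {z | F n y z})) ?_
    exact measurable_snd (measurableSet_le ((mc (meas_le hP k)).const_mul 5) (mc (MeasurableSet.iUnion hP)))
  have hQi : ∀ k n x y, S.E x y → Q k n x → Q k n y := fun k n x y hxy h z hz => h z (S.eqv.trans hxy hz)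
  have hQk : ∀ k n x, Q (k+1) n x → Q k n x := by
    intro k n x h y hy
    refine le_trans ?_ (h y hy)
    gcongr
    apply ws_mono
    apply inter_subset_inter_left
    rintro z ⟨j, hj, hz⟩
    exact ⟨j, by omega, hz⟩
  let D : Set X := {x | ∀ k, ∃ n, Q k n x}
  have hDm : MeasurableSet D := by
    have : D = ⋂ k, ⋃ n, {x | Q k n x} := by ext x; simp [D]
    rw [this]
    exact MeasurableSet.iInter fun k => MeasurableSet.iUnion fun n => hQm k n
  have hDi : ∀ x y, S.E x y → x ∈ D → y ∈ D := by
    intro x y hxy hx k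
    obtain ⟨n, hn⟩ := hx k
    exact ⟨n, hQi k n x y hxy hn⟩
  have hex : ∀ k x, ∃ n, Q k n x ∨ x ∉ D := by
    intro k x
    by_cases hx : x ∈ D
    · obtain ⟨n, hn⟩ := hx k; exact ⟨n, Or.inl hn⟩
    · exact ⟨0, Or.inr hx⟩
  let nk : ℕ → X → ℕ := fun k x => Nat.find (hex k x)
  have hnkm : ∀ k, Measurable (nk k) := fun k => measurable_find _ fun n => (hQm k n).union hDm.compl
  have hnki : ∀ k x y, S.E x y → nk k x = nk k y := by
    intro k x y hxy
    simp only [nk]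
    apply Nat.find_congr'
    intro n
    have h1 : x ∈ D ↔ y ∈ D := ⟨hDi _ _ hxy, hDi _ _ (S.eqv.symm hxy)⟩
    have h2 : Q k n x ↔ Q k n y := ⟨hQi _ _ _ _ hxy, hQi _ _ _ _ (S.eqv.symm hxy)⟩
    rw [h1, h2]
  have hnks : ∀ x, Monotone fun k => nk k x := by
    intro x
    refine monotone_nat_of_le_succ fun k => ?_
    apply Nat.find_mono
    rintro n (h | h)
    · exact Or.inl (hQk _ _ _ h)
    · exact Or.inr h
  refine ⟨fun k x y => F (nk k x) x y, D, ?_, ?_, hDm, hDi, fun x hx => hx.2, ?_⟩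
  · intro k
    refine ⟨⟨fun x => (hF _).1.refl x, ?_, ?_⟩, ?_, fun x y h => (hF _).2.2.1 h, fun x => (hF _).2.2.2 x⟩
    · intro x y h
      beta_reduce at h ⊢
      rw [← hnki k x y ((hF _).2.2.1 h)]
      exact (hF _).1.symm h
    · intro x y z h h'
      beta_reduce at h h' ⊢
      rw [← hnki k x y ((hF _).2.2.1 h)] at h'
      exact (hF _).1.trans h h'
    · have : {p : X × X | F (nk k p.1) p.1 p.2} = ⋃ n, ({p : X × X | nk k p.1 = n} ∩ {p | F n p.1 p.2}) := by
        ext p; simp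
      rw [this]
      exact MeasurableSet.iUnion fun n =>
        (((hnkm k).comp measurable_fst) (measurableSet_singleton n)).inter (hF n).2.1
  · intro n m hnm x y h
    exact hmono _ _ (hnks x hnm) _ _ h
  · intro x hx k
    have := (Nat.find_spec (hex k x)).resolve_right (by simpa using hx)
    exact this x (S.refl x)

end Sys

/-- a subset of mass between `c` and `2 * c` -/
lemma exists_chunk {X : Type*} {w : X → ℝ≥0∞} {c : ℝ≥0∞} (B : Finset X) (hB : ∀ y ∈ B, w y ≤ c)
    (h : c ≤ ws w B) : ∃ T : Finset X, T ⊆ B ∧ c ≤ ws w T ∧ ws w T ≤ 2 * c := by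
  classical
  induction B using Finset.induction_on with
  | empty => exact ⟨∅, le_refl _, h, by simp [ws_empty]⟩
  | insert a B ha ih =>
    by_cases h' : c ≤ ws w B
    · obtain ⟨T, h1, h2⟩ := ih (fun y hy => hB y (Finset.mem_insert_of_mem hy)) h'
      exact ⟨T, h1.trans (Finset.subset_insert _ _), h2⟩
    · refine ⟨insert a B, le_refl _, h, ?_⟩
      rw [ws_finset, Finset.sum_insert ha, ← ws_finset, two_mul]
      exact add_le_add (hB a (Finset.mem_insert_self _ _)) (not_le.1 h').le

lemma pack {X : Type*} {w : X → ℝ≥0∞} {c : ℝ≥0∞} (hc0 : c ≠ 0) (hct : c ≠ ⊤) (I : Finset X) :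
    ∀ (B : Finset X), (∀ y ∈ B, w y ≤ c) → Disjoint I B → 2 * (I.card * c) ≤ ws w B →
    ∃ q : X → X, (∀ y, q y ≠ y → y ∈ B ∧ q y ∈ I) ∧
      ∀ x ∈ I, c ≤ ws w {y | q y = x ∧ y ≠ x} ∧ ws w {y | q y = x ∧ y ≠ x} ≤ 2 * c := by
  classical
  induction I using Finset.induction_on with
  | empty => exact fun B _ _ _ => ⟨id, fun y h => (h rfl).elim, fun x hx => by simp at hx⟩
  | insert x I hx ih =>
    intro B hB hd hm
    rw [Finset.card_insert_of_notMem hx] at hm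
    have hm' : 2 * (I.card * c) + 2 * c ≤ ws w B := by
      refine le_trans (le_of_eq ?_) hm
      push_cast; ring
    obtain ⟨T, hT, hT1, hT2⟩ := exists_chunk B hB (le_trans (by rw [two_mul]; exact le_self_add) (le_trans le_add_self hm'))
    rw [Finset.disjoint_insert_left] at hd
    have hTt : ws w T ≠ ⊤ := ne_top_of_le_ne_top (ENNReal.mul_ne_top (by simp) hct) hT2
    have hm2 : 2 * (I.card * c) ≤ ws w (B \ T : Finset X) := by
      have e : ws w B = ws w (B \ T : Finset X) + ws w T := by
        rw [ws_finset, ws_finset, ws_finset, Finset.sum_sdiff hT]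
      rw [e] at hm'
      have : 2 * (I.card * c) + 2 * c ≤ ws w (B \ T : Finset X) + 2 * c :=
        hm'.trans (by gcongr)
      exact (ENNReal.add_le_add_iff_right (ENNReal.mul_ne_top (by simp) hct)).1 this
    obtain ⟨q, hq1, hq2⟩ := ih (B \ T) (fun y hy => hB y (Finset.sdiff_subset hy))
      (hd.2.mono_right Finset.sdiff_subset) hm2
    have hqT : ∀ y ∈ T, q y = y := by
      intro y hy
      by_contra h
      exact (Finset.mem_sdiff.1 (hq1 y h).1).2 hy
    refine ⟨fun y => if y ∈ T then x else q y, ?_, ?_⟩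
    · intro y hy
      by_cases hyT : y ∈ T
      · simp only [hyT, if_true] at hy ⊢
        exact ⟨hT hyT, Finset.mem_insert_self _ _⟩
      · simp only [hyT, if_false] at hy ⊢
        exact ⟨Finset.sdiff_subset (hq1 y hy).1, Finset.mem_insert_of_mem (hq1 y hy).2⟩
    · intro x' hx'
      rcases Finset.mem_insert.1 hx' with rfl | hx'
      · have : {y | (if y ∈ T then x' else q y) = x' ∧ y ≠ x'} = (T : Set X) := by
          ext y
          by_cases hyT : y ∈ T
          · simp only [hyT, if_true, mem_ofPred_eq, true_and, Finset.mem_coe, iff_true]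
            rintro rfl
            exact hd.1 (hT hyT)
          · simp only [hyT, if_false, mem_ofPred_eq, Finset.mem_coe, iff_false]
            rintro ⟨h1, h2⟩
            have := (hq1 y (by rw [h1]; exact h2.symm)).2
            rw [h1] at this
            exact hx this
        rw [this]
        exact ⟨hT1, hT2⟩
      · have hne : x ≠ x' := by rintro rfl; exact hx hx'
        have : {y | (if y ∈ T then x else q y) = x' ∧ y ≠ x'} = {y | q y = x' ∧ y ≠ x'} := by
          ext y
          by_cases hyT : y ∈ T
          · simp only [hyT, if_true, mem_ofPred_eq, hne, false_and, false_iff]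
            rintro ⟨h1, h2⟩
            exact h2 ((hqT y hyT).symm.trans h1)
          · simp [hyT]
        rw [this]
        exact hq2 x' hx'

end CocycleNadkarni

namespace CocycleNadkarni

set_option linter.unusedSectionVars false

lemma ws_fiber {X : Type*} (w : X → ℝ≥0∞) (q : X → X) (A : Set X) :
    ws w {y | q y ∈ A ∧ y ≠ q y} = ∑' x, A.indicator (fun x => ws w {y | q y = x ∧ y ≠ x}) x := by
  classical
  have : ∀ x, A.indicator (fun x => ws w {y | q y = x ∧ y ≠ x}) x =
      ∑' y, (if x ∈ A ∧ q y = x ∧ y ≠ x then w y else 0) := by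
    intro x
    by_cases hx : x ∈ A
    · simp only [hx, indicator_of_mem, ws, indicator, mem_ofPred_eq, true_and, if_true]
      exact tsum_congr fun y => by congr
    · simp [hx]
  simp_rw [this]
  rw [ENNReal.tsum_comm, ws]
  congr 1
  funext y
  rw [tsum_eq_single (q y)]
  · by_cases h : q y ∈ A ∧ y ≠ q y
    · rw [indicator_of_mem (show y ∈ {y | q y ∈ A ∧ y ≠ q y} from h), if_pos ⟨h.1, rfl, h.2⟩]
    · rw [indicator_of_notMem (show y ∉ {y | q y ∈ A ∧ y ≠ q y} from h), if_neg]
      rintro ⟨h1, _, h2⟩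
      exact h ⟨h1, h2⟩
  · intro x hx
    rw [if_neg]
    rintro ⟨_, h, _⟩
    exact hx h.symm

lemma ws_fiber_le {X : Type*} {w : X → ℝ≥0∞} {q : X → X} {A : Set X} {c : ℝ≥0∞}
    (h : ∀ x ∈ A, ws w {y | q y = x ∧ y ≠ x} ≤ c * w x) :
    ws w {y | q y ∈ A ∧ y ≠ q y} ≤ c * ws w A := by
  rw [ws_fiber, ws, ← ENNReal.tsum_mul_left]
  refine ENNReal.tsum_le_tsum fun x => ?_
  by_cases hx : x ∈ A
  · simpa [hx] using h x hx
  · simp [hx]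

lemma ws_le_fiber {X : Type*} {w : X → ℝ≥0∞} {q : X → X} {A : Set X}
    (h : ∀ x ∈ A, w x ≤ ws w {y | q y = x ∧ y ≠ x}) :
    ws w A ≤ ws w {y | q y ∈ A ∧ y ≠ q y} := by
  rw [ws_fiber, ws]
  refine ENNReal.tsum_le_tsum fun x => ?_
  by_cases hx : x ∈ A
  · simpa [hx] using h x hx
  · simp [hx]

namespace Sys
variable {X : Type*} [MeasurableSpace X] {S : Sys X} [StandardBorelSpace X]

def InvII (S : Sys X) (G : ℕ → X → X → Prop) (D : Set X) (P : ℕ → Set X) (k : ℕ) (p : X → X) : Prop :=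
  Measurable p ∧ (∀ y, p y ≠ y → y ∈ D ∧ ∃ j i, j < k ∧ j < i ∧ y ∈ P i ∧ p y ∈ P j ∧ G j y (p y)) ∧
  ∀ x ∈ D, ∀ j < k, x ∈ P j → S.h x ≤ ws S.h {y | p y = x ∧ y ≠ x} ∧
    ws S.h {y | p y = x ∧ y ≠ x} ≤ 2 * S.h x

lemma stepII {G : ℕ → X → X → Prop} {D : Set X} {P : ℕ → Set X} {lam : ℕ → ℤ}
    (hG : ∀ k, IsFinSubequiv S.E (G k)) (hGm : ∀ n m, n ≤ m → ∀ x y, G n x y → G m x y)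
    (hD : MeasurableSet D) (hDi : ∀ x y, S.E x y → x ∈ D → y ∈ D)
    (hG5 : ∀ x ∈ D, ∀ k, 5 * ws S.h ({z | ∃ j ≤ k, z ∈ P j} ∩ {z | G k x z}) ≤
        ws S.h ((⋃ j, P j) ∩ {z | G k x z}))
    (hP : ∀ k, MeasurableSet (P k)) (hd : ∀ i j x, x ∈ P i → x ∈ P j → i = j)
    (hl : ∀ k, ∀ x ∈ P k, S.l x = lam k) (ha : Antitone lam) (k : ℕ) (p : X → X)
    (hp : S.InvII G D P k p) :
    ∃ p', S.InvII G D P (k+1) p' ∧ ∀ y, p y ≠ y → p' y = p y := by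
  classical
  obtain ⟨hpm, hp1, hp2⟩ := hp
  obtain ⟨hGe, hGme, hGE, hGf⟩ := id (hG k)
  have hgtm : MeasurableSet {x | ∃ i > k, x ∈ P i} := by
    have : {x | ∃ i > k, x ∈ P i} = ⋃ i, ⋃ (_ : i > k), P i := by ext; simp
    rw [this]
    exact MeasurableSet.iUnion fun i => MeasurableSet.iUnion fun _ => hP i
  obtain ⟨q, hqm, hqG, hqΘ⟩ := finSel' (S := S) (hG k) (fun x q =>
      (q x ≠ x → (x ∈ D ∧ p x = x ∧ x ∈ {x | ∃ i > k, x ∈ P i} ∧ q x ∈ P k)) ∧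
      (x ∈ D ∩ P k → (S.h x ≤ ws S.h {y | G k x y ∧ q y = x ∧ y ≠ x} ∧
        ws S.h {y | G k x y ∧ q y = x ∧ y ≠ x} ≤ 2 * S.h x)))
    (by
      intro b q q' hqq h
      have e : {y | G k b y ∧ q' y = b ∧ y ≠ b} = {y | G k b y ∧ q y = b ∧ y ≠ b} := by
        ext y
        simp only [mem_ofPred_eq]
        refine and_congr_right fun hy => ?_
        rw [hqq y hy]
      rw [e, ← hqq b (hGe.refl b)]
      exact h)
    (by
      intro q hqm hqG
      have hne : ∀ {r : X → X}, Measurable r → MeasurableSet {x | r x ≠ x} := fun hr =>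
        (measurableSet_eq_fun hr measurable_id).compl
      have m1 : Measurable fun x => ws S.h {y | G k x y ∧ q y = x ∧ y ≠ x} := by
        refine meas_ws (S := S) (P := fun x y => G k x y ∧ q y = x ∧ y ≠ x) S.h_meas ?_ fun x y h => hGE h.1
        exact hGme.inter ((measurableSet_eq_fun (hqm.comp measurable_snd) measurable_fst).inter
          (measurableSet_eq_fun measurable_snd measurable_fst).compl)
      refine MeasurableSet.inter (MeasurableSet.imp (hne hqm) ?_) (MeasurableSet.imp (hD.inter (hP k)) ?_)
      · exact hD.inter ((measurableSet_eq_fun hpm measurable_id).inter (hgtm.inter (hqm (hP k))))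
      · exact (measurableSet_le S.h_meas m1).inter (measurableSet_le m1 (S.h_meas.const_mul 2)))
    (by
      intro b
      by_cases hb : b ∈ D
      swap
      · refine ⟨id, fun x => hGe.refl x, fun x hx => ⟨fun h => (h rfl).elim, fun h => ?_⟩⟩
        exact (hb (hDi _ _ (S.eqv.symm (hGE hx)) h.1)).elim
      have hfin : {z | G k b z}.Finite := hGf b
      have hIf : (P k ∩ {z | G k b z}).Finite := hfin.subset inter_subset_right
      have hBf : ({z | p z = z ∧ ∃ i > k, z ∈ P i} ∩ {z | G k b z}).Finite := hfin.subset inter_subset_right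
      have hhc : ∀ x ∈ P k, S.h x = (2:ℝ≥0∞) ^ (lam k) := by
        intro x hx
        rw [Sys.h, hl k x hx]
      obtain ⟨q, hq1, hq2⟩ := pack (w := S.h) (c := (2:ℝ≥0∞) ^ (lam k))
        (ENNReal.zpow_pos (by simp) (by simp) _).ne' (ENNReal.zpow_lt_top (by simp) (by simp) _).ne
        hIf.toFinset hBf.toFinset
        (by
          intro y hy
          obtain ⟨⟨_, i, hi, hyi⟩, _⟩ := hBf.mem_toFinset.1 hy
          rw [Sys.h, hl i y hyi]
          exact ENNReal.zpow_le_of_le (by norm_num) (ha (le_of_lt hi)))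
        (by
          rw [Finset.disjoint_left]
          intro y h1 h2
          obtain ⟨h1, _⟩ := hIf.mem_toFinset.1 h1
          obtain ⟨⟨_, i, hi, hyi⟩, _⟩ := hBf.mem_toFinset.1 h2
          have := hd _ _ _ h1 hyi
          omega)
        (by
          rw [hBf.coe_toFinset]
          set C := {z | G k b z} with hC
          set a := ws S.h ({z | ∃ j ≤ k, z ∈ P j} ∩ C) with ha'
          have hat : a ≠ ⊤ := ws_ne_top (fun _ => S.h_ne_top _) (hfin.subset inter_subset_right)
          have hIa : hIf.toFinset.card * (2:ℝ≥0∞) ^ (lam k) ≤ a := by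
            have : (hIf.toFinset.card * (2:ℝ≥0∞) ^ (lam k)) = ws S.h (P k ∩ C) := by
              conv_rhs => rw [← hIf.coe_toFinset]
              rw [ws_finset, Finset.sum_congr rfl (g := fun _ => (2:ℝ≥0∞) ^ (lam k)), Finset.sum_const, nsmul_eq_mul]
              intro x hx
              exact hhc x (hIf.mem_toFinset.1 hx).1
            rw [this]
            apply ws_mono
            rintro z ⟨h1, h2⟩
            exact ⟨⟨k, le_refl _, h1⟩, h2⟩
          have hu : ws S.h {y | p y ∈ ({z | D z ∧ ∃ j < k, z ∈ P j} ∩ C) ∧ y ≠ p y} ≤ 2 * a := by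
            refine (ws_fiber_le (c := 2) ?_).trans ?_
            · rintro x ⟨⟨hxD, j, hj, hx⟩, hxC⟩
              exact (hp2 x hxD j hj hx).2
            · gcongr
              apply ws_mono
              rintro z ⟨⟨_, j, hj, h⟩, h'⟩
              exact ⟨⟨j, hj.le, h⟩, h'⟩
          have h5 : 5 * a ≤ a + 2 * a + ws S.h ({z | p z = z ∧ ∃ i > k, z ∈ P i} ∩ C) := by
            refine (hG5 b hb k).trans ?_
            refine le_trans (ws_mono (T := (({z | ∃ j ≤ k, z ∈ P j} ∩ C) ∪ {y | p y ∈ ({z | D z ∧ ∃ j < k, z ∈ P j} ∩ C) ∧ y ≠ p y}) ∪ ({z | p z = z ∧ ∃ i > k, z ∈ P i} ∩ C)) ?_) ?_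
            · rintro z ⟨hz, hzC⟩
              obtain ⟨i, hi⟩ := mem_iUnion.1 hz
              by_cases hik : i ≤ k
              · exact Or.inl (Or.inl ⟨⟨i, hik, hi⟩, hzC⟩)
              · by_cases hpz : p z = z
                · exact Or.inr ⟨⟨hpz, i, not_le.1 hik, hi⟩, hzC⟩
                · left; right
                  obtain ⟨h1, j, i', h2, h3, h4, h5, h6⟩ := hp1 z hpz
                  have : G k z (p z) := hGm _ _ h2.le _ _ h6
                  exact ⟨⟨⟨hDi _ _ (hGE this) h1, j, h2, h5⟩, hGe.trans hzC this⟩, Ne.symm hpz⟩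
            · refine (ws_union_le _ _).trans ?_
              gcongr
              refine (ws_union_le _ _).trans ?_
              gcongr
          have : a + 2 * a + 2 * a ≤ a + 2 * a + ws S.h ({z | p z = z ∧ ∃ i > k, z ∈ P i} ∩ C) := by
            refine le_trans (le_of_eq ?_) h5
            ring
          have := (ENNReal.add_le_add_iff_left (by finiteness)).1 this
          exact le_trans (by gcongr) this)
      have hqC : ∀ y, q y ≠ y → G k b y ∧ G k b (q y) := fun y hy =>
        ⟨(hBf.mem_toFinset.1 (hq1 y hy).1).2, (hIf.mem_toFinset.1 (hq1 y hy).2).2⟩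
      refine ⟨q, ?_, ?_⟩
      · intro x
        by_cases hx : q x = x
        · rw [hx]; exact hGe.refl x
        · exact hGe.trans (hGe.symm (hqC x hx).1) (hqC x hx).2
      · intro x hx
        refine ⟨fun hqx => ?_, ?_⟩
        · obtain ⟨h1, h2⟩ := hq1 x hqx
          obtain ⟨⟨h3, h4⟩, h5⟩ := hBf.mem_toFinset.1 h1
          exact ⟨hDi _ _ (hGE h5) hb, h3, h4, (hIf.mem_toFinset.1 h2).1⟩
        · rintro ⟨hxD, hxk⟩
          have := hq2 x (hIf.mem_toFinset.2 ⟨hxk, hx⟩)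
          have e : {y | G k x y ∧ q y = x ∧ y ≠ x} = {y | q y = x ∧ y ≠ x} := by
            ext y
            simp only [mem_ofPred_eq, and_iff_right_iff_imp]
            rintro ⟨rfl, h⟩
            exact hGe.trans (hGe.symm hx) (hqC y h.symm).1
          rw [e, hhc x hxk]
          exact this)
  refine ⟨fun y => if p y ≠ y then p y else q y, ⟨?_, ?_, ?_⟩, ?_⟩
  · exact Measurable.ite (measurableSet_eq_fun hpm measurable_id).compl hpm hqm
  · intro y hy
    beta_reduce at hy ⊢
    by_cases h : p y ≠ y
    · rw [if_pos h] at hy ⊢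
      obtain ⟨h1, j, i, h2, h3⟩ := hp1 y h
      exact ⟨h1, j, i, by omega, h3⟩
    · rw [if_neg h] at hy ⊢
      obtain ⟨h1, h2, ⟨i, hi, hyi⟩, h4⟩ := (hqΘ y).1 hy
      exact ⟨h1, k, i, by omega, hi, hyi, h4, hqG y⟩
  · intro x hxD j hj hxj
    by_cases hjk : j = k
    · subst hjk
      have e : {y | (if p y ≠ y then p y else q y) = x ∧ y ≠ x} = {y | G j x y ∧ q y = x ∧ y ≠ x} := by
        ext y
        simp only [mem_ofPred_eq]
        by_cases h : p y ≠ y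
        · rw [if_pos h]
          constructor
          · rintro ⟨h1, _⟩
            obtain ⟨_, j', _, h2, _, _, h3, _⟩ := hp1 y h
            rw [h1] at h3
            have := hd _ _ _ h3 hxj
            omega
          · rintro ⟨_, h1, h2⟩
            exact (h ((hqΘ y).1 (by rw [h1]; exact h2.symm)).2.1).elim
        · rw [if_neg h]
          refine ⟨fun h' => ⟨?_, h'⟩, fun h' => h'.2⟩
          have := hqG y
          rw [h'.1] at this
          exact hGe.symm this
      rw [e]
      exact (hqΘ x).2 ⟨hxD, hxj⟩
    · have e : {y | (if p y ≠ y then p y else q y) = x ∧ y ≠ x} = {y | p y = x ∧ y ≠ x} := by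
        ext y
        simp only [mem_ofPred_eq]
        by_cases h : p y ≠ y
        · rw [if_pos h]
        · rw [if_neg h]
          push Not at h
          constructor
          · rintro ⟨h1, h2⟩
            have := ((hqΘ y).1 (by rw [h1]; exact h2.symm)).2.2.2
            rw [h1] at this
            exact (hjk (hd _ _ _ hxj this)).elim
          · rintro ⟨h1, h2⟩
            exact (h2 (h.symm.trans h1)).elim
      rw [e]
      exact hp2 x hxD j (by omega) hxj
  · intro y hy
    beta_reduce
    rw [if_pos hy]

theorem comp_II {F : ℕ → X → X → Prop} (hF : ∀ n, IsFinSubequiv S.E (F n))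
    (hmono : ∀ n m, n ≤ m → ∀ x y, F n x y → F m x y) {P : ℕ → Set X} {lam : ℕ → ℤ}
    (hP : ∀ k, MeasurableSet (P k)) (hd : ∀ i j x, x ∈ P i → x ∈ P j → i = j)
    (hl : ∀ k, ∀ x ∈ P k, S.l x = lam k) (ha : Antitone lam) : S.Comp (S.Esc F P) := by
  classical
  obtain ⟨G, D, hG, hGm, hD, hDi, hED, hG5⟩ := esc_G hF hmono hP
  obtain ⟨p, hp0, hpI, hpS⟩ := dep_choice (Inv := S.InvII G D P) (Step := fun _ p p' => ∀ y, p y ≠ y → p' y = p y)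
    (a := id) ⟨measurable_id, fun y h => (h rfl).elim, fun x _ j hj => by omega⟩
    fun k p hp => stepII hG hGm hD hDi hG5 hP hd hl ha k p hp
  have hst : ∀ k n y, p k y ≠ y → p (k + n) y = p k y := by
    intro k n y hy
    induction n with
    | zero => rfl
    | succ n ih => rw [← add_assoc, hpS (k+n) y (by rw [ih]; exact hy), ih]
  have hex : ∀ y, ∃ k, p k y ≠ y ∨ ∀ k, p k y = y := by
    intro y
    by_cases h : ∀ k, p k y = y
    · exact ⟨0, Or.inr h⟩
    · push Not at h
      obtain ⟨k, hk⟩ := h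
      exact ⟨k, Or.inl hk⟩
  have hpm : ∀ k, Measurable (p k) := fun k => (hpI k).1
  let idx : X → ℕ := fun y => Nat.find (hex y)
  have hidx : Measurable idx := by
    refine measurable_find _ fun k => ?_
    refine (measurableSet_eq_fun (hpm k) measurable_id).compl.union ?_
    have : {y | ∀ k, p k y = y} = ⋂ k, {y | p k y = y} := by ext; simp
    change MeasurableSet {y | ∀ k, p k y = y}
    rw [this]
    exact MeasurableSet.iInter fun k => measurableSet_eq_fun (hpm k) measurable_id
  let par : X → X := fun y => p (idx y) y
  have hparm : Measurable par := by
    have h := measurable_from_prod_countable_right (f := fun q : ℕ × X => p q.1 q.2) fun n => hpm n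
    exact h.comp (hidx.prodMk measurable_id)
  have hpar : ∀ k y, p k y ≠ y → par y = p k y := by
    intro k y hy
    have h1 : p (idx y) y ≠ y := (Nat.find_spec (hex y)).resolve_right fun h => hy (h k)
    have h2 : idx y ≤ k := Nat.find_min' (hex y) (Or.inl hy)
    obtain ⟨n, rfl⟩ := Nat.exists_eq_add_of_le h2
    exact (hst _ n y h1).symm
  have hpar1 : ∀ y, par y ≠ y → y ∈ D ∧ ∃ j i, j < i ∧ y ∈ P i ∧ par y ∈ P j ∧ S.E y (par y) := by
    intro y hy
    obtain ⟨h1, j, i, h2, h3, h4, h5, h6⟩ := (hpI (idx y)).2.1 y hy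
    exact ⟨h1, j, i, h3, h4, h5, (hG j).2.2.1 h6⟩
  have hparE : ∀ y, S.E y (par y) := by
    intro y
    by_cases h : par y = y
    · rw [h]; exact S.refl y
    · obtain ⟨_, _, _, _, _, _, h⟩ := hpar1 y h
      exact h
  have hpar2 : ∀ x ∈ D, ∀ j, x ∈ P j → S.h x ≤ ws S.h {y | par y = x ∧ y ≠ x} := by
    intro x hx j hj
    refine ((hpI (j+1)).2.2 x hx j (by omega) hj).1.trans (ws_mono ?_)
    rintro y ⟨rfl, h2⟩
    exact ⟨hpar _ _ h2.symm, h2⟩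
  have hpar0 : ∀ m ∈ P 0, par m = m := by
    intro m hm
    by_contra h
    obtain ⟨_, j, i, h1, h2, _⟩ := hpar1 m h
    have := hd _ _ _ hm h2
    omega
  have hparE' : ∀ n y, S.E y (par^[n] y) := by
    intro n
    induction n with
    | zero => exact S.refl
    | succ n ih => intro y; exact S.eqv.trans (hparE y) (ih (par y))
  have hparn : ∀ n, Measurable (par^[n]) := fun n => hparm.iterate n
  have hfix : ∀ m ∈ P 0, ∀ n, par^[n] m = m := fun m hm n => Function.iterate_fixed (hpar0 m hm) n
  refine (comp_rel (S := S) (P := fun y m => m ∈ P 0 ∩ D ∧ ∃ n, par^[n] y = m) ?_ ?_ ?_).mono ?_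
  · refine MeasurableSet.inter (measurable_snd ((hP 0).inter hD)) ?_
    have : {p : X × X | ∃ n, par^[n] p.1 = p.2} = ⋃ n, {p : X × X | par^[n] p.1 = p.2} := by ext; simp
    change MeasurableSet {p : X × X | ∃ n, par^[n] p.1 = p.2}
    rw [this]
    exact MeasurableSet.iUnion fun n => measurableSet_eq_fun ((hparn n).comp measurable_fst) measurable_snd
  · rintro y m ⟨_, n, rfl⟩
    exact hparE' n y
  · rintro y m m' ⟨hm, n, hn⟩ ⟨hm', n', hn'⟩
    have h1 : par^[n' + n] y = m := by rw [Function.iterate_add_apply, hn, hfix m hm.1]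
    have h2 : par^[n + n'] y = m' := by rw [Function.iterate_add_apply, hn', hfix m' hm'.1]
    rw [← h1, ← h2, add_comm]
  · intro x hx
    have hxD := hED hx
    obtain ⟨⟨m, hxm, hm⟩, _⟩ := hx
    have hmD := hDi _ _ hxm hxD
    refine ⟨m, hxm, ?_⟩
    rw [ws_f_top_iff]
    let A : ℕ → Set X := fun n => {y | par^[n] y = m ∧ ∀ j < n, par^[j] y ≠ m}
    have hA : ∀ n, S.h m ≤ ws S.h (A n) := by
      intro n
      induction n with
      | zero => exact le_ws (by simp [A])
      | succ n ih =>
        refine ih.trans ((ws_le_fiber (q := par) ?_).trans (ws_mono ?_))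
        · rintro x ⟨hx1, hx2⟩
          cases n with
          | zero =>
            have : x = m := hx1
            subst this
            exact hpar2 _ hmD 0 hm
          | succ n =>
            have hne : par x ≠ x := by
              intro h
              have : par^[n+1] x = x := Function.iterate_fixed h _
              exact hx2 0 (by omega) (by rw [← hx1, this]; rfl)
            obtain ⟨h1, j, i, _, h2, _⟩ := hpar1 x hne
            exact hpar2 x h1 i h2
        · rintro y ⟨⟨h1, h2⟩, h3⟩
          refine ⟨h1, ?_⟩
          intro j hj
          cases j with
          | zero =>
            rintro rfl
            exact h3 (hpar0 _ hm).symm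
          | succ j => exact h2 j (by omega)
    have hdj : Pairwise (Function.onFun Disjoint A) := by
      have key : ∀ i j, i < j → Disjoint (A i) (A j) := by
        intro i j hij
        rw [Set.disjoint_left]
        rintro y ⟨h1, _⟩ ⟨_, h2⟩
        exact h2 i hij h1
      intro i j hij
      rcases lt_or_gt_of_ne hij with h | h
      · exact key i j h
      · exact (key j i h).symm
    rw [← top_le_iff]
    calc (⊤ : ℝ≥0∞) = ∑' _ : ℕ, S.h m := (ENNReal.tsum_const_eq_top_of_ne_zero (S.h_ne_zero m)).symm
      _ ≤ ∑' n, ws S.h (A n) := ENNReal.tsum_le_tsum hA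
      _ = ws S.h (⋃ n, A n) := (ws_iUnion hdj).symm
      _ ≤ _ := ws_mono (by
        rintro y hy
        obtain ⟨n, hn, _⟩ := mem_iUnion.1 hy
        exact ⟨⟨hm, hmD⟩, n, hn⟩)

end Sys
end CocycleNadkarni

namespace CocycleNadkarni

set_option linter.unusedSectionVars false

lemma place {X : Type*} {w : X → ℝ≥0∞} {c : ℝ≥0∞} (hw0 : ∀ x, w x ≠ 0) (hwt : ∀ x, w x ≠ ⊤)
    (Bn : Finset X) (hB : ∀ b ∈ Bn, 4 * c ≤ w b) (I : Finset X) :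
    ∀ (ld : X → ℝ≥0∞), (∀ x ∈ I, w x ≤ c) → (∀ b ∈ Bn, 2 * ld b ≤ w b) →
    4 * (∑ b ∈ Bn, ld b + ∑ x ∈ I, w x) ≤ ∑ b ∈ Bn, w b →
    ∃ q : X → X, (∀ y ∈ I, q y ∈ Bn) ∧ (∀ y, y ∉ I → q y = y) ∧
      ∀ b ∈ Bn, 2 * (ld b + ws w {y | y ∈ I ∧ q y = b}) ≤ w b := by
  classical
  induction I using Finset.induction_on with
  | empty =>
    intro ld _ h2 _
    exact ⟨id, by simp, by simp, fun b hb => by simpa [ws_empty] using h2 b hb⟩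
  | insert x I hx ih =>
    intro ld hI hld hm
    rw [Finset.sum_insert hx] at hm
    have hldt : ∀ b ∈ Bn, ld b ≠ ⊤ := fun b hb h => by
      have := hld b hb
      rw [h, ENNReal.mul_top (by simp), top_le_iff] at this
      exact hwt b this
    have hex : ∃ b ∈ Bn, 2 * (ld b + w x) ≤ w b := by
      by_contra hno
      push Not at hno
      have h1 : ∀ b ∈ Bn, w b ≤ 4 * ld b := by
        intro b hb
        have h1 := (hno b hb).le
        have h2 : 4 * w x ≤ w b := le_trans (by gcongr; exact hI x (Finset.mem_insert_self _ _)) (hB b hb)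
        have h3 : w b + w b ≤ 4 * ld b + w b := by
          calc w b + w b ≤ 2 * (ld b + w x) + 2 * (ld b + w x) := add_le_add h1 h1
            _ = 4 * ld b + 4 * w x := by ring
            _ ≤ _ := by gcongr
        exact (ENNReal.add_le_add_iff_right (hwt b)).1 h3
      have h2 : ∑ b ∈ Bn, w b ≤ 4 * ∑ b ∈ Bn, ld b := by
        rw [Finset.mul_sum]; exact Finset.sum_le_sum h1
      have h3 := hm.trans h2
      have hst : ∑ b ∈ Bn, ld b ≠ ⊤ := (ENNReal.sum_lt_top.2 fun b hb => (hldt b hb).lt_top).ne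
      rw [mul_add] at h3
      have h4 : 4 * ∑ b ∈ Bn, ld b + 4 * (w x + ∑ x ∈ I, w x) ≤ 4 * ∑ b ∈ Bn, ld b + 0 := by
        simpa using h3
      have h5 := (ENNReal.add_le_add_iff_left (ENNReal.mul_ne_top (by simp) hst)).1 h4
      have h6 : 4 * (w x + ∑ x ∈ I, w x) = 0 := le_antisymm h5 bot_le
      simp [hw0] at h6
    obtain ⟨b, hb, hbx⟩ := hex
    obtain ⟨q, hq1, hq2, hq3⟩ := ih (Function.update ld b (ld b + w x))
      (fun y hy => hI y (Finset.mem_insert_of_mem hy))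
      (by
        intro b' hb'
        by_cases h : b' = b
        · subst h; simpa using hbx
        · rw [Function.update_of_ne h]; exact hld b' hb')
      (by
        refine le_trans (le_of_eq ?_) hm
        rw [Finset.sum_update_of_mem hb, Finset.sdiff_singleton_eq_erase, ← Finset.add_sum_erase _ _ hb]
        ring)
    refine ⟨Function.update q x b, ?_, ?_, ?_⟩
    · intro y hy
      by_cases h : y = x
      · subst h; simpa using hb
      · rw [Function.update_of_ne h]
        exact hq1 y ((Finset.mem_insert.1 hy).resolve_left h)
    · intro y hy
      rw [Finset.mem_insert, not_or] at hy
      rw [Function.update_of_ne hy.1]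
      exact hq2 y hy.2
    · intro b' hb'
      have h3 := hq3 b' hb'
      by_cases h : b' = b
      · subst h
        rw [Function.update_self] at h3
        refine le_trans ?_ h3
        rw [add_assoc]
        gcongr
        refine le_trans (ws_mono (T := {x} ∪ {y | y ∈ I ∧ q y = b'}) ?_) ((ws_union_le _ _).trans (by rw [ws_singleton]))
        rintro y ⟨hy1, hy2⟩
        by_cases h : y = x
        · exact Or.inl h
        · rw [Function.update_of_ne h] at hy2
          exact Or.inr ⟨(Finset.mem_insert.1 hy1).resolve_left h, hy2⟩
      · rw [Function.update_of_ne h] at h3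
        refine le_trans ?_ h3
        gcongr
        apply ws_mono
        rintro y ⟨hy1, hy2⟩
        by_cases h' : y = x
        · subst h'
          rw [Function.update_self] at hy2
          exact (h hy2.symm).elim
        · rw [Function.update_of_ne h'] at hy2
          exact ⟨(Finset.mem_insert.1 hy1).resolve_left h', hy2⟩

namespace Sys
variable {X : Type*} [MeasurableSpace X] {S : Sys X} [StandardBorelSpace X]

def InvH (S : Sys X) (G : ℕ → X → X → Prop) (D : Set X) (P : ℕ → Set X) (k : ℕ) (p : X → X) : Prop :=
  Measurable p ∧ (∀ y, p y ≠ y → y ∈ D ∧ ∃ j i, j < k ∧ j < i ∧ y ∈ P j ∧ p y ∈ P i ∧ G (j+1) y (p y)) ∧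
  (∀ x ∈ D, ∀ j < k, x ∈ P j → p x ≠ x) ∧
  ∀ x, 2 * ws S.h {y | p y = x ∧ y ≠ x} ≤ S.h x

lemma stepH {G : ℕ → X → X → Prop} {D : Set X} {P : ℕ → Set X} {K : ℤ}
    (hG : ∀ k, IsFinSubequiv S.E (G k)) (hGm : ∀ n m, n ≤ m → ∀ x y, G n x y → G m x y)
    (hD : MeasurableSet D) (hDi : ∀ x y, S.E x y → x ∈ D → y ∈ D)
    (hG5 : ∀ x ∈ D, ∀ k, 5 * ws S.h ({z | ∃ j ≤ k, z ∈ P j} ∩ {z | G k x z}) ≤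
        ws S.h ((⋃ j, P j) ∩ {z | G k x z}))
    (hP : ∀ k, MeasurableSet (P k)) (hd : ∀ i j x, x ∈ P i → x ∈ P j → i = j)
    (hl : ∀ k, ∀ x ∈ P k, S.l x = K + k) (k : ℕ) (p : X → X)
    (hp : S.InvH G D P k p) :
    ∃ p', S.InvH G D P (k+1) p' ∧ ∀ y, p y ≠ y → p' y = p y := by
  classical
  obtain ⟨hpm, hp1, hp2, hp3⟩ := hp
  obtain ⟨hGe, hGme, hGE, hGf⟩ := id (hG (k+1))
  have hpE : ∀ y, S.E y (p y) := by
    intro y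
    by_cases h : p y = y
    · rw [h]; exact S.refl y
    · obtain ⟨_, _, _, _, _, _, _, h⟩ := hp1 y h
      exact (hG _).2.2.1 h
  have hgtm : MeasurableSet {x | ∃ i > k + 1, x ∈ P i} := by
    have : {x | ∃ i > k + 1, x ∈ P i} = ⋃ i, ⋃ (_ : i > k + 1), P i := by ext; simp
    rw [this]
    exact MeasurableSet.iUnion fun i => MeasurableSet.iUnion fun _ => hP i
  obtain ⟨q, hqm, hqG, hqΘ⟩ := finSel' (S := S) (hG (k+1)) (fun x q =>
      (q x ≠ x → (x ∈ D ∧ x ∈ P k ∧ q x ∈ {x | ∃ i > k + 1, x ∈ P i})) ∧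
      (x ∈ D ∩ P k → q x ≠ x) ∧
      2 * (ws S.h {y | p y = x ∧ y ≠ x} + ws S.h {y | G (k+1) x y ∧ q y = x ∧ y ≠ x}) ≤ S.h x)
    (by
      intro b q q' hqq h
      have e : {y | G (k+1) b y ∧ q' y = b ∧ y ≠ b} = {y | G (k+1) b y ∧ q y = b ∧ y ≠ b} := by
        ext y
        simp only [mem_ofPred_eq]
        refine and_congr_right fun hy => ?_
        rw [hqq y hy]
      rw [e, ← hqq b (hGe.refl b)]
      exact h)
    (by
      intro q hqm hqG
      have hne : ∀ {r : X → X}, Measurable r → MeasurableSet {x | r x ≠ x} := fun hr =>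
        (measurableSet_eq_fun hr measurable_id).compl
      have m1 : Measurable fun x => ws S.h {y | G (k+1) x y ∧ q y = x ∧ y ≠ x} := by
        refine meas_ws (S := S) (P := fun x y => G (k+1) x y ∧ q y = x ∧ y ≠ x) S.h_meas ?_ fun x y h => hGE h.1
        exact hGme.inter ((measurableSet_eq_fun (hqm.comp measurable_snd) measurable_fst).inter
          (measurableSet_eq_fun measurable_snd measurable_fst).compl)
      have m2 : Measurable fun x => ws S.h {y | p y = x ∧ y ≠ x} := by
        refine meas_ws (S := S) (P := fun x y => p y = x ∧ y ≠ x) S.h_meas ?_ ?_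
        · exact ((measurableSet_eq_fun (hpm.comp measurable_snd) measurable_fst).inter
            (measurableSet_eq_fun measurable_snd measurable_fst).compl)
        · rintro x y ⟨rfl, _⟩
          exact S.eqv.symm (hpE y)
      refine MeasurableSet.inter (MeasurableSet.imp (hne hqm) ?_) (MeasurableSet.inter (MeasurableSet.imp (hD.inter (hP k)) (hne hqm)) ?_)
      · exact hD.inter ((hP k).inter (hqm hgtm))
      · exact measurableSet_le ((m2.add m1).const_mul 2) S.h_meas)
    (by
      intro b
      by_cases hb : b ∈ D
      swap
      · refine ⟨id, fun x => hGe.refl x, fun x hx => ⟨fun h => (h rfl).elim, fun h => ?_, ?_⟩⟩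
        · exact (hb (hDi _ _ (S.eqv.symm (hGE hx)) h.1)).elim
        · have : {y | G (k+1) x y ∧ id y = x ∧ y ≠ x} = ∅ := by
            ext y
            simp only [mem_ofPred_eq, id, mem_empty_iff_false, iff_false]
            rintro ⟨_, h1, h2⟩
            exact h2 h1
          rw [this, ws_empty, add_zero]
          exact hp3 x
      have hfin : {z | G (k+1) b z}.Finite := hGf b
      have hIf : (P k ∩ {z | G (k+1) b z}).Finite := hfin.subset inter_subset_right
      have hBf : ({z | ∃ i > k + 1, z ∈ P i} ∩ {z | G (k+1) b z}).Finite := hfin.subset inter_subset_right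
      obtain ⟨q, hq1, hq2, hq3⟩ := place (w := S.h) (c := (2:ℝ≥0∞) ^ (K + k))
        S.h_ne_zero S.h_ne_top hBf.toFinset
        (by
          intro y hy
          obtain ⟨⟨i, hi, hyi⟩, _⟩ := hBf.mem_toFinset.1 hy
          rw [Sys.h, hl i y hyi]
          have : (4 : ℝ≥0∞) = 2 ^ (2:ℤ) := by norm_num
          rw [this, ← ENNReal.zpow_add (by simp) (by simp)]
          exact ENNReal.zpow_le_of_le (by norm_num) (by omega))
        hIf.toFinset (fun b => ws S.h {y | p y = b ∧ y ≠ b})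
        (by
          intro y hy
          rw [Sys.h, hl k y (hIf.mem_toFinset.1 hy).1])
        (fun b _ => hp3 b)
        (by
          rw [← ws_finset, ← ws_finset, ← ws_finset, hBf.coe_toFinset, hIf.coe_toFinset]
          set C := {z | G (k+1) b z} with hC
          set a := ws S.h ({z | ∃ j ≤ k+1, z ∈ P j} ∩ C) with ha'
          have hat : a ≠ ⊤ := ws_ne_top (fun _ => S.h_ne_top _) (hfin.subset inter_subset_right)
          have hu : ws (fun b => ws S.h {y | p y = b ∧ y ≠ b}) ({z | ∃ i > k + 1, z ∈ P i} ∩ C) + ws S.h (P k ∩ C) ≤ a := by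
            rw [ws, ← ws_fiber S.h p, ← ws_union]
            · apply ws_mono
              rintro y (⟨⟨_, h2⟩, h3⟩ | ⟨h1, h2⟩)
              · obtain ⟨_, j, i, h4, _, h5, _, h6⟩ := hp1 y h3.symm
                exact ⟨⟨j, by omega, h5⟩, hGe.trans h2 (hGe.symm (hGm _ _ (by omega) _ _ h6))⟩
              · exact ⟨⟨k, by omega, h1⟩, h2⟩
            · rw [Set.disjoint_left]
              rintro y ⟨_, h3⟩ ⟨h1, _⟩
              obtain ⟨_, j, i, h4, _, h5, _, h6⟩ := hp1 y h3.symm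
              have := hd _ _ _ h1 h5
              omega
          have h5 : a + 4 * a ≤ a + ws S.h ({z | ∃ i > k + 1, z ∈ P i} ∩ C) := by
            refine le_trans (le_of_eq (by ring)) ((hG5 b hb (k+1)).trans ?_)
            refine le_trans (ws_mono ?_) (ws_union_le _ _)
            rintro z ⟨hz, hzC⟩
            obtain ⟨i, hi⟩ := mem_iUnion.1 hz
            by_cases hik : i ≤ k + 1
            · exact Or.inl ⟨⟨i, hik, hi⟩, hzC⟩
            · exact Or.inr ⟨⟨i, not_le.1 hik, hi⟩, hzC⟩
          have := (ENNReal.add_le_add_iff_left hat).1 h5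
          exact le_trans (by gcongr) this)
      have hqI : ∀ y, q y ≠ y → (y ∈ P k ∩ {z | G (k+1) b z}) ∧ q y ∈ {z | ∃ i > k + 1, z ∈ P i} ∩ {z | G (k+1) b z} := by
        intro y hy
        have : y ∈ hIf.toFinset := by
          by_contra h
          exact hy (hq2 y h)
        exact ⟨hIf.mem_toFinset.1 this, hBf.mem_toFinset.1 (hq1 y this)⟩
      refine ⟨q, ?_, ?_⟩
      · intro x
        by_cases hx : q x = x
        · rw [hx]; exact hGe.refl x
        · exact hGe.trans (hGe.symm (hqI x hx).1.2) (hqI x hx).2.2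
      · intro x hx
        refine ⟨fun hqx => ?_, ?_, ?_⟩
        · obtain ⟨h1, h2⟩ := hqI x hqx
          exact ⟨hDi _ _ (hGE h1.2) hb, h1.1, h2.1⟩
        · rintro ⟨_, hxk⟩ h
          obtain ⟨⟨i, hi, hxi⟩, _⟩ := hBf.mem_toFinset.1 (hq1 x (hIf.mem_toFinset.2 ⟨hxk, hx⟩))
          rw [h] at hxi
          have := hd _ _ _ hxk hxi
          omega
        · by_cases hxB : x ∈ hBf.toFinset
          · refine le_trans ?_ (hq3 x hxB)
            gcongr
            apply ws_mono
            rintro y ⟨_, h1, h2⟩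
            exact ⟨hIf.mem_toFinset.2 (hqI y (by rw [h1]; exact h2.symm)).1, h1⟩
          · have : {y | G (k+1) x y ∧ q y = x ∧ y ≠ x} = ∅ := by
              ext y
              simp only [mem_ofPred_eq, mem_empty_iff_false, iff_false]
              rintro ⟨_, h1, h2⟩
              have := (hqI y (by rw [h1]; exact h2.symm)).2
              rw [h1] at this
              exact hxB (hBf.mem_toFinset.2 this)
            rw [this, ws_empty, add_zero]
            exact hp3 x)
  refine ⟨fun y => if p y ≠ y then p y else q y, ⟨?_, ?_, ?_, ?_⟩, ?_⟩
  · exact Measurable.ite (measurableSet_eq_fun hpm measurable_id).compl hpm hqm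
  · intro y hy
    beta_reduce at hy ⊢
    by_cases h : p y ≠ y
    · rw [if_pos h] at hy ⊢
      obtain ⟨h1, j, i, h2, h3⟩ := hp1 y h
      exact ⟨h1, j, i, by omega, h3⟩
    · rw [if_neg h] at hy ⊢
      obtain ⟨h1, h2, ⟨i, hi, hyi⟩⟩ := (hqΘ y).1 hy
      exact ⟨h1, k, i, by omega, by omega, h2, hyi, hqG y⟩
  · intro x hxD j hj hxj
    beta_reduce
    by_cases h : p x ≠ x
    · rw [if_pos h]; exact h
    · rw [if_neg h]
      by_cases hjk : j = k
      · subst hjk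
        exact (hqΘ x).2.1 ⟨hxD, hxj⟩
      · exact (h (hp2 x hxD j (by omega) hxj)).elim
  · intro x
    refine le_trans ?_ (hqΘ x).2.2
    gcongr
    refine le_trans (ws_mono ?_) (ws_union_le _ _)
    rintro y ⟨h1, h2⟩
    beta_reduce at h1
    by_cases h : p y ≠ y
    · rw [if_pos h] at h1
      exact Or.inl ⟨h1, h2⟩
    · rw [if_neg h] at h1
      refine Or.inr ⟨?_, h1, h2⟩
      have := hqG y
      rw [h1] at this
      exact hGe.symm this
  · intro y hy
    beta_reduce
    rw [if_pos hy]

theorem comp_H {F : ℕ → X → X → Prop} (hF : ∀ n, IsFinSubequiv S.E (F n))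
    (hmono : ∀ n m, n ≤ m → ∀ x y, F n x y → F m x y) {P : ℕ → Set X} {K : ℤ}
    (hP : ∀ k, MeasurableSet (P k)) (hd : ∀ i j x, x ∈ P i → x ∈ P j → i = j)
    (hl : ∀ k, ∀ x ∈ P k, S.l x = K + k) : S.Comp (S.Esc F P) := by
  classical
  obtain ⟨G, D, hG, hGm, hD, hDi, hED, hG5⟩ := esc_G hF hmono hP
  obtain ⟨p, hp0, hpI, hpS⟩ := dep_choice (Inv := S.InvH G D P) (Step := fun _ p p' => ∀ y, p y ≠ y → p' y = p y)
    (a := id) ⟨measurable_id, fun y h => (h rfl).elim, fun x _ j hj => by omega, fun x => by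
      have : {y | id y = x ∧ y ≠ x} = ∅ := by
        ext y
        simp only [mem_ofPred_eq, id, mem_empty_iff_false, iff_false]
        rintro ⟨h1, h2⟩
        exact h2 h1
      rw [this, ws_empty]; simp⟩
    fun k p hp => stepH hG hGm hD hDi hG5 hP hd hl k p hp
  have hst : ∀ k n y, p k y ≠ y → p (k + n) y = p k y := by
    intro k n y hy
    induction n with
    | zero => rfl
    | succ n ih => rw [← add_assoc, hpS (k+n) y (by rw [ih]; exact hy), ih]
  have hex : ∀ y, ∃ k, p k y ≠ y ∨ ∀ k, p k y = y := by
    intro y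
    by_cases h : ∀ k, p k y = y
    · exact ⟨0, Or.inr h⟩
    · push Not at h
      obtain ⟨k, hk⟩ := h
      exact ⟨k, Or.inl hk⟩
  have hpm : ∀ k, Measurable (p k) := fun k => (hpI k).1
  let idx : X → ℕ := fun y => Nat.find (hex y)
  have hidx : Measurable idx := by
    refine measurable_find _ fun k => ?_
    refine (measurableSet_eq_fun (hpm k) measurable_id).compl.union ?_
    have : {y | ∀ k, p k y = y} = ⋂ k, {y | p k y = y} := by ext; simp
    change MeasurableSet {y | ∀ k, p k y = y}
    rw [this]
    exact MeasurableSet.iInter fun k => measurableSet_eq_fun (hpm k) measurable_id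
  let par : X → X := fun y => p (idx y) y
  have hparm : Measurable par := by
    have h := measurable_from_prod_countable_right (f := fun q : ℕ × X => p q.1 q.2) fun n => hpm n
    exact h.comp (hidx.prodMk measurable_id)
  have hpar : ∀ k y, p k y ≠ y → par y = p k y := by
    intro k y hy
    have h1 : p (idx y) y ≠ y := (Nat.find_spec (hex y)).resolve_right fun h => hy (h k)
    have h2 : idx y ≤ k := Nat.find_min' (hex y) (Or.inl hy)
    obtain ⟨n, rfl⟩ := Nat.exists_eq_add_of_le h2
    exact (hst _ n y h1).symm
  have hpar1 : ∀ y, par y ≠ y → y ∈ D ∧ ∃ j i, j < i ∧ y ∈ P j ∧ par y ∈ P i ∧ S.E y (par y) := by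
    intro y hy
    obtain ⟨h1, j, i, h2, h3, h4, h5, h6⟩ := (hpI (idx y)).2.1 y hy
    exact ⟨h1, j, i, h3, h4, h5, (hG _).2.2.1 h6⟩
  have hparE : ∀ y, S.E y (par y) := by
    intro y
    by_cases h : par y = y
    · rw [h]; exact S.refl y
    · obtain ⟨_, _, _, _, _, _, h⟩ := hpar1 y h
      exact h
  have hparI : ∀ x ∈ D, ∀ j, x ∈ P j → par x ≠ x := by
    intro x hx j hj
    have := (hpI (j+1)).2.2.1 x hx j (by omega) hj
    rw [hpar _ _ this]
    exact this
  have hpar2 : ∀ x, 2 * ws S.h {y | par y = x ∧ y ≠ x} ≤ S.h x := by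
    intro x
    by_cases hx : ∃ i, x ∈ P i
    · obtain ⟨i, hi⟩ := hx
      refine le_trans ?_ ((hpI i).2.2.2 x)
      gcongr
      apply ws_mono
      rintro y ⟨rfl, h2⟩
      obtain ⟨h3, j, i', h4, h5, h6, _⟩ := hpar1 y h2.symm
      have := hd _ _ _ hi h6
      subst this
      have := (hpI i).2.2.1 y h3 j h4 h5
      exact ⟨(hpar _ _ this).symm, h2⟩
    · have : {y | par y = x ∧ y ≠ x} = ∅ := by
        ext y
        simp only [mem_ofPred_eq, mem_empty_iff_false, iff_false]
        rintro ⟨rfl, h2⟩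
        obtain ⟨_, j, i, _, _, h6, _⟩ := hpar1 y h2.symm
        exact hx ⟨i, h6⟩
      rw [this, ws_empty]; simp
  have hparf : ∀ x, {y | par y = x ∧ y ≠ x}.Finite := by
    intro x
    have h1 : ws S.h {y | par y = x ∧ y ≠ x} ≠ ⊤ := by
      intro h
      have := hpar2 x
      rw [h, ENNReal.mul_top (by simp), top_le_iff] at this
      exact S.h_ne_top x this
    refine finite_of_ws (w := S.h) (c := (2:ℝ≥0∞)^K) ?_ h1 ?_
    · exact (ENNReal.zpow_pos (by simp) (by simp) _).ne'
    · rintro y ⟨rfl, h2⟩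
      obtain ⟨_, j, i, _, h3, _⟩ := hpar1 y h2.symm
      rw [Sys.h, hl j y h3]
      exact ENNReal.zpow_le_of_le (by norm_num) (by omega)
  -- fibres of `par`
  have hfib : ∀ x, {y | par y = x} = {y | par y = x ∧ y ≠ x} ∨ {y | par y = x} = {x} := by
    intro x
    by_cases h : par x = x
    · right
      ext y
      simp only [mem_ofPred_eq, mem_singleton_iff]
      refine ⟨fun h' => ?_, fun h' => h' ▸ h⟩
      by_contra hne
      subst h'
      obtain ⟨h1, j, i, _, _, h3, h4⟩ := hpar1 y (Ne.symm hne)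
      exact hparI _ (hDi _ _ h4 h1) i h3 h
    · left
      ext y
      simp only [mem_ofPred_eq]
      exact ⟨fun h' => ⟨h', fun h2 => h (h2 ▸ h')⟩, fun h' => h'.1⟩
  have hsing : ∀ x, {y : X | y = x} = {x} := fun x => rfl
  refine ⟨fun x y => x = y, par, finSub_eq, hparm, fun x y h => by rw [h], hparE, ?_, ?_, ?_⟩
  · intro x
    rcases hfib x with h | h
    · rw [h]; exact hparf x
    · rw [h]; exact finite_singleton x
  · intro x
    rw [hsing, ws_singleton]
    rcases hfib x with h | h
    · rw [h]
      exact (S.ws_f_le _).trans ((hpar2 x).trans (S.h_le x))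
    · rw [h, ws_singleton]
  · intro x hx
    have hxD := hED hx
    obtain ⟨⟨m, hxm, hm⟩, _⟩ := hx
    refine ⟨m, hxm, ?_⟩
    have : {y | par y = m} = ∅ := by
      ext y
      simp only [mem_ofPred_eq, mem_empty_iff_false, iff_false]
      rintro rfl
      by_cases h : par y = y
      · rw [h] at hm hxm
        exact hparI y (hDi _ _ hxm hxD) 0 hm h
      · obtain ⟨_, j, i, h1, _, h2, _⟩ := hpar1 y h
        have := hd _ _ _ hm h2
        omega
    rw [this, ws_empty, hsing, ws_singleton]
    exact pos_iff_ne_zero.2 (S.hf0 m)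

end Sys
end CocycleNadkarni

namespace CocycleNadkarni

set_option linter.unusedSectionVars false

/-- finitely additive probabilities on all subsets -/
def FinAdd {X : Type*} (m : Set X → ℝ≥0∞) : Prop :=
  m univ = 1 ∧ ∀ A B, Disjoint A B → m (A ∪ B) = m A + m B

def SigAdd {X : Type*} (m : Set X → ℝ≥0∞) (s : ℕ → Set X) : Prop :=
  m (⋃ k, s k) = ∑' k, m (s k)

/-- disjoint measurable sequences -/
def DSeq {X : Type*} [MeasurableSpace X] (s : ℕ → Set X) : Prop :=
  (∀ k, MeasurableSet (s k)) ∧ ∀ i j x, x ∈ s i → x ∈ s j → i = j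

namespace FinAdd
variable {X : Type*} {m : Set X → ℝ≥0∞} (hm : FinAdd m)

lemma mono (hm : FinAdd m) {A B : Set X} (h : A ⊆ B) : m A ≤ m B := by
  have := hm.2 A (B \ A) disjoint_sdiff_right
  rw [union_sdiff_cancel h] at this
  rw [this]; exact le_self_add

lemma le_one (hm : FinAdd m) (A : Set X) : m A ≤ 1 := by
  rw [← hm.1]; exact hm.mono (subset_univ A)

lemma ne_top (hm : FinAdd m) (A : Set X) : m A ≠ ⊤ := ne_top_of_le_ne_top (by simp) (hm.le_one A)

lemma empty (hm : FinAdd m) : m ∅ = 0 := by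
  have := hm.2 ∅ ∅ (disjoint_empty _)
  rw [union_self] at this
  have h2 : m ∅ + 0 = m ∅ + m ∅ := by simpa using this
  exact ((ENNReal.add_right_inj (hm.ne_top _)).1 h2).symm

lemma compl (hm : FinAdd m) (A : Set X) : m Aᶜ = 1 - m A := by
  have := hm.2 A Aᶜ disjoint_compl_right
  rw [union_compl_self, hm.1] at this
  rw [this, ENNReal.add_sub_cancel_left (hm.ne_top A)]

lemma union_le (hm : FinAdd m) (A B : Set X) : m (A ∪ B) ≤ m A + m B := by
  rw [← union_sdiff_self, hm.2 _ _ disjoint_sdiff_right]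
  gcongr
  exact hm.mono sdiff_subset

lemma fin_sum (hm : FinAdd m) {s : ℕ → Set X} (hs : ∀ i j x, x ∈ s i → x ∈ s j → i = j) (n : ℕ) :
    m {z | ∃ j < n, z ∈ s j} = ∑ j ∈ Finset.range n, m (s j) := by
  induction n with
  | zero =>
    have : {z | ∃ j < 0, z ∈ s j} = ∅ := by ext; simp
    rw [this, hm.empty]; simp
  | succ n ih =>
    have : {z | ∃ j < n + 1, z ∈ s j} = {z | ∃ j < n, z ∈ s j} ∪ s n := by
      ext z
      simp only [mem_ofPred_eq, mem_union]
      constructor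
      · rintro ⟨j, hj, hz⟩
        rcases Nat.lt_succ_iff_lt_or_eq.1 hj with h | rfl
        · exact Or.inl ⟨j, h, hz⟩
        · exact Or.inr hz
      · rintro (⟨j, hj, hz⟩ | hz)
        · exact ⟨j, by omega, hz⟩
        · exact ⟨n, by omega, hz⟩
    rw [this, hm.2, ih, Finset.sum_range_succ]
    rw [Set.disjoint_left]
    rintro z ⟨j, hj, hz⟩ hz'
    have := hs _ _ _ hz hz'
    omega

lemma tsum_le (hm : FinAdd m) {s : ℕ → Set X} (hs : ∀ i j x, x ∈ s i → x ∈ s j → i = j) :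
    ∑' k, m (s k) ≤ m (⋃ k, s k) := by
  rw [ENNReal.tsum_eq_iSup_nat]
  refine iSup_le fun n => ?_
  rw [← hm.fin_sum hs]
  apply hm.mono
  rintro z ⟨j, _, hz⟩
  exact mem_iUnion.2 ⟨j, hz⟩

end FinAdd

/-- increments -/
def dif {X : Type*} (U : ℕ → Set X) : ℕ → Set X
  | 0 => U 0
  | (n+1) => U (n+1) \ U n

lemma dif_part {X : Type*} {U : ℕ → Set X} (hU : Monotone U) (n : ℕ) :
    {z | ∃ j < n + 1, z ∈ dif U j} = U n := by
  induction n with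
  | zero => ext z; simp [dif]
  | succ n ih =>
    ext z
    constructor
    · rintro ⟨j, hj, hz⟩
      rcases Nat.lt_succ_iff_lt_or_eq.1 hj with h | rfl
      · apply hU (Nat.le_succ n)
        rw [← ih]; exact ⟨j, h, hz⟩
      · exact hz.1
    · intro hz
      by_cases h : z ∈ U n
      · rw [← ih] at h
        obtain ⟨j, hj, hz⟩ := h
        exact ⟨j, by omega, hz⟩
      · exact ⟨n+1, by omega, hz, h⟩

lemma dif_iUnion {X : Type*} {U : ℕ → Set X} (hU : Monotone U) : ⋃ n, dif U n = ⋃ n, U n := by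
  ext z
  simp only [mem_iUnion]
  constructor
  · rintro ⟨n, hn⟩
    refine ⟨n, ?_⟩
    rw [← dif_part hU]; exact ⟨n, by omega, hn⟩
  · rintro ⟨n, hn⟩
    rw [← dif_part hU] at hn
    obtain ⟨j, _, hz⟩ := hn
    exact ⟨j, hz⟩

lemma dif_disj {X : Type*} {U : ℕ → Set X} (hU : Monotone U) :
    ∀ i j x, x ∈ dif U i → x ∈ dif U j → i = j := by
  have key : ∀ i j x, i < j → x ∈ dif U i → x ∈ dif U j → False := by
    intro i j x hij hi hj
    cases j with
    | zero => omega
    | succ j =>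
      apply hj.2
      rw [← dif_part hU]
      exact ⟨i, hij, hi⟩
  intro i j x hi hj
  rcases lt_trichotomy i j with h | h | h
  · exact (key _ _ _ h hi hj).elim
  · exact h
  · exact (key _ _ _ h hj hi).elim

lemma dif_dseq {X : Type*} [MeasurableSpace X] {U : ℕ → Set X} (hU : Monotone U)
    (hm : ∀ n, MeasurableSet (U n)) : DSeq (dif U) := by
  refine ⟨fun k => ?_, dif_disj hU⟩
  cases k with
  | zero => exact hm 0
  | succ k => exact (hm _).diff (hm _)

open Filter Topology in
lemma FinAdd.tendsto_mono {X : Type*} {m : Set X → ℝ≥0∞} (hm : FinAdd m) {U : ℕ → Set X}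
    (hU : Monotone U) (hs : SigAdd m (dif U)) : Tendsto (fun n => m (U n)) atTop (𝓝 (m (⋃ n, U n))) := by
  rw [← dif_iUnion hU, hs]
  have := (ENNReal.summable (f := fun k => m (dif U k))).hasSum.tendsto_sum_nat
  have h2 := this.comp (tendsto_add_atTop_nat 1)
  refine h2.congr fun n => ?_
  simp only [Function.comp]
  rw [← hm.fin_sum (dif_disj hU), dif_part hU]

open Filter Topology in
lemma FinAdd.tendsto_anti {X : Type*} {m : Set X → ℝ≥0∞} (hm : FinAdd m) {V : ℕ → Set X}
    (hV : Antitone V) (hs : SigAdd m (dif fun n => (V n)ᶜ)) :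
    Tendsto (fun n => m (V n)) atTop (𝓝 (m (⋂ n, V n))) := by
  have := hm.tendsto_mono (U := fun n => (V n)ᶜ) (fun i j h => compl_subset_compl.2 (hV h)) hs
  have h2 := ENNReal.Tendsto.sub (tendsto_const_nhds (x := (1:ℝ≥0∞))) this (Or.inl (by simp))
  have e : (⋂ n, V n) = (⋃ n, (V n)ᶜ)ᶜ := by simp
  rw [e, hm.compl]
  refine h2.congr fun n => ?_
  rw [← hm.compl, compl_compl]

lemma Q_lemma {A : Set ℝ} (hA : MeasurableSet A) : ∃ 𝒮 : Set (ℕ → Set ℝ), 𝒮.Countable ∧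
    (∀ s ∈ 𝒮, DSeq s) ∧ ∀ (m : Set ℝ → ℝ≥0∞) (μ : Measure ℝ), FinAdd m → IsProbabilityMeasure μ →
      (∀ q : ℚ, m (Iic (q : ℝ)) = μ (Iic (q : ℝ))) → (∀ s ∈ 𝒮, SigAdd m s) → m A = μ A := by
  refine MeasurableSpace.induction_on_inter
    (C := fun A _ => ∃ 𝒮 : Set (ℕ → Set ℝ), 𝒮.Countable ∧
    (∀ s ∈ 𝒮, DSeq s) ∧ ∀ (m : Set ℝ → ℝ≥0∞) (μ : Measure ℝ), FinAdd m → IsProbabilityMeasure μ →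
      (∀ q : ℚ, m (Iic (q : ℝ)) = μ (Iic (q : ℝ))) → (∀ s ∈ 𝒮, SigAdd m s) → m A = μ A)
    ((BorelSpace.measurable_eq (α := ℝ)).trans Real.borel_eq_generateFrom_Iic_rat) Real.isPiSystem_Iic_rat ?_ ?_ ?_ ?_ A hA
  · refine ⟨∅, by simp, by simp, fun m μ hm hμ h1 h2 => ?_⟩
    rw [hm.empty, measure_empty]
  · intro t ht
    simp only [mem_iUnion, mem_singleton_iff] at ht
    obtain ⟨q, rfl⟩ := ht
    exact ⟨∅, by simp, by simp, fun m μ hm hμ h1 h2 => h1 q⟩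
  · rintro t ht ⟨𝒮, h1, h2, h3⟩
    refine ⟨𝒮, h1, h2, fun m μ hm hμ h4 h5 => ?_⟩
    rw [hm.compl, h3 m μ hm hμ h4 h5, prob_compl_eq_one_sub ht]
  · intro f hd hf hC
    choose 𝒮 h1 h2 h3 using hC
    refine ⟨{f} ∪ ⋃ n, 𝒮 n, (countable_singleton f).union (countable_iUnion h1), ?_, ?_⟩
    · rintro s (rfl | hs)
      · refine ⟨hf, fun i j x hi hj => ?_⟩
        by_contra h
        exact Set.disjoint_left.1 (hd h) hi hj
      · obtain ⟨n, hn⟩ := mem_iUnion.1 hs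
        exact h2 n s hn
    · intro m μ hm hμ h4 h5
      rw [h5 f (Or.inl rfl), measure_iUnion hd hf]
      congr 1
      funext n
      exact h3 n m μ hm hμ h4 fun s hs => h5 s (Or.inr (mem_iUnion.2 ⟨n, hs⟩))

def baseA : ℕ → Set ℝ := fun n => Iic (n : ℝ)
def baseB : ℕ → Set ℝ := fun n => Iic (-(n : ℝ))
def baseC (q : ℚ) : ℕ → Set ℝ := fun n => Iic ((q + 1 / (n + 1) : ℚ) : ℝ)

lemma baseA_mono : Monotone baseA := fun i j h => Iic_subset_Iic.2 (by exact_mod_cast h)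
lemma baseB_anti : Antitone baseB := fun i j h => Iic_subset_Iic.2 (by
  have : (i:ℝ) ≤ j := by exact_mod_cast h
  linarith)
lemma baseC_anti (q : ℚ) : Antitone (baseC q) := fun i j h => Iic_subset_Iic.2 (by
  have h' : (i:ℚ) ≤ j := by exact_mod_cast h
  have : (1:ℚ) / (j + 1) ≤ 1 / (i + 1) := by gcongr
  exact_mod_cast (by linarith : q + 1 / ((j:ℚ) + 1) ≤ q + 1 / (i + 1)))

def baseS : Set (ℕ → Set ℝ) := {dif baseA} ∪ {dif fun n => (baseB n)ᶜ} ∪ range fun q : ℚ => dif fun n => (baseC q n)ᶜ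

lemma baseS_c : baseS.Countable := by
  refine ((countable_singleton _).union (countable_singleton _)).union (countable_range _)

lemma baseS_d : ∀ s ∈ baseS, DSeq s := by
  rintro s ((rfl | rfl) | ⟨q, rfl⟩)
  · exact dif_dseq baseA_mono fun n => measurableSet_Iic
  · exact dif_dseq (fun i j h => compl_subset_compl.2 (baseB_anti h)) fun n => measurableSet_Iic.compl
  · exact dif_dseq (fun i j h => compl_subset_compl.2 (baseC_anti q h)) fun n => measurableSet_Iic.compl

open Filter Topology ProbabilityTheory in
lemma exists_real {m : Set ℝ → ℝ≥0∞} (hm : FinAdd m) (hs : ∀ s ∈ baseS, SigAdd m s) :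
    ∃ μ : Measure ℝ, IsProbabilityMeasure μ ∧ ∀ q : ℚ, m (Iic (q : ℝ)) = μ (Iic (q : ℝ)) := by
  let f : Unit → ℚ → ℝ := fun _ q => (m (Iic (q : ℝ))).toReal
  have hmono : Monotone (f ()) := by
    intro a b hab
    exact ENNReal.toReal_mono (hm.ne_top _) (hm.mono (Iic_subset_Iic.2 (by exact_mod_cast hab)))
  have hbd : BddAbove (range (f ())) := ⟨1, by
    rintro _ ⟨q, rfl⟩
    exact ENNReal.toReal_le_of_le_ofReal (by norm_num) (by simpa using hm.le_one _)⟩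
  have hbb : BddBelow (range (f ())) := ⟨0, by
    rintro _ ⟨q, rfl⟩
    exact ENNReal.toReal_nonneg⟩
  have h1 : IsRatStieltjesPoint f () := by
    refine ⟨hmono, ?_, ?_, ?_⟩
    · have t1 := tendsto_atTop_ciSup hmono hbd
      have t2 := t1.comp (tendsto_natCast_atTop_atTop (R := ℚ))
      have t3 := hm.tendsto_mono baseA_mono (hs _ (Or.inl (Or.inl rfl)))
      have e : ⋃ n, baseA n = univ := by
        ext z
        simp only [baseA, mem_iUnion, mem_Iic, mem_univ, iff_true]
        exact exists_nat_ge z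
      rw [e, hm.1] at t3
      have t4 := (ENNReal.tendsto_toReal (by simp)).comp t3
      have t5 : Tendsto (f () ∘ Nat.cast) atTop (𝓝 (1:ℝ)) := by
        refine (t4.congr fun n => ?_).trans (by simp)
        simp [f, baseA]
      rwa [tendsto_nhds_unique t2 t5] at t1
    · have t1 := tendsto_atBot_ciInf hmono hbb
      have t2 := t1.comp (tendsto_neg_atTop_atBot.comp (tendsto_natCast_atTop_atTop (R := ℚ)))
      have t3 := hm.tendsto_anti baseB_anti (hs _ (Or.inl (Or.inr rfl)))
      have e : ⋂ n, baseB n = ∅ := by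
        ext z
        simp only [baseB, mem_iInter, mem_Iic, mem_empty_iff_false, iff_false, not_forall]
        obtain ⟨n, hn⟩ := exists_nat_gt (-z)
        exact ⟨n, by linarith⟩
      rw [e, hm.empty] at t3
      have t4 := (ENNReal.tendsto_toReal (by simp)).comp t3
      have t5 : Tendsto (f () ∘ (Neg.neg ∘ Nat.cast)) atTop (𝓝 (0:ℝ)) := by
        refine (t4.congr fun n => ?_).trans (by simp)
        simp [f, baseB]
      rwa [tendsto_nhds_unique t2 t5] at t1
    · intro t
      have : Nonempty (Ioi t) := ⟨⟨t + 1, by simp⟩⟩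
      apply le_antisymm
      · have t3 := hm.tendsto_anti (baseC_anti t) (hs _ (Or.inr ⟨t, rfl⟩))
        have e : ⋂ n, baseC t n = Iic (t : ℝ) := by
          ext z
          simp only [baseC, mem_iInter, mem_Iic]
          constructor
          · intro h
            by_contra hz
            obtain ⟨n, hn⟩ := exists_nat_one_div_lt (sub_pos.2 (not_le.1 hz))
            have := h n
            push_cast at this
            linarith
          · intro h n
            refine h.trans ?_
            have : (0:ℚ) < 1 / ((n:ℚ) + 1) := by positivity
            exact_mod_cast (by linarith : t ≤ t + 1 / ((n:ℚ) + 1))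
        rw [e] at t3
        have t4 := (ENNReal.tendsto_toReal (hm.ne_top _)).comp t3
        refine ge_of_tendsto' t4 fun n => ?_
        have : t < t + 1 / ((n:ℚ) + 1) := by
          have : (0:ℚ) < 1 / ((n:ℚ) + 1) := by positivity
          linarith
        refine (ciInf_le ?_ (⟨_, this⟩ : Ioi t)).trans (le_of_eq rfl)
        exact ⟨0, by rintro _ ⟨q, rfl⟩; exact ENNReal.toReal_nonneg⟩
      · exact le_ciInf fun r => hmono (le_of_lt r.2)
  have hf : IsMeasurableRatCDF f := ⟨fun _ => h1, measurable_const⟩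
  refine ⟨(hf.stieltjesFunction ()).measure, inferInstance, fun q => ?_⟩
  rw [hf.measure_stieltjesFunction_Iic, hf.stieltjesFunction_eq]
  simp only [f]
  rw [ENNReal.ofReal_toReal (hm.ne_top _)]

theorem exists_measure {X : Type*} [MeasurableSpace X] [StandardBorelSpace X] {ℬ : Set (Set X)}
    (hc : ℬ.Countable) (hB : ∀ B ∈ ℬ, MeasurableSet B) :
    ∃ 𝒮 : Set (ℕ → Set X), 𝒮.Countable ∧ (∀ s ∈ 𝒮, DSeq s) ∧
      ∀ m : Set X → ℝ≥0∞, FinAdd m → (∀ s ∈ 𝒮, SigAdd m s) →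
        ∃ μ : Measure X, IsProbabilityMeasure μ ∧ ∀ B ∈ ℬ, μ B = m B := by
  obtain ⟨e, he⟩ := MeasureTheory.exists_measurableEmbedding_real X
  have hQ : ∀ B : Set X, ∃ 𝒮 : Set (ℕ → Set ℝ), MeasurableSet B → 𝒮.Countable ∧
    (∀ s ∈ 𝒮, DSeq s) ∧ ∀ (m : Set ℝ → ℝ≥0∞) (μ : Measure ℝ), FinAdd m → IsProbabilityMeasure μ →
      (∀ q : ℚ, m (Iic (q : ℝ)) = μ (Iic (q : ℝ))) → (∀ s ∈ 𝒮, SigAdd m s) → m (e '' B) = μ (e '' B) := by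
    intro B
    by_cases h : MeasurableSet B
    · obtain ⟨𝒮, h⟩ := Q_lemma (he.measurableSet_image.2 h)
      exact ⟨𝒮, fun _ => h⟩
    · exact ⟨∅, fun h' => (h h').elim⟩
  choose 𝒯 h𝒯 using hQ
  let 𝒮0 : Set (ℕ → Set ℝ) := baseS ∪ ⋃ B ∈ insert univ ℬ, 𝒯 B
  have hB' : ∀ B ∈ insert univ ℬ, MeasurableSet B := by
    rintro B (rfl | h)
    · exact MeasurableSet.univ
    · exact hB B h
  have hpre : ∀ s : ℕ → Set ℝ, DSeq s → DSeq (fun k => e ⁻¹' s k) := fun s h =>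
    ⟨fun k => he.measurable (h.1 k), fun i j x hi hj => h.2 i j (e x) hi hj⟩
  refine ⟨(fun s k => e ⁻¹' s k) '' 𝒮0, Countable.image ?_ _, ?_, ?_⟩
  · exact baseS_c.union ((hc.insert univ).biUnion fun B hB => (h𝒯 B (hB' B hB)).1)
  · rintro _ ⟨s, hs, rfl⟩
    apply hpre
    rcases hs with hs | hs
    · exact baseS_d s hs
    · simp only [mem_iUnion] at hs
      obtain ⟨B, hB, hs⟩ := hs
      exact (h𝒯 B (hB' B hB)).2.1 s hs
  · intro m hm hms
    let m' : Set ℝ → ℝ≥0∞ := fun A => m (e ⁻¹' A)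
    have hm' : FinAdd m' := ⟨hm.1, fun A B h => hm.2 _ _ (h.preimage e)⟩
    have hms' : ∀ s ∈ 𝒮0, SigAdd m' s := by
      intro s hs
      have := hms _ ⟨s, hs, rfl⟩
      unfold SigAdd at this ⊢
      rw [← this]
      simp [m', preimage_iUnion]
    obtain ⟨μ, hμ, hμq⟩ := exists_real hm' fun s hs => hms' s (Or.inl hs)
    have key : ∀ B ∈ insert univ ℬ, μ (e '' B) = m B := by
      intro B hB
      rw [← (h𝒯 B (hB' B hB)).2.2 m' μ hm' hμ hμq fun s hs => hms' s (Or.inr (mem_biUnion hB hs))]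
      simp only [m', he.injective.preimage_image]
    refine ⟨μ.comap e, ⟨?_⟩, ?_⟩
    · rw [he.comap_apply, key univ (mem_insert _ _), hm.1]
    · intro B hB
      rw [he.comap_apply, key B (mem_insert_of_mem _ hB)]

end CocycleNadkarni

namespace CocycleNadkarni

set_option linter.unusedSectionVars false

namespace Sys
variable {X : Type*} [MeasurableSpace X] {S : Sys X} [StandardBorelSpace X]

def Mix (S : Sys X) (F : ℕ → X → X → Prop) (x : X) (A : Set X) : Prop :=
  ∀ s t : ℝ≥0∞, s < t → ∃ n0,
    (∀ n ≥ n0, ∀ y, S.E x y → s * ws S.h {z | F n y z} ≤ ws S.h (A ∩ {z | F n y z})) ∨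
    (∀ n ≥ n0, ∀ y, S.E x y → ws S.h (A ∩ {z | F n y z}) ≤ t * ws S.h {z | F n y z})

lemma cls_pos {F : X → X → Prop} (hF : IsFinSubequiv S.E F) (x : X) : ws S.h {z | F x z} ≠ 0 :=
  ws_pos S.h_ne_zero ⟨x, hF.1.refl x⟩

lemma cls_fin {F : X → X → Prop} (hF : IsFinSubequiv S.E F) (x : X) : ws S.h {z | F x z} ≠ ⊤ := by
  obtain ⟨hFe, hFm, hFE, hFf⟩ := hF
  refine ws_ne_top S.h_ne_top ?_
  exact hFf x

/-- the limit density functional -/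
lemma exists_lim {F : ℕ → X → X → Prop} (hF : ∀ n, IsFinSubequiv S.E (F n)) (x : X) :
    ∃ m : Set X → ℝ≥0∞, FinAdd m ∧
      (∀ A c, c < m A → ∀ n0, ∃ n ≥ n0, c * ws S.h {z | F n x z} < ws S.h (A ∩ {z | F n x z})) ∧
      (∀ A c, m A < c → ∀ n0, ∃ n ≥ n0, ws S.h (A ∩ {z | F n x z}) < c * ws S.h {z | F n x z}) := by
  let fr : Set X → ℕ → ℝ≥0∞ := fun A n => ws S.h (A ∩ {z | F n x z}) / ws S.h {z | F n x z}
  let U : Ultrafilter ℕ := Filter.hyperfilter ℕ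
  let m : Set X → ℝ≥0∞ := fun A => (U.map (fr A)).lim
  have hm : ∀ A, Filter.Tendsto (fr A) U (nhds (m A)) := by
    intro A
    have := (U.map (fr A)).le_nhds_lim
    exact this
  have hU : (U : Filter ℕ) ≤ Filter.atTop := by
    have := @Filter.hyperfilter_le_cofinite ℕ _
    rwa [Nat.cofinite_eq_atTop] at this
  refine ⟨m, ⟨?_, ?_⟩, ?_, ?_⟩
  · refine tendsto_nhds_unique (hm univ) ?_
    have : fr univ = fun _ => 1 := by
      funext n
      simp only [fr, univ_inter]
      exact ENNReal.div_self (cls_pos (hF n) x) (cls_fin (hF n) x)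
    rw [this]; exact tendsto_const_nhds
  · intro A B hAB
    refine tendsto_nhds_unique (hm (A ∪ B)) ?_
    have : fr (A ∪ B) = fun n => fr A n + fr B n := by
      funext n
      simp only [fr]
      rw [union_inter_distrib_right, ws_union, ENNReal.add_div]
      exact hAB.mono inter_subset_left inter_subset_left
    rw [this]; exact (hm A).add (hm B)
  · intro A c hc n0
    have h1 := (hm A).eventually (lt_mem_nhds hc)
    have h2 := hU (Filter.eventually_ge_atTop n0)
    obtain ⟨n, h3, h4⟩ := (h1.and h2).exists
    refine ⟨n, h4, ?_⟩
    exact (ENNReal.lt_div_iff_mul_lt (Or.inl (cls_pos (hF n) x)) (Or.inl (cls_fin (hF n) x))).1 h3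
  · intro A c hc n0
    have h1 := (hm A).eventually (gt_mem_nhds hc)
    have h2 := hU (Filter.eventually_ge_atTop n0)
    obtain ⟨n, h3, h4⟩ := (h1.and h2).exists
    refine ⟨n, h4, ?_⟩
    exact (ENNReal.div_lt_iff (Or.inl (cls_pos (hF n) x)) (Or.inl (cls_fin (hF n) x))).1 h3

/-- limit functional predicates -/
structure Lim (S : Sys X) (F : ℕ → X → X → Prop) (x : X) (m : Set X → ℝ≥0∞) : Prop where
  hF : ∀ n, IsFinSubequiv S.E (F n)
  fa : FinAdd m
  lo : ∀ A c, c < m A → ∀ n0, ∃ n ≥ n0, c * ws S.h {z | F n x z} < ws S.h (A ∩ {z | F n x z})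
  up : ∀ A c, m A < c → ∀ n0, ∃ n ≥ n0, ws S.h (A ∩ {z | F n x z}) < c * ws S.h {z | F n x z}

variable {F : ℕ → X → X → Prop} {x : X} {m : Set X → ℝ≥0∞}

lemma Lim.mix_lt (hL : S.Lim F x m) {A : Set X} (hA : S.Mix F x A) {c : ℝ≥0∞} (hc : m A < c) :
    ∃ n0, ∀ n ≥ n0, ∀ y, S.E x y → ws S.h (A ∩ {z | F n y z}) ≤ c * ws S.h {z | F n y z} := by
  obtain ⟨s, hs, hsc⟩ := exists_between hc
  obtain ⟨n0, h | h⟩ := hA s c hsc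
  · obtain ⟨n, hn, h2⟩ := hL.up A s hs n0
    exact absurd (h n hn x (S.refl x)) (not_le.2 h2)
  · exact ⟨n0, h⟩

lemma Lim.mix_gt (hL : S.Lim F x m) {A : Set X} (hA : S.Mix F x A) {c : ℝ≥0∞} (hc : c < m A) :
    ∃ n0, ∀ n ≥ n0, ∀ y, S.E x y → c * ws S.h {z | F n y z} ≤ ws S.h (A ∩ {z | F n y z}) := by
  obtain ⟨s, hs, hsc⟩ := exists_between hc
  obtain ⟨n0, h | h⟩ := hA c s hs
  · exact ⟨n0, h⟩
  · obtain ⟨n, hn, h2⟩ := hL.lo A s hsc n0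
    exact absurd (h n hn x (S.refl x)) (not_le.2 h2)

lemma Lim.sigAdd (hL : S.Lim F x m) {P : ℕ → Set X} (hd : ∀ i j x, x ∈ P i → x ∈ P j → i = j)
    (hM1 : ∀ K k, S.Mix F x {z | ∃ j ≤ k, z ∈ P (j + K)}) (hM2 : ∀ K, S.Mix F x (⋃ j, P (j + K)))
    (hE : ∀ K, x ∉ S.Esc F fun j => P (j + K)) : SigAdd m P := by
  have key : ∀ δ : ℝ≥0∞, 0 < δ → ∃ K, m (⋃ j, P (j + K)) ≤ 5 * δ := by
    intro δ hδ
    by_contra hcon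
    push Not at hcon
    have hfin : ∑' k, m (P k) ≠ ⊤ :=
      ne_top_of_le_ne_top (hL.fa.ne_top _) (hL.fa.tsum_le hd)
    have ht := ENNReal.tendsto_sum_nat_add (fun k => m (P k)) hfin
    obtain ⟨K, hK⟩ := (ht.eventually (gt_mem_nhds hδ)).exists
    obtain ⟨n, -, hn⟩ := hL.lo (⋃ j, P (j + K)) 0 (lt_of_le_of_lt zero_le (hcon K)) 0
    have hne : ((⋃ j, P (j + K)) ∩ {z | F n x z}).Nonempty := by
      by_contra h
      rw [not_nonempty_iff_eq_empty.1 h, ws_empty, zero_mul] at hn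
      exact lt_irrefl _ hn
    obtain ⟨y, hy, hxy⟩ := hne
    obtain ⟨j, hj⟩ := mem_iUnion.1 hy
    refine hE (j + K) ⟨⟨y, (hL.hF n).2.2.1 hxy, by simpa using hj⟩, fun k => ?_⟩
    have h1 : m {z | ∃ i ≤ k, z ∈ P (i + (j + K))} < δ := by
      refine lt_of_le_of_lt ?_ hK
      have e : {z | ∃ i ≤ k, z ∈ P (i + (j + K))} ⊆ {z | ∃ i < k + j + 1, z ∈ P (i + K)} := by
        rintro z ⟨i, hi, hz⟩
        exact ⟨i + j, by omega, by rwa [add_assoc]⟩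
      refine (hL.fa.mono e).trans ?_
      rw [hL.fa.fin_sum (s := fun i => P (i + K)) (fun a b z ha hb => by
        have := hd _ _ _ ha hb; omega)]
      exact ENNReal.sum_le_tsum _
    obtain ⟨n1, hn1⟩ := hL.mix_lt (hM1 (j + K) k) h1
    obtain ⟨n2, hn2⟩ := hL.mix_gt (hM2 (j + K)) (hcon (j + K))
    refine ⟨max n1 n2, fun z hz => ?_⟩
    refine le_trans ?_ (hn2 _ (le_max_right _ _) z hz)
    rw [mul_assoc]
    gcongr
    exact hn1 _ (le_max_left _ _) z hz
  refine le_antisymm ?_ (hL.fa.tsum_le hd)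
  refine ENNReal.le_of_forall_pos_le_add fun ε hε _ => ?_
  obtain ⟨K, hK⟩ := key ((ε : ℝ≥0∞) / 5) (by
    refine ENNReal.div_pos (by exact_mod_cast hε.ne') (by norm_num))
  rw [ENNReal.mul_div_cancel (by norm_num) (by norm_num)] at hK
  have e : (⋃ k, P k) ⊆ {z | ∃ i < K, z ∈ P i} ∪ ⋃ j, P (j + K) := by
    intro z hz
    obtain ⟨i, hi⟩ := mem_iUnion.1 hz
    by_cases h : i < K
    · exact Or.inl ⟨i, h, hi⟩
    · exact Or.inr (mem_iUnion.2 ⟨i - K, by rwa [Nat.sub_add_cancel (by omega)]⟩)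
  refine (hL.fa.mono e).trans ((hL.fa.union_le _ _).trans (add_le_add ?_ hK))
  rw [hL.fa.fin_sum hd]
  exact ENNReal.sum_le_tsum _

/-- comparing constant-level sets -/
lemma Lim.compare (hL : S.Lim F x m) {B B' : Set X} {a b : ℤ} (hB : S.Mix F x B) (hB' : S.Mix F x B')
    (ha : ∀ z ∈ B, S.l z = a) (hb : ∀ z ∈ B', S.l z = b)
    (hn : ∀ n, ¬ ∀ y, S.E x y →
      ws (fun _ => 1) (B ∩ {z | F n y z}) < ws (fun _ => 1) (B' ∩ {z | F n y z})) :
    (2 : ℝ≥0∞) ^ a * m B' ≤ 2 ^ b * m B := by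
  have z0 : ∀ i : ℤ, (2 : ℝ≥0∞) ^ i ≠ 0 := fun i => (ENNReal.zpow_pos (by norm_num) (by norm_num) _).ne'
  have zt : ∀ i : ℤ, (2 : ℝ≥0∞) ^ i ≠ ⊤ := fun i => (ENNReal.zpow_lt_top (by norm_num) (by norm_num) _).ne
  have hw : ∀ (D : Set X) (c : ℤ), (∀ z ∈ D, S.l z = c) → ∀ Q, ws S.h (D ∩ Q) = 2 ^ c * ws (fun _ => 1) (D ∩ Q) := by
    intro D c hD Q
    rw [← ws_const_mul]
    refine le_antisymm (ws_le_ws fun z hz => ?_) (ws_le_ws fun z hz => ?_) <;>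
    · simp only [Sys.h]; rw [hD z hz.1, mul_one]
  by_contra hcon
  rw [not_le] at hcon
  have h1 : m B / 2 ^ a < m B' / 2 ^ b := by
    rw [ENNReal.div_lt_iff (Or.inl (z0 a)) (Or.inl (zt a)), mul_comm, ← mul_div_assoc,
      ENNReal.lt_div_iff_mul_lt (Or.inl (z0 b)) (Or.inl (zt b)), mul_comm]
    exact hcon
  obtain ⟨c, hc1, hc⟩ := exists_between h1
  obtain ⟨d, hcd, hd⟩ := exists_between hc
  rw [ENNReal.div_lt_iff (Or.inl (z0 a)) (Or.inl (zt a))] at hc1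
  rw [ENNReal.lt_div_iff_mul_lt (Or.inl (z0 b)) (Or.inl (zt b))] at hd
  obtain ⟨n1, hn1⟩ := hL.mix_lt hB hc1
  obtain ⟨n2, hn2⟩ := hL.mix_gt hB' hd
  refine hn (max n1 n2) fun y hy => ?_
  have g1 := hn1 (max n1 n2) (le_max_left _ _) y hy
  have g2 := hn2 (max n1 n2) (le_max_right _ _) y hy
  rw [hw B a ha, mul_comm c, mul_assoc, ENNReal.mul_le_mul_iff_right (z0 a) (zt a)] at g1
  rw [hw B' b hb, mul_comm d, mul_assoc, ENNReal.mul_le_mul_iff_right (z0 b) (zt b)] at g2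
  refine g1.trans_lt (lt_of_lt_of_le ?_ g2)
  have p0 := cls_pos (hL.hF (max n1 n2)) y
  have pt := cls_fin (hL.hF (max n1 n2)) y
  rw [mul_comm c, mul_comm d]
  exact (ENNReal.mul_lt_mul_iff_right p0 pt).2 hcd

/-- sigma-additivity from levelwise sigma-additivity -/
lemma level_sum (hm : FinAdd m) (hH : SigAdd m fun k : ℕ => {z | S.l z = k})
    (hLo : SigAdd m fun k : ℕ => {z | S.l z = -1 - k}) (A : Set X) :
    m A = ∑' k : ℕ, m (A ∩ {z | S.l z = k}) + ∑' k : ℕ, m (A ∩ {z | S.l z = -1 - k}) := by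
  have hle : ∀ A : Set X, ∑' k : ℕ, m (A ∩ {z | S.l z = k}) + ∑' k : ℕ, m (A ∩ {z | S.l z = -1 - k}) ≤ m A := by
    intro A
    have h1 := hm.tsum_le (s := fun k : ℕ => A ∩ {z | S.l z = k}) (fun i j z hi hj => by
      have a1 : S.l z = i := hi.2
      have a2 : S.l z = j := hj.2
      omega)
    have h2 := hm.tsum_le (s := fun k : ℕ => A ∩ {z | S.l z = -1 - k}) (fun i j z hi hj => by
      have a1 : S.l z = -1 - i := hi.2
      have a2 : S.l z = -1 - j := hj.2
      omega)
    refine (add_le_add h1 h2).trans ?_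
    rw [← hm.2]
    · exact hm.mono (union_subset (iUnion_subset fun _ => inter_subset_left) (iUnion_subset fun _ => inter_subset_left))
    · rw [Set.disjoint_left]
      intro z hz hz'
      obtain ⟨i, hi⟩ := mem_iUnion.1 hz
      obtain ⟨j, hj⟩ := mem_iUnion.1 hz'
      have a1 : S.l z = i := hi.2
      have a2 : S.l z = -1 - j := hj.2
      omega
  have hone : ∑' k : ℕ, m {z | S.l z = k} + ∑' k : ℕ, m {z | S.l z = -1 - k} = 1 := by
    unfold SigAdd at hH hLo
    rw [← hH, ← hLo, ← hm.2, ← hm.1]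
    · congr 1
      ext z
      simp only [mem_union, mem_iUnion, mem_univ, iff_true]
      rcases le_or_gt 0 (S.l z) with h | h
      · exact Or.inl ⟨(S.l z).toNat, by change S.l z = _; omega⟩
      · exact Or.inr ⟨(-1 - S.l z).toNat, by change S.l z = _; omega⟩
    · rw [Set.disjoint_left]
      intro z hz hz'
      obtain ⟨i, hi⟩ := mem_iUnion.1 hz
      obtain ⟨j, hj⟩ := mem_iUnion.1 hz'
      have a1 : S.l z = i := hi
      have a2 : S.l z = -1 - j := hj
      omega
  have hsplit : ∀ C, m (A ∩ C) + m (Aᶜ ∩ C) = m C := by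
    intro C
    rw [← hm.2, ← union_inter_distrib_right, union_compl_self, univ_inter]
    exact disjoint_compl_right.mono inter_subset_left inter_subset_left
  have h1 := hle A
  have h2 := hle Aᶜ
  have h3 : m A + m Aᶜ = 1 := by rw [← hm.2 _ _ disjoint_compl_right, union_compl_self, hm.1]
  have h4 : (∑' k : ℕ, m (A ∩ {z | S.l z = k}) + ∑' k : ℕ, m (A ∩ {z | S.l z = -1 - k})) +
      (∑' k : ℕ, m (Aᶜ ∩ {z | S.l z = k}) + ∑' k : ℕ, m (Aᶜ ∩ {z | S.l z = -1 - k})) = 1 := by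
    rw [← hone, add_add_add_comm, ← ENNReal.tsum_add, ← ENNReal.tsum_add]
    simp only [hsplit]
  refine le_antisymm ?_ h1
  rw [← ENNReal.add_le_add_iff_right (hm.ne_top Aᶜ), h3, ← h4]
  gcongr

lemma sig_of_levels (hm : FinAdd m) (hH : SigAdd m fun k : ℕ => {z | S.l z = k})
    (hLo : SigAdd m fun k : ℕ => {z | S.l z = -1 - k}) {s : ℕ → Set X}
    (hs : ∀ i : ℤ, SigAdd m fun k => s k ∩ {z | S.l z = i}) : SigAdd m s := by
  unfold SigAdd at *
  rw [level_sum hm hH hLo]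
  simp only [iUnion_inter, hs]
  rw [ENNReal.tsum_comm, ENNReal.tsum_comm (f := fun (k : ℕ) k_1 => m (s k_1 ∩ {z | S.l z = -1 - k})),
    ← ENNReal.tsum_add]
  exact tsum_congr fun k => (level_sum hm hH hLo (s k)).symm

end Sys
end CocycleNadkarni

namespace CocycleNadkarni

set_option linter.unusedSectionVars false

namespace Sys
variable {X : Type*} [MeasurableSpace X] {S : Sys X} [StandardBorelSpace X]

lemma exists_good (hnc : ¬ S.Comp univ) {𝒩 : Set (Set X)} (hc : 𝒩.Countable) (h : ∀ N ∈ 𝒩, S.Comp N) :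
    ∃ x, ∀ N ∈ 𝒩, x ∉ N := by
  by_contra hcon
  push Not at hcon
  apply hnc
  have h1 : S.Comp (⋃ N ∈ insert ∅ 𝒩, N) := by
    have : Countable ↥(insert ∅ 𝒩) := (hc.insert ∅).to_subtype
    have : Nonempty ↥(insert ∅ 𝒩) := ⟨⟨∅, mem_insert _ _⟩⟩
    rw [biUnion_eq_iUnion]
    refine Comp.iUnion fun N => ?_
    rcases N.2 with h' | h'
    · rw [h']; exact Comp.empty
    · exact h _ h'
  refine h1.mono fun x _ => ?_
  obtain ⟨N, hN, hx⟩ := hcon x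
  exact mem_biUnion (mem_insert_of_mem _ hN) hx

/-- piece of `B` -/
def pc (S : Sys X) (j : ℕ) (a b : ℤ) (B : Set X) : Set X := {z | z ∈ B ∧ S.l z = a ∧ S.l (S.γ j z) = b}
/-- image of the piece -/
def pi (S : Sys X) (j : ℕ) (a b : ℤ) (B : Set X) : Set X := {z | S.γ j z ∈ S.pc j a b B}

lemma pc_meas (j : ℕ) (a b : ℤ) {B : Set X} (hB : MeasurableSet B) : MeasurableSet (S.pc j a b B) :=
  hB.inter ((S.hlm (measurableSet_singleton a)).inter
    ((S.hlm.comp (S.γ j).measurable) (measurableSet_singleton b)))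

lemma pi_meas (j : ℕ) (a b : ℤ) {B : Set X} (hB : MeasurableSet B) : MeasurableSet (S.pi j a b B) :=
  (S.γ j).measurable (pc_meas j a b hB)

theorem exists_fin_inv (hinf : ∀ x, ws S.f {y | S.E x y} = ⊤) (hnc : ¬ S.Comp univ)
    {𝒜 : Set (ℕ → Set X)} (h𝒜c : 𝒜.Countable) (h𝒜 : ∀ s ∈ 𝒜, DSeq s)
    {𝓑 : Set (Set X)} (h𝓑c : 𝓑.Countable) (h𝓑 : ∀ B ∈ 𝓑, MeasurableSet B) :
    ∃ m, FinAdd m ∧ (∀ s ∈ 𝒜, SigAdd m s) ∧ ∀ B ∈ 𝓑, ∀ j a b,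
      (2 : ℝ≥0∞) ^ a * m (S.pi j a b B) = 2 ^ b * m (S.pc j a b B) := by
  let H : ℕ → Set X := fun k => {z | S.l z = k}
  let Lo : ℕ → Set X := fun k => {z | S.l z = -1 - k}
  let 𝓟 : Set (ℕ → Set X) := {H} ∪ {Lo} ∪
    (fun p : (ℕ → Set X) × ℤ => fun k => p.1 k ∩ {z | S.l z = p.2}) '' (𝒜 ×ˢ univ)
  have h𝓟c : 𝓟.Countable :=
    ((countable_singleton _).union (countable_singleton _)).union ((h𝒜c.prod countable_univ).image _)
  have hlev : ∀ i : ℤ, MeasurableSet {z | S.l z = i} := fun i => S.hlm (measurableSet_singleton i)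
  have h𝓟d : ∀ P ∈ 𝓟, DSeq P := by
    rintro P ((rfl | rfl) | ⟨⟨s, i⟩, ⟨hs, -⟩, rfl⟩)
    · refine ⟨fun k => hlev _, fun i j z hi hj => ?_⟩
      have a1 : S.l z = i := hi
      have a2 : S.l z = j := hj
      omega
    · refine ⟨fun k => hlev _, fun i j z hi hj => ?_⟩
      have a1 : S.l z = -1 - i := hi
      have a2 : S.l z = -1 - j := hj
      omega
    · exact ⟨fun k => ((h𝒜 s hs).1 k).inter (hlev i), fun a b z ha hb => (h𝒜 s hs).2 a b z ha.1 hb.1⟩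
  have h𝓟C : ∀ F : ℕ → X → X → Prop, (∀ n, IsFinSubequiv S.E (F n)) →
      (∀ n m, n ≤ m → ∀ x y, F n x y → F m x y) → ∀ P ∈ 𝓟, ∀ K : ℕ, S.Comp (S.Esc F fun j => P (j + K)) := by
    intro F hF hmono P hP K
    have hm : ∀ k, MeasurableSet (P (k + K)) := fun k => (h𝓟d P hP).1 _
    have hd : ∀ i j x, x ∈ P (i + K) → x ∈ P (j + K) → i = j := fun i j x hi hj => by
      have := (h𝓟d P hP).2 _ _ _ hi hj
      omega
    rcases hP with (rfl | rfl) | ⟨⟨s, i⟩, ⟨hs, -⟩, rfl⟩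
    · refine comp_H (K := K) hF hmono hm hd fun k x hx => ?_
      have a1 : S.l x = ((k + K : ℕ) : ℤ) := hx
      rw [a1]; push_cast; ring
    · refine comp_II (lam := fun k => -1 - ((k + K : ℕ) : ℤ)) hF hmono hm hd (fun k x hx => hx) ?_
      intro a b hab
      simp only
      omega
    · exact comp_II (lam := fun k => i) hF hmono hm hd (fun k x hx => hx.2) antitone_const
  let 𝓕 : Set (Set X) := {univ} ∪
    (fun p : Set X × ℕ × ℤ × ℤ => S.pc p.2.1 p.2.2.1 p.2.2.2 p.1) '' (𝓑 ×ˢ univ) ∪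
    (fun p : Set X × ℕ × ℤ × ℤ => S.pi p.2.1 p.2.2.1 p.2.2.2 p.1) '' (𝓑 ×ˢ univ) ∪
    (fun p : (ℕ → Set X) × ℕ × ℕ => {z | ∃ j ≤ p.2.2, z ∈ p.1 (j + p.2.1)}) '' (𝓟 ×ˢ univ) ∪
    (fun p : (ℕ → Set X) × ℕ => ⋃ j, p.1 (j + p.2)) '' (𝓟 ×ˢ univ)
  have h𝓕c : 𝓕.Countable :=
    ((((countable_singleton _).union ((h𝓑c.prod countable_univ).image _)).union
      ((h𝓑c.prod countable_univ).image _)).union ((h𝓟c.prod countable_univ).image _)).union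
      ((h𝓟c.prod countable_univ).image _)
  have h𝓕m : ∀ A ∈ 𝓕, MeasurableSet A := by
    rintro A ((((rfl | ⟨⟨B, j, a, b⟩, ⟨hB, -⟩, rfl⟩) | ⟨⟨B, j, a, b⟩, ⟨hB, -⟩, rfl⟩) | ⟨⟨P, K, k⟩, ⟨hP, -⟩, rfl⟩) | ⟨⟨P, K⟩, ⟨hP, -⟩, rfl⟩)
    · exact MeasurableSet.univ
    · exact pc_meas _ _ _ (h𝓑 B hB)
    · exact pi_meas _ _ _ (h𝓑 B hB)
    · exact meas_le (P := fun j => P (j + K)) (fun i => (h𝓟d P hP).1 _) k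
    · exact MeasurableSet.iUnion fun i => (h𝓟d P hP).1 _
  obtain ⟨A, hA⟩ := h𝓕c.exists_eq_range ⟨univ, Or.inl (Or.inl (Or.inl (Or.inl rfl)))⟩
  obtain ⟨F, hF, hmono, N, hN, hmix⟩ := mixing_seq hinf A fun i => h𝓕m _ (hA ▸ mem_range_self i)
  let C : ℕ → Set X → Set X → Set X := fun n B B' => {x | ∀ y, S.E x y →
    ws (fun _ => 1) (B ∩ {z | F n y z}) < ws (fun _ => 1) (B' ∩ {z | F n y z})}
  let 𝒩 : Set (Set X) := {N} ∪
    (fun p : (ℕ → Set X) × ℕ => S.Esc F fun j => p.1 (j + p.2)) '' (𝓟 ×ˢ univ) ∪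
    (fun p : Set X × ℕ × ℤ × ℤ × ℕ => C p.2.2.2.2 (S.pc p.2.1 p.2.2.1 p.2.2.2.1 p.1)
      (S.pi p.2.1 p.2.2.1 p.2.2.2.1 p.1)) '' (𝓑 ×ˢ univ) ∪
    (fun p : Set X × ℕ × ℤ × ℤ × ℕ => C p.2.2.2.2 (S.pi p.2.1 p.2.2.1 p.2.2.2.1 p.1)
      (S.pc p.2.1 p.2.2.1 p.2.2.2.1 p.1)) '' (𝓑 ×ˢ univ)
  have hpi : ∀ j a b B z, z ∈ S.pi j a b B → S.l z = b := by
    intro j a b B z hz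
    have := hz.2.2
    rwa [S.hγ2] at this
  obtain ⟨x, hx⟩ := exists_good hnc (𝒩 := 𝒩)
    ((((countable_singleton _).union ((h𝓟c.prod countable_univ).image _)).union
      ((h𝓑c.prod countable_univ).image _)).union ((h𝓑c.prod countable_univ).image _)) (by
    rintro M (((rfl | ⟨⟨P, K⟩, ⟨hP, -⟩, rfl⟩) | ⟨⟨B, j, a, b, n⟩, ⟨hB, -⟩, rfl⟩) | ⟨⟨B, j, a, b, n⟩, ⟨hB, -⟩, rfl⟩)
    · exact hN
    · exact h𝓟C F hF hmono P hP K
    · exact comp_count (hF n) (pc_meas j a b (h𝓑 B hB)) (pi_meas j a b (h𝓑 B hB)) (S.γ j)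
        (S.γ j).measurable (fun z _ => S.E_γ j z) (fun z hz => hz) (S.γ j).injective.injOn (hpi j a b B)
    · refine comp_count (hF n) (pi_meas j a b (h𝓑 B hB)) (pc_meas j a b (h𝓑 B hB)) (S.γ j)
        (S.γ j).measurable (fun z _ => S.E_γ j z) (fun z hz => ?_) (S.γ j).injective.injOn (fun z hz => hz.2.1)
      change S.γ j (S.γ j z) ∈ S.pc j a b B
      rwa [S.hγ2])
  have hxN : x ∉ N := hx _ (Or.inl (Or.inl (Or.inl rfl)))
  have hM : ∀ D ∈ 𝓕, S.Mix F x D := by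
    intro D hD s t hst
    rw [hA] at hD
    obtain ⟨i, rfl⟩ := hD
    exact hmix x hxN i s t hst
  obtain ⟨m, hfa, hlo, hup⟩ := exists_lim hF x
  have hL : S.Lim F x m := ⟨hF, hfa, hlo, hup⟩
  have hsig : ∀ P ∈ 𝓟, SigAdd m P := by
    intro P hP
    refine hL.sigAdd (h𝓟d P hP).2 (fun K k => hM _ ?_) (fun K => hM _ ?_) fun K => hx _ ?_
    · exact Or.inl (Or.inr ⟨(P, K, k), ⟨hP, mem_univ _⟩, rfl⟩)
    · exact Or.inr ⟨(P, K), ⟨hP, mem_univ _⟩, rfl⟩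
    · exact Or.inl (Or.inl (Or.inr ⟨(P, K), ⟨hP, mem_univ _⟩, rfl⟩))
  refine ⟨m, hfa, fun s hs => ?_, fun B hB j a b => ?_⟩
  · exact sig_of_levels hfa (hsig H (Or.inl (Or.inl rfl))) (hsig Lo (Or.inl (Or.inr rfl)))
      fun i => hsig _ (Or.inr ⟨(s, i), ⟨hs, mem_univ _⟩, rfl⟩)
  · have m1 : S.Mix F x (S.pc j a b B) :=
      hM _ (Or.inl (Or.inl (Or.inl (Or.inr ⟨(B, j, a, b), ⟨hB, mem_univ _⟩, rfl⟩))))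
    have m2 : S.Mix F x (S.pi j a b B) :=
      hM _ (Or.inl (Or.inl (Or.inr ⟨(B, j, a, b), ⟨hB, mem_univ _⟩, rfl⟩)))
    refine le_antisymm (hL.compare m1 m2 (fun z hz => hz.2.1) (hpi j a b B) fun n => ?_)
      (hL.compare m2 m1 (hpi j a b B) (fun z hz => hz.2.1) fun n => ?_)
    · exact hx _ (Or.inl (Or.inr ⟨(B, j, a, b, n), ⟨hB, mem_univ _⟩, rfl⟩))
    · exact hx _ (Or.inr ⟨(B, j, a, b, n), ⟨hB, mem_univ _⟩, rfl⟩)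

end Sys
end CocycleNadkarni

namespace CocycleNadkarni

set_option linter.unusedSectionVars false

namespace Sys
variable {X : Type*} [MeasurableSpace X] {S : Sys X} [StandardBorelSpace X]

/-- invariance under the full pseudogroup from invariance under generators -/
lemma inv_full {κ : Measure X} (hκ : ∀ j B, MeasurableSet B → κ (S.γ j ⁻¹' B) = κ B)
    (T : X ≃ᵐ X) (hT : ∀ x, S.E x (T x)) : MeasurePreserving T κ κ := by
  classical
  have him : ∀ B, MeasurableSet B → κ (T '' B) = κ B := by
    intro B hB
    let D : ℕ → Set X := fun n => {x | S.γ n x = T x}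
    have hD : ∀ n, MeasurableSet (D n) := fun n => measurableSet_eq_fun (S.γ n).measurable T.measurable
    let d : ℕ → Set X := disjointed D
    have hdm : ∀ n, MeasurableSet (d n) := fun n => MeasurableSet.disjointed hD n
    have hdU : ⋃ n, d n = univ := by
      rw [iUnion_disjointed]
      refine eq_univ_of_forall fun x => ?_
      obtain ⟨n, hn⟩ := (S.hγ _ _).1 (hT x)
      exact mem_iUnion.2 ⟨n, hn⟩
    have e1 : B = ⋃ n, B ∩ d n := by rw [← inter_iUnion, hdU, inter_univ]
    have e2 : T '' B = ⋃ n, S.γ n ⁻¹' (B ∩ d n) := by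
      conv_lhs => rw [e1, image_iUnion]
      refine iUnion_congr fun n => ?_
      ext y
      constructor
      · rintro ⟨x, hx, rfl⟩
        have : S.γ n x = T x := disjointed_subset D n hx.2
        change S.γ n (T x) ∈ B ∩ d n
        rw [← this, S.hγ2]; exact hx
      · intro hy
        have : S.γ n (S.γ n y) = T (S.γ n y) := disjointed_subset D n hy.2
        rw [S.hγ2] at this
        exact ⟨_, hy, this.symm⟩
    have hdis : Pairwise (Function.onFun Disjoint fun n => B ∩ d n) := fun i j hij =>
      (disjoint_disjointed D hij).mono inter_subset_right inter_subset_right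
    rw [e2, measure_iUnion]
    · conv_rhs => rw [e1]
      rw [measure_iUnion hdis fun n => hB.inter (hdm n)]
      exact tsum_congr fun n => hκ n _ (hB.inter (hdm n))
    · intro i j hij
      rw [Function.onFun, Set.disjoint_left]
      intro y hy hy'
      have h1 : S.γ i (S.γ i y) = T (S.γ i y) := disjointed_subset D i hy.2
      have h2 : S.γ j (S.γ j y) = T (S.γ j y) := disjointed_subset D j hy'.2
      rw [S.hγ2] at h1 h2
      have h3 := T.injective (h1.symm.trans h2)
      have hy2 : S.γ j y ∈ B ∩ d j := hy'
      rw [← h3] at hy2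
      exact (Set.disjoint_left.1 (hdis hij) hy) hy2
    · exact fun n => (S.γ n).measurable (hB.inter (hdm n))
  refine ⟨T.measurable, ?_⟩
  ext B hB
  rw [Measure.map_apply T.measurable hB, ← him _ (T.measurable hB), T.surjective.image_preimage]

lemma prob_of_kappa {κ : Measure X} (hκ : ∀ j B, MeasurableSet B → κ (S.γ j ⁻¹' B) = κ B)
    (h0 : ∫⁻ x, S.f x ∂κ ≠ 0) (ht : ∫⁻ x, S.f x ∂κ ≠ ⊤) :
    ∃ μ : Measure X, IsProbabilityMeasure μ ∧ ∀ T : X ≃ᵐ X, (∀ x, S.E x (T x)) → ∀ B, MeasurableSet B →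
      μ (T '' B) = ∫⁻ x in B, S.f (T x) / S.f x ∂μ := by
  set c := (∫⁻ x, S.f x ∂κ)⁻¹ with hc
  refine ⟨c • κ.withDensity S.f, ⟨?_⟩, fun T hT B hB => ?_⟩
  · rw [Measure.smul_apply, withDensity_apply _ MeasurableSet.univ, Measure.restrict_univ, smul_eq_mul]
    exact ENNReal.inv_mul_cancel h0 ht
  · have hmp := inv_full hκ T hT
    rw [Measure.smul_apply, Measure.restrict_smul, lintegral_smul_measure, smul_eq_mul, smul_eq_mul]
    congr 1
    have hTB : MeasurableSet (T '' B) := T.measurableSet_image.2 hB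
    rw [withDensity_apply _ hTB, restrict_withDensity hB,
      lintegral_withDensity_eq_lintegral_mul _ S.hfm
        (show Measurable fun x => S.f (T x) / S.f x from (S.hfm.comp T.measurable).div S.hfm)]
    rw [← hmp.setLIntegral_comp_emb T.measurableEmbedding]
    refine lintegral_congr fun x => ?_
    simp only [Pi.mul_apply]
    exact (ENNReal.mul_div_cancel (S.hf0 x) (S.hft x)).symm

/-- a class of finite mass carries an invariant probability -/
lemma prob_of_finite_class {x0 : X} (hx : ws S.f {y | S.E x0 y} ≠ ⊤) :
    ∃ κ : Measure X, (∀ j B, MeasurableSet B → κ (S.γ j ⁻¹' B) = κ B) ∧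
     ∫⁻ x, S.f x ∂κ ≠ 0 ∧ ∫⁻ x, S.f x ∂κ ≠ ⊤ := by
  have hC : MeasurableSet {y | S.E x0 y} := measurable_prodMk_left S.hEm
  refine ⟨Measure.count.restrict {y | S.E x0 y}, fun j B hB => ?_, ?_⟩
  · rw [Measure.restrict_apply hB, Measure.restrict_apply ((S.γ j).measurable hB)]
    have : S.γ j ⁻¹' B ∩ {y | S.E x0 y} = S.γ j '' (B ∩ {y | S.E x0 y}) := by
      ext y
      constructor
      · rintro ⟨h1, h2⟩
        exact ⟨S.γ j y, ⟨h1, S.eqv.trans h2 (S.E_γ j y)⟩, S.hγ2 j y⟩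
      · rintro ⟨z, ⟨h1, h2⟩, rfl⟩
        exact ⟨by change S.γ j (S.γ j z) ∈ B; rwa [S.hγ2], S.eqv.trans h2 (S.E_γ j z)⟩
    rw [this, Measure.count_injective_image (S.γ j).injective]
  · have : ∫⁻ x, S.f x ∂(Measure.count.restrict {y | S.E x0 y}) = ws S.f {y | S.E x0 y} := by
      rw [← lintegral_indicator hC, lintegral_count]; rfl
    rw [this]
    exact ⟨ws_pos S.hf0 ⟨x0, S.refl x0⟩, hx⟩

lemma exists_pi_gen (X : Type*) [i : MeasurableSpace X] [StandardBorelSpace X] : ∃ 𝓑 : Set (Set X), 𝓑.Countable ∧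
    IsPiSystem 𝓑 ∧ i = MeasurableSpace.generateFrom 𝓑 := by
  obtain ⟨e, he⟩ := MeasureTheory.exists_measurableEmbedding_real X
  refine ⟨{s | ∃ t ∈ ⋃ q : ℚ, ({Iic (q : ℝ)} : Set (Set ℝ)), e ⁻¹' t = s}, ?_, Real.isPiSystem_Iic_rat.comap e, ?_⟩
  · exact (countable_iUnion fun q => countable_singleton _).image _
  · rw [← he.comap_eq, (BorelSpace.measurable_eq (α := ℝ)), Real.borel_eq_generateFrom_Iic_rat]
    exact MeasurableSpace.comap_generateFrom

theorem exists_kappa (hinf : ∀ x, ws S.f {y | S.E x y} = ⊤) (hnc : ¬ S.Comp univ) :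
    ∃ κ : Measure X, (∀ j B, MeasurableSet B → κ (S.γ j ⁻¹' B) = κ B) ∧
     ∫⁻ x, S.f x ∂κ ≠ 0 ∧ ∫⁻ x, S.f x ∂κ ≠ ⊤ := by
  obtain ⟨𝓑₀, hc₀, hpi, hgen⟩ := exists_pi_gen X
  have hm₀ : ∀ B ∈ 𝓑₀, MeasurableSet B := by
    intro B hB
    rw [hgen]; exact MeasurableSpace.measurableSet_generateFrom hB
  set 𝓑 := insert univ 𝓑₀ with h𝓑
  have hc : 𝓑.Countable := hc₀.insert _
  have hm : ∀ B ∈ 𝓑, MeasurableSet B := by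
    rintro B (rfl | hB)
    · exact MeasurableSet.univ
    · exact hm₀ B hB
  let ℬ : Set (Set X) :=
    (fun p : Set X × ℕ × ℤ × ℤ => S.pc p.2.1 p.2.2.1 p.2.2.2 p.1) '' (𝓑 ×ˢ univ) ∪
    (fun p : Set X × ℕ × ℤ × ℤ => S.pi p.2.1 p.2.2.1 p.2.2.2 p.1) '' (𝓑 ×ˢ univ)
  obtain ⟨𝒮, h𝒮c, h𝒮d, h𝒮⟩ := exists_measure (ℬ := ℬ)
    (((hc.prod countable_univ).image _).union ((hc.prod countable_univ).image _)) (by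
    rintro A (⟨⟨B, j, a, b⟩, ⟨hB, -⟩, rfl⟩ | ⟨⟨B, j, a, b⟩, ⟨hB, -⟩, rfl⟩)
    · exact pc_meas _ _ _ (hm B hB)
    · exact pi_meas _ _ _ (hm B hB))
  obtain ⟨m, hfa, hsig, hinv⟩ := exists_fin_inv hinf hnc h𝒮c h𝒮d hc hm
  obtain ⟨μ, hμ, hμm⟩ := h𝒮 m hfa hsig
  have hμinv : ∀ B ∈ 𝓑, ∀ j a b, (2 : ℝ≥0∞) ^ a * μ (S.pi j a b B) = 2 ^ b * μ (S.pc j a b B) := by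
    intro B hB j a b
    rw [hμm _ (Or.inr ⟨(B, j, a, b), ⟨hB, mem_univ _⟩, rfl⟩),
      hμm _ (Or.inl ⟨(B, j, a, b), ⟨hB, mem_univ _⟩, rfl⟩)]
    exact hinv B hB j a b
  have z0 : ∀ i : ℤ, (2 : ℝ≥0∞) ^ i ≠ 0 := fun i => (ENNReal.zpow_pos (by norm_num) (by norm_num) _).ne'
  have zt : ∀ i : ℤ, (2 : ℝ≥0∞) ^ i ≠ ⊤ := fun i => (ENNReal.zpow_lt_top (by norm_num) (by norm_num) _).ne
  have hall : ∀ j a b B, MeasurableSet B →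
      (2 : ℝ≥0∞) ^ a * μ (S.pi j a b B) = 2 ^ b * μ (S.pc j a b B) := by
    intro j a b
    let ν1 : Measure X := (2 : ℝ≥0∞) ^ a • (μ.restrict (S.pi j a b univ)).map (S.γ j)
    let ν2 : Measure X := (2 : ℝ≥0∞) ^ b • μ.restrict (S.pc j a b univ)
    have e1 : ∀ B, MeasurableSet B → ν1 B = (2 : ℝ≥0∞) ^ a * μ (S.pi j a b B) := by
      intro B hB
      simp only [ν1, Measure.smul_apply, smul_eq_mul]
      rw [Measure.map_apply (S.γ j).measurable hB, Measure.restrict_apply ((S.γ j).measurable hB)]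
      congr 2
      ext z
      simp only [pi, pc, mem_inter_iff, mem_preimage, mem_ofPred_eq, mem_univ, true_and]
    have e2 : ∀ B, MeasurableSet B → ν2 B = (2 : ℝ≥0∞) ^ b * μ (S.pc j a b B) := by
      intro B hB
      simp only [ν2, Measure.smul_apply, smul_eq_mul]
      rw [Measure.restrict_apply hB]
      congr 2
      ext z
      simp only [pc, mem_inter_iff, mem_ofPred_eq, mem_univ, true_and]
    have hfin : IsFiniteMeasure ν1 := ⟨by
      rw [e1 _ MeasurableSet.univ]
      exact ENNReal.mul_lt_top (zt a).lt_top (measure_lt_top _ _)⟩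
    have : ν1 = ν2 := ext_of_generate_finite 𝓑₀ hgen hpi (fun B hB => by
      rw [e1 B (hm₀ B hB), e2 B (hm₀ B hB)]
      exact hμinv B (Or.inr hB) j a b) (by
      rw [e1 _ MeasurableSet.univ, e2 _ MeasurableSet.univ]
      exact hμinv univ (Or.inl rfl) j a b)
    intro B hB
    rw [← e1 B hB, ← e2 B hB, this]
  let κ : Measure X := μ.withDensity fun x => (S.h x)⁻¹
  have hκc : ∀ (D : Set X) (c : ℤ), MeasurableSet D → (∀ z ∈ D, S.l z = c) → κ D = (2 ^ c)⁻¹ * μ D := by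
    intro D c hD hl
    simp only [κ]
    rw [withDensity_apply _ hD, setLIntegral_congr_fun (g := fun _ => ((2 : ℝ≥0∞) ^ c)⁻¹) hD]
    · rw [setLIntegral_const]
    · intro z hz
      simp only [Sys.h]
      rw [hl z hz]
  have hpl : ∀ j a b B z, z ∈ S.pi j a b B → S.l z = b := by
    intro j a b B z hz
    have := hz.2.2
    rwa [S.hγ2] at this
  refine ⟨κ, fun j B hB => ?_, ?_⟩
  · have u1 : B = ⋃ p : ℤ × ℤ, S.pc j p.1 p.2 B := by
      ext z
      simp only [mem_iUnion, Prod.exists]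
      constructor
      · intro hz; exact ⟨_, _, hz, rfl, rfl⟩
      · rintro ⟨a, b, hz⟩; exact hz.1
    have u2 : S.γ j ⁻¹' B = ⋃ p : ℤ × ℤ, S.pi j p.1 p.2 B := by
      conv_lhs => rw [u1, preimage_iUnion]
      rfl
    have d1 : Pairwise (Function.onFun Disjoint fun p : ℤ × ℤ => S.pc j p.1 p.2 B) := by
      intro p q hpq
      rw [Function.onFun, Set.disjoint_left]
      intro z h1 h2
      exact hpq (Prod.ext (h1.2.1.symm.trans h2.2.1) (h1.2.2.symm.trans h2.2.2))
    have d2 : Pairwise (Function.onFun Disjoint fun p : ℤ × ℤ => S.pi j p.1 p.2 B) := by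
      intro p q hpq
      exact (d1 hpq).preimage (S.γ j)
    rw [u2, measure_iUnion d2 fun p => pi_meas j _ _ hB]
    conv_rhs => rw [u1]
    rw [measure_iUnion d1 fun p => pc_meas j _ _ hB]
    refine tsum_congr fun p => ?_
    rw [hκc _ p.2 (pi_meas j _ _ hB) (hpl _ _ _ _), hκc _ p.1 (pc_meas j _ _ hB) fun z hz => hz.2.1]
    have h1 := hall j p.1 p.2 B hB
    have h2 : ((2 : ℝ≥0∞) ^ p.1)⁻¹ * (2 ^ p.2)⁻¹ * (2 ^ p.1 * μ (S.pi j p.1 p.2 B)) =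
      ((2 : ℝ≥0∞) ^ p.1)⁻¹ * (2 ^ p.2)⁻¹ * (2 ^ p.2 * μ (S.pc j p.1 p.2 B)) := by rw [h1]
    calc (2 ^ p.2)⁻¹ * μ (S.pi j p.1 p.2 B) = (((2 : ℝ≥0∞) ^ p.1)⁻¹ * 2 ^ p.1) * ((2 ^ p.2)⁻¹ * μ (S.pi j p.1 p.2 B)) := by
          rw [ENNReal.inv_mul_cancel (z0 _) (zt _), one_mul]
      _ = ((2 : ℝ≥0∞) ^ p.1)⁻¹ * (2 ^ p.2)⁻¹ * (2 ^ p.1 * μ (S.pi j p.1 p.2 B)) := by ring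
      _ = _ := h2
      _ = (((2 : ℝ≥0∞) ^ p.2)⁻¹ * 2 ^ p.2) * ((2 ^ p.1)⁻¹ * μ (S.pc j p.1 p.2 B)) := by ring
      _ = _ := by rw [ENNReal.inv_mul_cancel (z0 _) (zt _), one_mul]
  · have e : ∫⁻ x, S.f x ∂κ = ∫⁻ x, (S.h x)⁻¹ * S.f x ∂μ :=
      lintegral_withDensity_eq_lintegral_mul _ S.h_meas.inv S.hfm
    have lo : 1 ≤ ∫⁻ x, (S.h x)⁻¹ * S.f x ∂μ := by
      calc (1 : ℝ≥0∞) = ∫⁻ x, 1 ∂μ := by simp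
        _ ≤ _ := lintegral_mono fun x => by
          rw [← ENNReal.inv_mul_cancel (S.h_ne_zero x) (S.h_ne_top x)]
          gcongr
          exact S.h_le x
    have up : ∫⁻ x, (S.h x)⁻¹ * S.f x ∂μ ≤ 2 := by
      calc _ ≤ ∫⁻ x, 2 ∂μ := lintegral_mono fun x => by
            calc (S.h x)⁻¹ * S.f x ≤ (S.h x)⁻¹ * (2 * S.h x) := by gcongr; exact S.f_le x
              _ = 2 * ((S.h x)⁻¹ * S.h x) := by ring
              _ = 2 := by rw [ENNReal.inv_mul_cancel (S.h_ne_zero x) (S.h_ne_top x), mul_one]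
        _ = 2 := by simp
    rw [e]
    exact ⟨(lt_of_lt_of_le one_pos lo).ne', ne_top_of_le_ne_top (by norm_num) up⟩

/-- dichotomy -/
theorem dichotomy (hnc : ¬ S.Comp univ) :
    ∃ μ : Measure X, IsProbabilityMeasure μ ∧ ∀ T : X ≃ᵐ X, (∀ x, S.E x (T x)) → ∀ B, MeasurableSet B →
      μ (T '' B) = ∫⁻ x in B, S.f (T x) / S.f x ∂μ := by
  by_cases hinf : ∀ x, ws S.f {y | S.E x y} = ⊤
  · obtain ⟨κ, h1, h2, h3⟩ := exists_kappa hinf hnc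
    exact prob_of_kappa h1 h2 h3
  · push Not at hinf
    obtain ⟨x0, hx⟩ := hinf
    obtain ⟨κ, h1, h2, h3⟩ := prob_of_finite_class hx
    exact prob_of_kappa h1 h2 h3

end Sys
end CocycleNadkarni

namespace CocycleNadkarni

set_option linter.unusedSectionVars false

namespace Sys
variable {X : Type*} [MeasurableSpace X] {S : Sys X} [StandardBorelSpace X]

lemma tsum_formula {g : X → X → ℝ≥0∞} (hE : ∀ x y, ¬ S.E x y → g x y = 0) (x : X)
    [∀ n, Decidable (∀ k < n, S.γ k x ≠ S.γ n x)] :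
    ∑' y, g x y = ∑' n, if ∀ k < n, S.γ k x ≠ S.γ n x then g x (S.γ n x) else 0 := by
  classical
  have h1 : ∀ y, g x y = ∑' n, if (∀ k < n, S.γ k x ≠ S.γ n x) ∧ S.γ n x = y then g x y else 0 := by
    intro y
    by_cases hy : S.E x y
    · have hex := (S.hγ x y).1 hy
      rw [tsum_eq_single (Nat.find hex)]
      · rw [if_pos]
        refine ⟨fun k hk => ?_, Nat.find_spec hex⟩
        rw [Nat.find_spec hex]
        exact Nat.find_min hex hk
      · intro n hn
        rw [if_neg]
        rintro ⟨h1, h2⟩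
        have h3 := Nat.find_min' hex h2
        exact h1 _ (lt_of_le_of_ne h3 hn.symm) ((Nat.find_spec hex).trans h2.symm)
    · simp [hE x y hy]
  rw [tsum_congr h1, ENNReal.tsum_comm]
  refine tsum_congr fun n => ?_
  rw [tsum_eq_single (S.γ n x)]
  · simp
  · intro y hy
    rw [if_neg]
    rintro ⟨-, h⟩
    exact hy h.symm

lemma mass_transport {κ : Measure X} (hκ : ∀ j B, MeasurableSet B → κ (S.γ j ⁻¹' B) = κ B)
    {g : X → X → ℝ≥0∞} (hg : Measurable fun p : X × X => g p.1 p.2)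
    (hE : ∀ x y, ¬ S.E x y → g x y = 0) :
    ∫⁻ x, ∑' y, g x y ∂κ = ∫⁻ x, ∑' y, g y x ∂κ := by
  classical
  have hmp : ∀ n, MeasurePreserving (S.γ n) κ κ := fun n => inv_full hκ (S.γ n) (S.E_γ n)
  have e1 : ∀ x, ∑' y, g x y = ∑' n, if ∀ k < n, S.γ k x ≠ S.γ n x then g x (S.γ n x) else 0 :=
    fun x => tsum_formula hE x
  have e2 : ∀ x, ∑' y, g y x = ∑' n, if ∀ k < n, S.γ k x ≠ S.γ n x then g (S.γ n x) x else 0 :=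
    fun x => tsum_formula (g := fun x y => g y x) (fun x y h => hE y x fun h' => h (S.eqv.symm h')) x
  have hD : ∀ n, MeasurableSet {x | ∀ k < n, S.γ k x ≠ S.γ n x} := by
    intro n
    have : {x | ∀ k < n, S.γ k x ≠ S.γ n x} = ⋂ k, ⋂ (_ : k < n), {x | S.γ k x = S.γ n x}ᶜ := by
      ext x; simp
    rw [this]
    refine MeasurableSet.iInter fun k => MeasurableSet.iInter fun _ => MeasurableSet.compl ?_
    exact measurableSet_eq_fun (S.γ k).measurable (S.γ n).measurable
  have m1 : ∀ n, Measurable fun x => if ∀ k < n, S.γ k x ≠ S.γ n x then g x (S.γ n x) else 0 := fun n =>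
    Measurable.ite (hD n) (hg.comp (measurable_id.prodMk (S.γ n).measurable)) measurable_const
  have m2 : ∀ n, Measurable fun x => if ∀ k < n, S.γ k x ≠ S.γ n x then g (S.γ n x) x else 0 := fun n =>
    Measurable.ite (hD n) (hg.comp ((S.γ n).measurable.prodMk measurable_id)) measurable_const
  simp_rw [e1, e2]
  rw [lintegral_tsum fun n => (m1 n).aemeasurable, lintegral_tsum fun n => (m2 n).aemeasurable]
  refine tsum_congr fun n => ?_
  rw [← (hmp n).lintegral_comp (m1 n)]
  refine lintegral_congr fun x => ?_
  have : (∀ k < n, S.γ k (S.γ n x) ≠ x) ↔ ∀ k < n, S.γ k x ≠ S.γ n x := by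
    refine forall₂_congr fun k _ => not_congr ?_
    constructor
    · intro h
      rw [← S.hγ2 k (S.γ n x), h]
    · intro h
      rw [← h, S.hγ2]
  simp only [S.hγ2, this]

theorem comp_excl (hC : S.Comp univ) {κ : Measure X}
    (hκ : ∀ j B, MeasurableSet B → κ (S.γ j ⁻¹' B) = κ B)
    (h0 : ∫⁻ x, S.f x ∂κ ≠ 0) (ht : ∫⁻ x, S.f x ∂κ ≠ ⊤) : False := by
  classical
  obtain ⟨F, ψ, hF, hψm, hψF, hψE, -, hle, hlt⟩ := hC
  obtain ⟨hFe, hFm, hFE, hFf⟩ := id hF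
  let c : X → ℝ≥0∞ := fun x => ws S.f {z | F x z}
  have hcm : Measurable c := meas_ws (S := S) (P := F) S.hfm hFm fun x y h => hFE h
  have hc0 : ∀ x, c x ≠ 0 := fun x => ws_pos S.hf0 ⟨x, hFe.refl x⟩
  have hct : ∀ x, c x ≠ ⊤ := fun x => ws_ne_top S.hft (hFf x)
  have hcF : ∀ x y, F x y → c x = c y := by
    intro x y h
    have : {z | F x z} = {z | F y z} := by
      ext z; exact ⟨fun h' => hFe.trans (hFe.symm h) h', fun h' => hFe.trans h h'⟩
    simp only [c, this]
  have hcs : ∀ x, ws S.f {z | F z x} = c x := by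
    intro x
    have : {z | F x z} = {z | F z x} := by
      ext z; exact ⟨fun h' => hFe.symm h', fun h' => hFe.symm h'⟩
    simp only [c, this]
  have hRm : MeasurableSet {p : X × X | F (ψ p.1) p.2} :=
    (hψm.comp measurable_fst).prodMk measurable_snd hFm
  let g : X → X → ℝ≥0∞ := fun x y => if F (ψ x) y then S.f x * (S.f y / c y) else 0
  have hg : Measurable fun p : X × X => g p.1 p.2 :=
    Measurable.ite hRm ((S.hfm.comp measurable_fst).mul
      ((S.hfm.comp measurable_snd).div (hcm.comp measurable_snd))) measurable_const
  have hgE : ∀ x y, ¬ S.E x y → g x y = 0 := by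
    intro x y h
    simp only [g]
    rw [if_neg]
    exact fun h' => h (S.eqv.trans (hψE x) (hFE h'))
  have hmt := mass_transport hκ hg hgE
  have out : ∀ x, ∑' y, g x y = S.f x := by
    intro x
    have : ∀ y, g x y = (S.f x / c (ψ x)) * ({z | F (ψ x) z} : Set X).indicator S.f y := by
      intro y
      by_cases h : F (ψ x) y
      · simp only [g]
        rw [if_pos h, indicator_of_mem (show y ∈ {z | F (ψ x) z} from h), hcF _ _ h, div_eq_mul_inv, div_eq_mul_inv]
        ring
      · simp only [g]
        rw [if_neg h, indicator_of_notMem (show y ∉ {z | F (ψ x) z} from h), mul_zero]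
    rw [tsum_congr this, ENNReal.tsum_mul_left]
    exact ENNReal.div_mul_cancel (hc0 _) (hct _)
  have inn : ∀ x, ∑' y, g y x = (S.f x / c x) * ws S.f {y | F (ψ y) x} := by
    intro x
    have : ∀ y, g y x = (S.f x / c x) * ({y | F (ψ y) x} : Set X).indicator S.f y := by
      intro y
      by_cases h : F (ψ y) x
      · simp only [g]
        rw [if_pos h, indicator_of_mem (show y ∈ {y | F (ψ y) x} from h), mul_comm]
      · simp only [g]
        rw [if_neg h, indicator_of_notMem (show y ∉ {y | F (ψ y) x} from h), mul_zero]
    rw [tsum_congr this, ENNReal.tsum_mul_left]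
    rfl
  have inle : ∀ x, ∑' y, g y x ≤ S.f x := by
    intro x
    rw [inn]
    calc S.f x / c x * ws S.f {y | F (ψ y) x} ≤ S.f x / c x * c x := by
          gcongr
          rw [← hcs]; exact hle x
      _ = S.f x := ENNReal.div_mul_cancel (hc0 _) (hct _)
  have inlt : ∀ x, ws S.f {z | F (ψ z) x} < ws S.f {z | F z x} → ∑' y, g y x < S.f x := by
    intro x h
    rw [inn]
    have h1 : S.f x / c x ≠ 0 := (ENNReal.div_pos (S.hf0 x) (hct x)).ne'
    have h2 : S.f x / c x ≠ ⊤ := ENNReal.div_ne_top (S.hft x) (hc0 x)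
    calc S.f x / c x * ws S.f {y | F (ψ y) x} < S.f x / c x * c x := by
          rw [hcs] at h; exact (ENNReal.mul_lt_mul_iff_right h1 h2).2 h
      _ = S.f x := ENNReal.div_mul_cancel (hc0 _) (hct _)
  simp only [out] at hmt
  have hae := ae_eq_of_ae_le_of_lintegral_le (Filter.Eventually.of_forall inle)
    (by rw [← hmt]; exact ht) S.hfm.aemeasurable hmt.le
  have hbad : ∀ᵐ x ∂κ, ¬ (∑' y, g y x < S.f x) := by
    filter_upwards [hae] with x hx h
    exact h.ne hx
  have hall : ∀ᵐ x ∂κ, ∀ n, ¬ (∑' y, g y (S.γ n x) < S.f (S.γ n x)) := by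
    rw [ae_all_iff]
    intro n
    exact (inv_full hκ (S.γ n) (S.E_γ n)).quasiMeasurePreserving.ae hbad
  have hF0 : ∀ᵐ x ∂κ, False := by
    filter_upwards [hall] with x hx
    obtain ⟨y, hy, hy2⟩ := hlt x (mem_univ x)
    obtain ⟨n, rfl⟩ := (S.hγ x y).1 hy
    exact hx n (inlt _ hy2)
  apply h0
  rw [lintegral_congr_ae (g := fun _ => 0) (hF0.mono fun x h => h.elim), lintegral_zero]

lemma kappa_of_prob {μ : Measure X} [IsProbabilityMeasure μ]
    (hμ : ∀ T : X ≃ᵐ X, (∀ x, S.E x (T x)) → ∀ B, MeasurableSet B →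
      μ (T '' B) = ∫⁻ x in B, S.f (T x) / S.f x ∂μ) :
    ∃ κ : Measure X, (∀ j B, MeasurableSet B → κ (S.γ j ⁻¹' B) = κ B) ∧
     ∫⁻ x, S.f x ∂κ ≠ 0 ∧ ∫⁻ x, S.f x ∂κ ≠ ⊤ := by
  refine ⟨μ.withDensity fun x => (S.f x)⁻¹, fun j B hB => ?_, ?_⟩
  · have him : ∀ A, S.γ j '' A = S.γ j ⁻¹' A := by
      intro A
      ext y
      constructor
      · rintro ⟨x, hx, rfl⟩
        change S.γ j (S.γ j x) ∈ A
        rwa [S.hγ2]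
      · intro hy; exact ⟨_, hy, S.hγ2 j y⟩
    have hdm : Measurable fun x => S.f (S.γ j x) / S.f x := (S.hfm.comp (S.γ j).measurable).div S.hfm
    have hmap : μ.map (S.γ j) = μ.withDensity fun x => S.f (S.γ j x) / S.f x := by
      ext A hA
      rw [Measure.map_apply (S.γ j).measurable hA, ← him, hμ _ (S.E_γ j) A hA, withDensity_apply _ hA]
    have hB' : MeasurableSet (S.γ j ⁻¹' B) := (S.γ j).measurable hB
    rw [withDensity_apply _ hB, withDensity_apply _ hB']
    have e : ∫⁻ x in S.γ j ⁻¹' B, (S.f x)⁻¹ ∂μ = ∫⁻ x in S.γ j ⁻¹' B, (S.f (S.γ j (S.γ j x)))⁻¹ ∂μ := by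
      simp only [S.hγ2]
    have hm2 : Measurable fun x => (S.f (S.γ j x))⁻¹ := (S.hfm.comp (S.γ j).measurable).inv
    rw [e, ← setLIntegral_map (f := fun x => (S.f (S.γ j x))⁻¹) hB hm2 (S.γ j).measurable, hmap,
      restrict_withDensity hB, lintegral_withDensity_eq_lintegral_mul _ hdm hm2]
    refine lintegral_congr fun x => ?_
    simp only [Pi.mul_apply]
    rw [div_eq_mul_inv, mul_right_comm, ENNReal.mul_inv_cancel (S.hf0 _) (S.hft _), one_mul]
  · have e : ∫⁻ x, S.f x ∂(μ.withDensity fun x => (S.f x)⁻¹) = 1 := by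
      rw [lintegral_withDensity_eq_lintegral_mul _ (show Measurable fun x => (S.f x)⁻¹ from S.hfm.inv) S.hfm]
      have : ∀ x, ((fun x => (S.f x)⁻¹) * S.f) x = 1 := fun x =>
        ENNReal.inv_mul_cancel (S.hf0 x) (S.hft x)
      simp only [this]
      simp
    rw [e]; simp

end Sys
end CocycleNadkarni

namespace CocycleNadkarni

set_option linter.unusedSectionVars false

lemma exists_sys {X : Type*} [MeasurableSpace X] [StandardBorelSpace X] {E : X → X → Prop} (hE : IsCBER E)
    {f : X → ℝ} (hfm : Measurable f) (hf : ∀ x, 0 < f x) :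
    ∃ S : Sys X, S.E = E ∧ ∀ x, S.f x = ENNReal.ofReal (f x) := by
  obtain ⟨γ, h1, h2⟩ := feldman_moore hE
  have hm : Measurable fun x => ENNReal.ofReal (f x) := hfm.ennreal_ofReal
  have h0 : ∀ x, ENNReal.ofReal (f x) ≠ 0 := fun x => (ENNReal.ofReal_pos.2 (hf x)).ne'
  have hex : ∀ x, ∃ n : ℤ, ENNReal.ofReal (f x) ∈ Ico ((2 : ℝ≥0∞) ^ n) (2 ^ (n + 1)) := fun x =>
    ENNReal.exists_mem_Ico_zpow (h0 x) ENNReal.ofReal_ne_top (by norm_num) (by norm_num)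
  choose l hl using hex
  have hlm : Measurable l := by
    refine measurable_to_countable' fun n => ?_
    have : l ⁻¹' {n} = (fun x => ENNReal.ofReal (f x)) ⁻¹' Ico ((2 : ℝ≥0∞) ^ n) (2 ^ (n + 1)) := by
      ext x
      simp only [mem_preimage, mem_singleton_iff]
      constructor
      · rintro rfl; exact hl x
      · intro h
        by_contra hne
        rcases lt_or_gt_of_ne hne with h' | h'
        · exact absurd ((ENNReal.zpow_le_of_le (by norm_num) (by omega : l x + 1 ≤ n)).trans h.1) (not_le.2 (hl x).2)
        · exact absurd ((ENNReal.zpow_le_of_le (by norm_num) (by omega : n + 1 ≤ l x)).trans (hl x).1) (not_le.2 h.2)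
    rw [this]
    exact hm measurableSet_Ico
  exact ⟨⟨E, hE.1, hE.2.1, γ, h1, h2, fun x => ENNReal.ofReal (f x), hm, h0, fun x => ENNReal.ofReal_ne_top,
    l, hlm, fun x => (hl x).1, fun x => (hl x).2⟩, rfl, fun x => rfl⟩

namespace Sys
variable {X : Type*} [MeasurableSpace X] {S : Sys X} [StandardBorelSpace X]

lemma eSize_eq {ρ : X → X → ℝ} (hρ : ∀ x y, S.E x y → ENNReal.ofReal (ρ x y) = S.f x / S.f y)
    {Y : Set X} {z : X} (hY : ∀ y ∈ Y, S.E y z) : eSize ρ Y z = ws S.f Y / S.f z := by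
  unfold eSize ws
  rw [div_eq_mul_inv, ← ENNReal.tsum_mul_right, tsum_subtype Y (fun y => ENNReal.ofReal (ρ y z))]
  refine tsum_congr fun y => ?_
  by_cases h : y ∈ Y
  · rw [indicator_of_mem h, indicator_of_mem h, hρ y z (hY y h), div_eq_mul_inv]
  · rw [indicator_of_notMem h, indicator_of_notMem h, zero_mul]

lemma relSize_eq {ρ : X → X → ℝ} (hρ : ∀ x y, S.E x y → ENNReal.ofReal (ρ x y) = S.f x / S.f y)
    {Y Z : Set X} {z : X} (hY : ∀ y ∈ Y, S.E y z) (hZ : ∀ y ∈ Z, S.E y z) :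
    relSize ρ Y Z z = ws S.f Y / ws S.f Z := by
  unfold relSize
  rw [eSize_eq hρ hY, eSize_eq hρ hZ, ENNReal.div_eq_inv_mul (a := ws S.f Y / S.f z), 
    ENNReal.inv_div (Or.inl (S.hft z)) (Or.inl (S.hf0 z)), div_eq_mul_inv, div_eq_mul_inv, div_eq_mul_inv]
  calc S.f z * (ws S.f Z)⁻¹ * (ws S.f Y * (S.f z)⁻¹) = (S.f z * (S.f z)⁻¹) * (ws S.f Y * (ws S.f Z)⁻¹) := by ring
    _ = _ := by rw [ENNReal.mul_inv_cancel (S.hf0 z) (S.hft z), one_mul]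

lemma div_le_one_iff' {a b : ℝ≥0∞} (h0 : b ≠ 0) (ht : b ≠ ⊤) : a / b ≤ 1 ↔ a ≤ b := by
  rw [ENNReal.div_le_iff h0 ht, one_mul]

lemma div_lt_one_iff' {a b : ℝ≥0∞} (h0 : b ≠ 0) (ht : b ≠ ⊤) : a / b < 1 ↔ a < b := by
  rw [ENNReal.div_lt_iff (Or.inl h0) (Or.inl ht), one_mul]

lemma exists_selector {F : X → X → Prop} (hF : IsFinSubequiv S.E F) :
    ∃ p : X → X, Measurable p ∧ (∀ x, F x (p x)) ∧ ∀ x y, F x y → p x = p y := by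
  classical
  obtain ⟨hFe, hFm, hFE, hFf⟩ := id hF
  obtain ⟨p, h1, h2, h3⟩ := finSel hF (fun b p => ∀ y, S.E b y → (F b y → p y = p b))
    (fun b p q h h' y hy hby => by
      rw [← h y hby, ← h b (hFe.refl b)]; exact h' y hy hby)
    (fun b c p hbc h y hy hcy => by
      rw [h y (S.eqv.trans (hFE hbc) hy) (hFe.trans hbc hcy), h c (hFE hbc) hbc])
    (fun p hp hpF => meas_all (S := S) (P := fun b y => F b y → p y = p b) (by
      have : {q : X × X | F q.1 q.2 → p q.2 = p q.1} = {q : X × X | F q.1 q.2}ᶜ ∪ {q : X × X | p q.2 = p q.1} := by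
        ext q; simp [imp_iff_not_or]
      rw [this]
      exact hFm.compl.union (measurableSet_eq_fun (hp.comp measurable_snd) (hp.comp measurable_fst))))
    (fun b => ⟨fun x => if F b x then b else x, fun x => by
      by_cases h : F b x
      · simp only [h, if_true]; exact hFe.symm h
      · simp only [h, if_false]; exact hFe.refl x, fun y _ hby => by
      simp [hby, hFe.refl b]⟩)
  exact ⟨p, h1, h2, fun x y h => (h3 x y (hFE h) h).symm⟩

/-- the frozen compression condition is equivalent to `Comp univ` -/
lemma comp_iff {ρ : X → X → ℝ} (hρ : ∀ x y, S.E x y → ENNReal.ofReal (ρ x y) = S.f x / S.f y) :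
    (∃ (F : X → X → Prop) (hF : Equivalence F), IsFinSubequiv S.E F ∧
        ∃ φ : Quotient (Setoid.mk F hF) → Quotient (Setoid.mk F hF),
          Measurable φ ∧ (∀ C, (φ ⁻¹' {C}).Finite) ∧
          QuotCompressionOn S.E ρ Set.univ (Setoid.mk F hF) φ) ↔ S.Comp univ := by
  constructor
  · rintro ⟨F, hFe, hF, φ, hφm, hφf, hq1, hq2, hq3⟩
    obtain ⟨p, hpm, hpF, hpc⟩ := exists_selector hF
    obtain ⟨-, hFm, hFE, hFf⟩ := id hF
    let s : Setoid X := Setoid.mk F hFe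
    let p' : Quotient s → X := Quotient.lift p hpc
    have hp' : Measurable p' := measurable_from_quotient.2 hpm
    have hmk : ∀ q : Quotient s, Quotient.mk s (p' q) = q := by
      intro q
      induction q using Quotient.inductionOn with
      | h x => exact Quotient.sound (hFe.symm (hpF x))
    let ψ : X → X := fun x => p' (φ (Quotient.mk s x))
    have hR : ∀ x y, F (ψ x) y ↔ φ (Quotient.mk s x) = Quotient.mk s y := by
      intro x y
      rw [← hmk (φ (Quotient.mk s x))]
      exact (Quotient.eq (r := s)).symm
    have hRE : ∀ x y, F (ψ x) y → S.E x y := fun x y h => (hq1 (mem_univ x) y ((hR x y).1 h)).1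
    have hset : ∀ x, {y | y ∈ (univ : Set X) ∧ φ (Quotient.mk s y) = Quotient.mk s x} = {y | F (ψ y) x} := by
      intro x; ext y
      exact ⟨fun h => (hR y x).2 h.2, fun h => ⟨mem_univ _, (hR y x).1 h⟩⟩
    have hrel : ∀ x, relSize ρ {y | y ∈ (univ : Set X) ∧ φ (Quotient.mk s y) = Quotient.mk s x} {y | s.r y x} x =
        ws S.f {y | F (ψ y) x} / ws S.f {y | F y x} := by
      intro x
      rw [hset]
      exact relSize_eq hρ (fun y hy => hRE y x hy) fun y hy => hFE hy
    have hfin : ∀ x, {y | F y x}.Finite := fun x => by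
      have : {y | F y x} = {y | F x y} := by ext z; exact ⟨fun h => hFe.symm h, fun h => hFe.symm h⟩
      rw [this]; exact hFf x
    have p0 : ∀ x, ws S.f {y | F y x} ≠ 0 := fun x => ws_pos S.hf0 ⟨x, hFe.refl x⟩
    have pt : ∀ x, ws S.f {y | F y x} ≠ ⊤ := fun x => ws_ne_top S.hft (hfin x)
    refine ⟨F, ψ, hF, hp'.comp (hφm.comp measurable_quotient_mk''), fun x y h => ?_, fun x => hRE x _ (hFe.refl _),
      fun x => ?_, fun x => ?_, fun x _ => ?_⟩
    · have : Quotient.mk s x = Quotient.mk s y := Quotient.sound h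
      simp only [ψ]
      rw [this]; exact hFe.refl _
    · have e : {y | F (ψ y) x} = (fun y => Quotient.mk s y) ⁻¹' (φ ⁻¹' {Quotient.mk s x}) := by
        ext y; exact hR y x
      rw [e]
      refine (hφf _).preimage' fun C _ => ?_
      induction C using Quotient.inductionOn with
      | h z =>
        refine (hfin z).subset fun y hy => ?_
        exact (Quotient.eq (r := s)).1 hy
    · exact (div_le_one_iff' (p0 x) (pt x)).1 (hrel x ▸ hq2 (mem_univ x))
    · obtain ⟨y, -, hy, hlt⟩ := hq3 (mem_univ x)
      exact ⟨y, hy, (div_lt_one_iff' (p0 y) (pt y)).1 (hrel y ▸ hlt)⟩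
  · rintro ⟨F, ψ, hF, hψm, hψF, hψE, hψf, hle, hlt⟩
    obtain ⟨hFe, hFm, hFE, hFf⟩ := id hF
    let s : Setoid X := Setoid.mk F hFe
    let φ : Quotient s → Quotient s := Quotient.map ψ hψF
    have hR : ∀ x y, φ (Quotient.mk s x) = Quotient.mk s y ↔ F (ψ x) y := by
      intro x y
      exact Quotient.eq (r := s)
    have hRE : ∀ x y, F (ψ x) y → S.E x y := fun x y h => S.eqv.trans (hψE x) (hFE h)
    have hset : ∀ x, {y | y ∈ (univ : Set X) ∧ φ (Quotient.mk s y) = Quotient.mk s x} = {y | F (ψ y) x} := by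
      intro x; ext y
      exact ⟨fun h => (hR y x).1 h.2, fun h => ⟨mem_univ _, (hR y x).2 h⟩⟩
    have hrel : ∀ x, relSize ρ {y | y ∈ (univ : Set X) ∧ φ (Quotient.mk s y) = Quotient.mk s x} {y | s.r y x} x =
        ws S.f {y | F (ψ y) x} / ws S.f {y | F y x} := by
      intro x
      rw [hset]
      exact relSize_eq hρ (fun y hy => hRE y x hy) fun y hy => hFE hy
    have hfin : ∀ x, {y | F y x}.Finite := fun x => by
      have : {y | F y x} = {y | F x y} := by ext z; exact ⟨fun h => hFe.symm h, fun h => hFe.symm h⟩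
      rw [this]; exact hFf x
    have p0 : ∀ x, ws S.f {y | F y x} ≠ 0 := fun x => ws_pos S.hf0 ⟨x, hFe.refl x⟩
    have pt : ∀ x, ws S.f {y | F y x} ≠ ⊤ := fun x => ws_ne_top S.hft (hfin x)
    refine ⟨F, hFe, hF, φ, measurable_from_quotient.2 (measurable_quotient_mk''.comp hψm), fun C => ?_,
      fun x _ y h => ⟨hRE x y ((hR x y).1 h), mem_univ _⟩, fun x _ => ?_, fun x _ => ?_⟩
    · induction C using Quotient.inductionOn with
      | h x =>
        refine ((hψf x).image (Quotient.mk s)).subset fun D hD => ?_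
        induction D using Quotient.inductionOn with
        | h y => exact ⟨y, (hR y x).1 hD, rfl⟩
    · exact (hrel x).trans_le ((div_le_one_iff' (p0 x) (pt x)).2 (hle x))
    · obtain ⟨y, hy, h⟩ := hlt x (mem_univ x)
      exact ⟨y, mem_univ _, hy, (hrel y).trans_lt ((div_lt_one_iff' (p0 y) (pt y)).2 h)⟩

end Sys

theorem stmt1' {X : Type*} [MeasurableSpace X] [StandardBorelSpace X]
    (E : X → X → Prop) (hE : IsCBER E)
    (ρ : X → X → ℝ)
    (hcob : ∃ f : X → ℝ, Measurable f ∧ (∀ x, 0 < f x) ∧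
      ∀ ⦃x y : X⦄, E x y → ρ x y = f x / f y) :
    Xor'
      (∃ (F : X → X → Prop) (hF : Equivalence F), IsFinSubequiv E F ∧
        ∃ φ : Quotient (Setoid.mk F hF) → Quotient (Setoid.mk F hF),
          Measurable φ ∧ (∀ C, (φ ⁻¹' {C}).Finite) ∧
          QuotCompressionOn E ρ Set.univ (Setoid.mk F hF) φ)
      (∃ μ : Measure X, IsProbabilityMeasure μ ∧ IsInvariant E ρ μ) := by
  obtain ⟨f, hfm, hf, hfρ⟩ := hcob
  obtain ⟨S, rfl, hSf⟩ := exists_sys hE hfm hf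
  have hρ' : ∀ x y, S.E x y → ENNReal.ofReal (ρ x y) = S.f x / S.f y := by
    intro x y h
    rw [hfρ h, hSf, hSf, ENNReal.ofReal_div_of_pos (hf y)]
  have hinv : ∀ μ : Measure X, IsInvariant S.E ρ μ ↔
      ∀ T : X ≃ᵐ X, (∀ x, S.E x (T x)) → ∀ B, MeasurableSet B →
      μ (T '' B) = ∫⁻ x in B, S.f (T x) / S.f x ∂μ := by
    intro μ
    unfold IsInvariant
    constructor
    · intro h T hT B hB
      rw [h T (fun x => S.eqv.symm (hT x)) B hB]
      exact lintegral_congr fun x => hρ' _ _ (S.eqv.symm (hT x))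
    · intro h T hT B hB
      rw [h T (fun x => S.eqv.symm (hT x)) B hB]
      exact lintegral_congr fun x => (hρ' _ _ (hT x)).symm
  rw [Sys.comp_iff hρ']
  simp only [hinv]
  by_cases hC : S.Comp univ
  · refine Or.inl ⟨hC, ?_⟩
    rintro ⟨μ, hμ, h⟩
    obtain ⟨κ, h1, h2, h3⟩ := Sys.kappa_of_prob h
    exact Sys.comp_excl hC h1 h2 h3
  · exact Or.inr ⟨Sys.dichotomy hC, hC⟩

end CocycleNadkarni

namespace CocycleNadkarni

variable {X : Type*} {Γ : Type*}

/-- Nadkarni's theorem for Borel coboundaries: either there is a finite-to-one Borel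
compression of the quotient of `ρ` by a finite Borel subequivalence relation of `E`,
or there is a `ρ`-invariant Borel probability measure -- and not both. -/
theorem stmt1 [MeasurableSpace X] [StandardBorelSpace X]
    (E : X → X → Prop) (hE : IsCBER E)
    (ρ : X → X → ℝ) (hρ : IsCocycle E ρ)
    (hcob : ∃ f : X → ℝ, Measurable f ∧ (∀ x, 0 < f x) ∧
      ∀ ⦃x y : X⦄, E x y → ρ x y = f x / f y) :
    Xor'
      (∃ (F : X → X → Prop) (hF : Equivalence F), IsFinSubequiv E F ∧
        ∃ φ : Quotient (Setoid.mk F hF) → Quotient (Setoid.mk F hF),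
          Measurable φ ∧ (∀ C, (φ ⁻¹' {C}).Finite) ∧
          QuotCompressionOn E ρ Set.univ (Setoid.mk F hF) φ)
      (∃ μ : Measure X, IsProbabilityMeasure μ ∧ IsInvariant E ρ μ) := by
  exact stmt1' E hE ρ hcob

end CocycleNadkarni
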